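/- arXiv:1409.4934 — 5 statements merged into one kernel-verified Lean document; each statement's English description precedes it below -/
import Mathlib

section
/- Assume that ∫_0^1 g(t)^{−1/m} t^{1/m−1} dt < ∞ and that ∫_a^∞ ξ^{m−1} f(ξ) μ(ξ)^{1/m−1} dξ = ∞. Then every nontrivial Kneser solution w is singular of the first kind, i.e. there exists R ≥ a such that w(r) = 0 for all r ≥ R. -/
open MeasureTheory Filter Set

/-- The essential supremum of a real-valued function over a set (w.r.t. Lebesgue measure). -/
noncomputable def essSupOn (b : ℝ → ℝ) (s : Set ℝ) : ℝ :=
  essSup b (volume.restrict s)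

/-- `g t = inf_{(t/θ, θ t)} h`. -/
noncomputable def gFun (θ : ℝ) (h : ℝ → ℝ) (t : ℝ) : ℝ :=
  sInf (h '' Ioo (t / θ) (θ * t))

/-- `f r = q r / (1 + ∑_{i=1}^{m-1} r^{m-i} ess sup_{(r/σ, rσ) ∩ [a,∞)} b_i)`. -/
noncomputable def fFun (m : ℕ) (a σ : ℝ) (q : ℝ → ℝ) (b : ℕ → ℝ → ℝ) (r : ℝ) : ℝ :=
  q r / (1 + ∑ i ∈ Finset.Ico 1 m, r ^ (m - i) * essSupOn (b i) (Ioo (r / σ) (r * σ) ∩ Ici a))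

/-- `μ r = 1 + r^m ess sup_{(r/σ, r) ∩ [a,∞)} f`. -/
noncomputable def muFun (m : ℕ) (a σ : ℝ) (q : ℝ → ℝ) (b : ℕ → ℝ → ℝ) (r : ℝ) : ℝ :=
  1 + r ^ m * essSupOn (fFun m a σ q b) (Ioo (r / σ) r ∩ Ici a)

/-- A Kneser solution of `w^{(m)} = Q(r, w, …, w^{(m-1)})` on `[a, ∞)`:
`w` is `m` times differentiable, its derivatives up to order `m-1` are locally absolutely
continuous on `[a, ∞)` (expressed by the fundamental-theorem-of-calculus identities, with
`w^{(m)}` locally integrable), `(-1)^i w^{(i)} ≥ 0` on `[a, ∞)` for `i = 0, …, m-1`, and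
`(-1)^m w^{(m)}(r) ≥ q(r) h(w(r)) - ∑_{i=1}^{m-1} b_i(r) |w^{(i)}(r)|` for a.e. `r ≥ a`
with `w r > 0`. -/
def IsKneser (m : ℕ) (a : ℝ) (q : ℝ → ℝ) (b : ℕ → ℝ → ℝ) (h : ℝ → ℝ) (w : ℝ → ℝ) : Prop :=
  (∀ i < m, Differentiable ℝ (iteratedDeriv i w)) ∧
  (∀ r, a ≤ r → IntervalIntegrable (iteratedDeriv m w) volume a r) ∧
  (∀ i < m, ∀ r, a ≤ r →
    iteratedDeriv i w r = iteratedDeriv i w a + ∫ ξ in a..r, iteratedDeriv (i + 1) w ξ) ∧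
  (∀ i < m, ∀ r, a ≤ r → 0 ≤ (-1 : ℝ) ^ i * iteratedDeriv i w r) ∧
  (∀ᵐ r ∂(volume.restrict (Ici a)), 0 < w r →
    q r * h (w r) - ∑ i ∈ Finset.Ico 1 m, b i r * |iteratedDeriv i w r|
      ≤ (-1 : ℝ) ^ m * iteratedDeriv m w r)

lemma essSupOn_set_eq (b : ℝ → ℝ) (s : Set ℝ) :
    essSupOn b s = sInf {c : ℝ | ∀ᵐ x ∂(volume.restrict s), b x ≤ c} := by
  unfold essSupOn essSup
  rw [Filter.limsup_eq]

lemma essSupOn_zero {b : ℝ → ℝ} {s : Set ℝ} (hz : volume.restrict s = 0) :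
    essSupOn b s = 0 := by
  rw [essSupOn_set_eq, hz]
  simp

lemma nonneg_of_ae_le {b : ℝ → ℝ} {s : Set ℝ} (hz : volume.restrict s ≠ 0)
    (h0 : ∀ᵐ x ∂(volume.restrict s), 0 ≤ b x) {c : ℝ}
    (hc : ∀ᵐ x ∂(volume.restrict s), b x ≤ c) : 0 ≤ c := by
  have : (ae (volume.restrict s)).NeBot := ae_neBot.2 hz
  obtain ⟨x, hx1, hx2⟩ := (h0.and hc).exists
  linarith

lemma essSupOn_nonneg {b : ℝ → ℝ} {s : Set ℝ}
    (h0 : ∀ᵐ x ∂(volume.restrict s), 0 ≤ b x) : 0 ≤ essSupOn b s := by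
  by_cases hz : volume.restrict s = 0
  · rw [essSupOn_zero hz]
  · rw [essSupOn_set_eq]
    apply Real.sInf_nonneg
    intro c hc
    exact nonneg_of_ae_le hz h0 hc

lemma essSupOn_le {b : ℝ → ℝ} {s : Set ℝ} {c : ℝ} (hc : 0 ≤ c)
    (h0 : ∀ᵐ x ∂(volume.restrict s), 0 ≤ b x)
    (h1 : ∀ᵐ x ∂(volume.restrict s), b x ≤ c) : essSupOn b s ≤ c := by
  by_cases hz : volume.restrict s = 0
  · rw [essSupOn_zero hz]; exact hc
  · rw [essSupOn_set_eq]
    exact csInf_le ⟨0, fun d hd => nonneg_of_ae_le hz h0 hd⟩ h1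

lemma ae_le_essSupOn {b : ℝ → ℝ} {s : Set ℝ} {M : ℝ}
    (h1 : ∀ᵐ x ∂(volume.restrict s), b x ≤ M) :
    ∀ᵐ x ∂(volume.restrict s), b x ≤ essSupOn b s := by
  exact ae_le_essSup ⟨M, h1⟩

lemma null_of_left_null (S : Set ℝ)
    (hS : ∀ s ∈ S, ∃ ε > 0, volume (S ∩ Ioo (s - ε) s) = 0) : volume S = 0 := by
  choose! ε hε hn using hS
  obtain ⟨T, hTS, hTc, hTe⟩ := TopologicalSpace.isOpen_biUnion_countable S
    (fun s => Ioo (s - ε s) s) (fun s _ => isOpen_Ioo)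
  have h1 : volume (⋃ s ∈ T, S ∩ Ioo (s - ε s) s) = 0 :=
    (measure_biUnion_null_iff hTc).2 (fun s hs => hn s (hTS hs))
  have h2 : (S \ ⋃ s ∈ S, Ioo (s - ε s) s).Countable := by
    apply Set.PairwiseDisjoint.countable_of_isOpen (s := fun s => Ioo (s - ε s) s)
    · intro x hx y hy hxy
      have key : ∀ x ∈ (S \ ⋃ s ∈ S, Ioo (s - ε s) s), ∀ y ∈ (S \ ⋃ s ∈ S, Ioo (s - ε s) s),
          x < y → x ≤ y - ε y := by
        intro x hx y hy hxy
        by_contra hc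
        apply hx.2
        simp only [mem_iUnion]
        exact ⟨y, hy.1, not_le.1 hc, hxy⟩
      rw [Function.onFun, Set.disjoint_left]
      rintro z ⟨hz1, hz2⟩ ⟨hz3, hz4⟩
      rcases lt_or_gt_of_ne hxy with h | h
      · have := key x hx y hy h
        linarith
      · have := key y hy x hx h
        linarith
    · intro s _; exact isOpen_Ioo
    · intro s hs
      have := hε s hs.1
      exact nonempty_Ioo.2 (by linarith)
  have h3 : S ⊆ (⋃ s ∈ T, S ∩ Ioo (s - ε s) s) ∪ (S \ ⋃ s ∈ S, Ioo (s - ε s) s) := by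
    intro x hx
    by_cases hxT : x ∈ ⋃ s ∈ S, Ioo (s - ε s) s
    · left
      rw [← hTe] at hxT
      simp only [mem_iUnion] at hxT ⊢
      obtain ⟨s, hs, h⟩ := hxT
      exact ⟨s, hs, hx, h⟩
    · right; exact ⟨hx, hxT⟩
  exact measure_mono_null h3 (measure_union_null h1 (h2.measure_zero _))

lemma ae_le_left_essSup {F : ℝ → ℝ} {a σ : ℝ} (ha : 0 < a) (hσ : 1 < σ)
    (hF : ∀ r, ∃ M, ∀ᵐ x ∂(volume.restrict (Icc a r)), F x ≤ M) :
    ∀ᵐ s, a < s → F s ≤ essSupOn F (Ioo (s / σ) s ∩ Ici a) := by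
  have key : ∀ p : ℚ, volume {s | a < s ∧ (p : ℝ) < F s ∧
      essSupOn F (Ioo (s / σ) s ∩ Ici a) < p} = 0 := by
    intro p
    apply null_of_left_null
    rintro s ⟨has, hps, hsp⟩
    have hs0 : 0 < s := ha.trans has
    have hd : s / σ < s := div_lt_self hs0 hσ
    refine ⟨min (s - a) (s - s / σ), lt_min (by linarith) (by linarith), ?_⟩
    obtain ⟨M, hM⟩ := hF s
    have h1 : ∀ᵐ x ∂(volume.restrict (Ioo (s / σ) s ∩ Ici a)), F x ≤ M := by
      have hsub : Ioo (s / σ) s ∩ Ici a ⊆ Icc a s := fun x hx => ⟨hx.2, hx.1.2.le⟩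
      exact ae_restrict_of_ae_restrict_of_subset hsub hM
    have h2 := ae_le_essSupOn h1
    rw [ae_restrict_iff' (measurableSet_Ioo.inter measurableSet_Ici)] at h2
    refine measure_mono_null ?_ (ae_iff.1 h2)
    rintro x ⟨⟨hx1, hx2, hx3⟩, hx4, hx5⟩
    simp only [mem_ofPred_eq, not_forall, not_le]
    have e1 := min_le_left (s - a) (s - s / σ)
    have e2 := min_le_right (s - a) (s - s / σ)
    exact ⟨⟨⟨by linarith, hx5⟩, hx1.le⟩, by linarith⟩
  have h2 := ae_all_iff.2 (fun p : ℚ => (ae_iff (p := fun s => ¬ (a < s ∧ (p : ℝ) < F s ∧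
      essSupOn F (Ioo (s / σ) s ∩ Ici a) < p))).2 (by simpa using key p))
  filter_upwards [h2] with s hs has
  by_contra hc
  obtain ⟨p, hp1, hp2⟩ := exists_rat_btwn (not_le.1 hc)
  exact hs p ⟨has, hp2, hp1⟩

section fmu
variable {m : ℕ} {a σ : ℝ} {q : ℝ → ℝ} {b : ℕ → ℝ → ℝ}

lemma window_nonneg (hb_nonneg : ∀ i r, a ≤ r → 0 ≤ b i r) (i : ℕ) (r : ℝ) :
    0 ≤ essSupOn (b i) (Ioo (r / σ) (r * σ) ∩ Ici a) := by
  apply essSupOn_nonneg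
  filter_upwards [ae_restrict_mem (measurableSet_Ioo.inter measurableSet_Ici)] with x hx
  exact hb_nonneg i x hx.2

lemma one_le_den (ha : 0 < a) (hb_nonneg : ∀ i r, a ≤ r → 0 ≤ b i r) {r : ℝ} (hr : a ≤ r) :
    1 ≤ 1 + ∑ i ∈ Finset.Ico 1 m, r ^ (m - i) * essSupOn (b i) (Ioo (r / σ) (r * σ) ∩ Ici a) := by
  have : 0 ≤ ∑ i ∈ Finset.Ico 1 m,
      r ^ (m - i) * essSupOn (b i) (Ioo (r / σ) (r * σ) ∩ Ici a) := by
    apply Finset.sum_nonneg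
    intro i _
    have hr0 : 0 ≤ r := ha.le.trans hr
    exact mul_nonneg (pow_nonneg hr0 _) (window_nonneg hb_nonneg i r)
  linarith

lemma fFun_nonneg (ha : 0 < a) (hq_nonneg : ∀ r, a ≤ r → 0 ≤ q r)
    (hb_nonneg : ∀ i r, a ≤ r → 0 ≤ b i r) {r : ℝ} (hr : a ≤ r) : 0 ≤ fFun m a σ q b r := by
  unfold fFun
  exact div_nonneg (hq_nonneg r hr) (zero_le_one.trans (one_le_den ha hb_nonneg hr))

lemma fFun_le_q (ha : 0 < a) (hq_nonneg : ∀ r, a ≤ r → 0 ≤ q r)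
    (hb_nonneg : ∀ i r, a ≤ r → 0 ≤ b i r) {r : ℝ} (hr : a ≤ r) : fFun m a σ q b r ≤ q r := by
  unfold fFun
  exact div_le_self (hq_nonneg r hr) (one_le_den ha hb_nonneg hr)

lemma fFun_loc (ha : 0 < a) (hq_nonneg : ∀ r, a ≤ r → 0 ≤ q r)
    (hb_nonneg : ∀ i r, a ≤ r → 0 ≤ b i r)
    (hq_loc : ∀ r, ∃ M, ∀ᵐ x ∂(volume.restrict (Icc a r)), q x ≤ M) :
    ∀ r, ∃ M, ∀ᵐ x ∂(volume.restrict (Icc a r)), fFun m a σ q b x ≤ M := by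
  intro r
  obtain ⟨M, hM⟩ := hq_loc r
  refine ⟨M, ?_⟩
  filter_upwards [hM, ae_restrict_mem measurableSet_Icc] with x hx hx2
  exact (fFun_le_q ha hq_nonneg hb_nonneg hx2.1).trans hx

lemma E_nonneg (ha : 0 < a) (hq_nonneg : ∀ r, a ≤ r → 0 ≤ q r)
    (hb_nonneg : ∀ i r, a ≤ r → 0 ≤ b i r) (s : ℝ) :
    0 ≤ essSupOn (fFun m a σ q b) (Ioo (s / σ) s ∩ Ici a) := by
  apply essSupOn_nonneg
  filter_upwards [ae_restrict_mem (measurableSet_Ioo.inter measurableSet_Ici)] with x hx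
  exact fFun_nonneg ha hq_nonneg hb_nonneg hx.2

lemma one_le_mu (ha : 0 < a) (hq_nonneg : ∀ r, a ≤ r → 0 ≤ q r)
    (hb_nonneg : ∀ i r, a ≤ r → 0 ≤ b i r) {s : ℝ} (hs : a ≤ s) :
    1 ≤ muFun m a σ q b s := by
  have := mul_nonneg (pow_nonneg (ha.le.trans hs) m)
    (E_nonneg (m := m) (σ := σ) ha hq_nonneg hb_nonneg s)
  unfold muFun
  linarith

/-- `f ≤ σ^m q / D` on a short interval, `D` the constant for the interval. -/
lemma fFun_le_const (ha : 0 < a) (hσ : 1 < σ) (hq_nonneg : ∀ r, a ≤ r → 0 ≤ q r)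
    (hb_nonneg : ∀ i r, a ≤ r → 0 ≤ b i r)
    (hb_loc : ∀ i r, ∃ M, ∀ᵐ x ∂(volume.restrict (Icc a r)), b i x ≤ M)
    {r0 r2 : ℝ} (h0 : a ≤ r0) (h2 : r2 ≤ σ * r0) {ξ : ℝ} (hξ : ξ ∈ Ioo r0 r2) :
    fFun m a σ q b ξ ≤ σ ^ m * (q ξ /
      (1 + ∑ i ∈ Finset.Ico 1 m, essSupOn (b i) (Ioo r0 r2) * r2 ^ (m - i))) := by
  have hξa : a ≤ ξ := h0.trans hξ.1.le
  have hr00 : 0 < r0 := ha.trans_le h0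
  have hξ0 : 0 < ξ := ha.trans_le hξa
  have hσ0 : 0 < σ := by linarith
  have hsub : Ioo r0 r2 ⊆ Ioo (ξ / σ) (ξ * σ) ∩ Ici a := by
    rintro x ⟨hx1, hx2⟩
    refine ⟨⟨?_, ?_⟩, h0.trans hx1.le⟩
    · rw [div_lt_iff₀ hσ0]
      nlinarith [hξ.2]
    · nlinarith [hξ.1]
  have hB0 : ∀ i, 0 ≤ essSupOn (b i) (Ioo r0 r2) := by
    intro i
    apply essSupOn_nonneg
    filter_upwards [ae_restrict_mem measurableSet_Ioo] with x hx
    exact hb_nonneg i x (h0.trans hx.1.le)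
  have hBle : ∀ i, essSupOn (b i) (Ioo r0 r2) ≤
      essSupOn (b i) (Ioo (ξ / σ) (ξ * σ) ∩ Ici a) := by
    intro i
    apply essSupOn_le (window_nonneg hb_nonneg i ξ)
    · filter_upwards [ae_restrict_mem measurableSet_Ioo] with x hx
      exact hb_nonneg i x (h0.trans hx.1.le)
    · obtain ⟨M, hM⟩ := hb_loc i (ξ * σ)
      apply ae_restrict_of_ae_restrict_of_subset hsub
      apply ae_le_essSupOn (M := M)
      have hsub2 : Ioo (ξ / σ) (ξ * σ) ∩ Ici a ⊆ Icc a (ξ * σ) := fun x hx => ⟨hx.2, hx.1.2.le⟩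
      exact ae_restrict_of_ae_restrict_of_subset hsub2 hM
  have hr20 : 0 ≤ r2 := by linarith [hξ.1, hξ.2]
  have hDpos : 0 < 1 + ∑ i ∈ Finset.Ico 1 m, essSupOn (b i) (Ioo r0 r2) * r2 ^ (m - i) := by
    have : 0 ≤ ∑ i ∈ Finset.Ico 1 m, essSupOn (b i) (Ioo r0 r2) * r2 ^ (m - i) :=
      Finset.sum_nonneg (fun i _ => mul_nonneg (hB0 i) (pow_nonneg hr20 _))
    linarith
  have hDle : 1 + ∑ i ∈ Finset.Ico 1 m, essSupOn (b i) (Ioo r0 r2) * r2 ^ (m - i) ≤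
      σ ^ m * (1 + ∑ i ∈ Finset.Ico 1 m,
        ξ ^ (m - i) * essSupOn (b i) (Ioo (ξ / σ) (ξ * σ) ∩ Ici a)) := by
    rw [mul_add, Finset.mul_sum]
    apply add_le_add
    · rw [mul_one]; exact one_le_pow₀ hσ.le
    · apply Finset.sum_le_sum
      intro i _
      have e1 : r2 ^ (m - i) ≤ σ ^ m * ξ ^ (m - i) := by
        calc r2 ^ (m - i) ≤ (σ * ξ) ^ (m - i) := by
              apply pow_le_pow_left₀ hr20
              nlinarith [hξ.1]
          _ = σ ^ (m - i) * ξ ^ (m - i) := mul_pow _ _ _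
          _ ≤ σ ^ m * ξ ^ (m - i) := by
              apply mul_le_mul_of_nonneg_right _ (pow_nonneg hξ0.le _)
              exact pow_le_pow_right₀ hσ.le (Nat.sub_le _ _)
      calc essSupOn (b i) (Ioo r0 r2) * r2 ^ (m - i)
          ≤ essSupOn (b i) (Ioo (ξ / σ) (ξ * σ) ∩ Ici a) * (σ ^ m * ξ ^ (m - i)) :=
            mul_le_mul (hBle i) e1 (pow_nonneg hr20 _) (window_nonneg hb_nonneg i ξ)
        _ = _ := by ring
  have hD1 := one_le_den (m := m) (σ := σ) ha hb_nonneg hξa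
  unfold fFun
  rw [← mul_div_assoc, div_le_div_iff₀ (by linarith) hDpos]
  calc _ ≤ q ξ * (σ ^ m * (1 + ∑ i ∈ Finset.Ico 1 m,
        ξ ^ (m - i) * essSupOn (b i) (Ioo (ξ / σ) (ξ * σ) ∩ Ici a))) :=
        mul_le_mul_of_nonneg_left hDle (hq_nonneg ξ hξa)
    _ = _ := by ring

end fmu

lemma intervalIntegrable_of_bdd {v : ℝ → ℝ} {a r0 r2 M : ℝ} (hv : Measurable v)
    (hv0 : ∀ r, a ≤ r → 0 ≤ v r) (hM : ∀ᵐ x ∂(volume.restrict (Icc a r2)), v x ≤ M)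
    (h0 : a ≤ r0) (h2 : r0 ≤ r2) : IntervalIntegrable v volume r0 r2 := by
  rw [intervalIntegrable_iff_integrableOn_Ioc_of_le h2]
  have hsub : Ioc r0 r2 ⊆ Icc a r2 := fun x hx => ⟨h0.trans hx.1.le, hx.2⟩
  refine Measure.integrableOn_of_bounded (M := M) (by simp) hv.aestronglyMeasurable ?_
  filter_upwards [ae_restrict_of_ae_restrict_of_subset hsub hM,
    ae_restrict_mem measurableSet_Ioc] with x hx hx2
  rw [Real.norm_of_nonneg (hv0 x (hsub hx2).1)]
  exact hx

section kneser
variable {m : ℕ} {a : ℝ} {q : ℝ → ℝ} {b : ℕ → ℝ → ℝ} {h w : ℝ → ℝ}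

lemma kneser_hasDeriv (hw : IsKneser m a q b h w) {i : ℕ} (hi : i < m) (x : ℝ) :
    HasDerivAt (fun ξ => (-1 : ℝ) ^ i * iteratedDeriv i w ξ)
      (-((-1 : ℝ) ^ (i + 1) * iteratedDeriv (i + 1) w x)) x := by
  have h1 := (hw.1 i hi x).hasDerivAt.const_mul ((-1 : ℝ) ^ i)
  rw [← iteratedDeriv_succ] at h1
  refine h1.congr_deriv ?_
  rw [pow_succ]
  ring

lemma kneser_intble (hw : IsKneser m a q b h w) {i : ℕ} (hi : i ≤ m) {r0 r2 : ℝ}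
    (h0 : a ≤ r0) (h2 : r0 ≤ r2) :
    IntervalIntegrable (fun ξ => (-1 : ℝ) ^ i * iteratedDeriv i w ξ) volume r0 r2 := by
  apply IntervalIntegrable.const_mul
  rcases hi.lt_or_eq with hi | rfl
  · exact (hw.1 i hi).continuous.intervalIntegrable _ _
  · apply (hw.2.1 r2 (h0.trans h2)).mono_set
    rw [uIcc_of_le h2, uIcc_of_le (h0.trans h2)]
    exact Icc_subset_Icc_left h0

lemma kneser_parts (hw : IsKneser m a q b h w) {r0 r2 : ℝ} (h0 : a ≤ r0) (h2 : r0 ≤ r2) (i : ℕ) :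
    i + 1 ≤ m → ∫ ξ in r0..r2, (ξ - r0) ^ i * ((-1 : ℝ) ^ (i + 1) * iteratedDeriv (i + 1) w ξ) ≤
      (i.factorial : ℝ) * (w r0 - w r2) := by
  induction i with
  | zero =>
    intro hi
    have e := intervalIntegral.integral_eq_sub_of_hasDerivAt (a := r0) (b := r2)
      (fun x _ => (kneser_hasDeriv hw (i := 0) (by omega) x).neg)
      (by simpa using kneser_intble hw (i := 1) hi h0 h2)
    simp only [neg_neg] at e
    simp only [pow_zero, one_mul, Nat.factorial_zero, Nat.cast_one, zero_add] at e ⊢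
    rw [e]
    simp
  | succ i ih =>
    intro hi
    have ih := ih (by omega)
    have e := intervalIntegral.integral_mul_deriv_eq_deriv_mul (a := r0) (b := r2)
      (u := fun ξ => (ξ - r0) ^ (i + 1)) (u' := fun ξ => ((i + 1 : ℕ) : ℝ) * (ξ - r0) ^ i)
      (v := fun ξ => - ((-1 : ℝ) ^ (i + 1) * iteratedDeriv (i + 1) w ξ))
      (v' := fun ξ => (-1 : ℝ) ^ (i + 1 + 1) * iteratedDeriv (i + 1 + 1) w ξ)
      (fun x _ => (((hasDerivAt_id x).sub_const r0).pow (i + 1)).congr_deriv (by simp))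
      (fun x _ => ((kneser_hasDeriv hw (i := i + 1) (by omega) x).neg).congr_deriv (by simp))
      (by apply Continuous.intervalIntegrable; fun_prop)
      (kneser_intble hw hi h0 h2)
    rw [e]
    have e2 : ∫ x in r0..r2, ((i + 1 : ℕ) : ℝ) * (x - r0) ^ i *
        -((-1 : ℝ) ^ (i + 1) * iteratedDeriv (i + 1) w x) =
        -(((i + 1 : ℕ) : ℝ) * ∫ x in r0..r2, (x - r0) ^ i *
          ((-1 : ℝ) ^ (i + 1) * iteratedDeriv (i + 1) w x)) := by
      rw [← intervalIntegral.integral_const_mul, ← intervalIntegral.integral_neg]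
      congr 1
      ext x
      ring
    rw [e2]
    have e3 := hw.2.2.2.1 (i + 1) (by omega) r2 (h0.trans h2)
    have e4 : 0 ≤ (r2 - r0) ^ (i + 1) := pow_nonneg (by linarith) _
    have e5 := mul_nonneg e4 e3
    have e6 := mul_le_mul_of_nonneg_left ih (Nat.cast_nonneg (α := ℝ) (i + 1))
    rw [Nat.factorial_succ, Nat.cast_mul, mul_assoc]
    simp only [sub_self, ne_eq, Nat.add_eq_zero_iff, one_ne_zero, and_false, not_false_eq_true,
      zero_pow, zero_mul, sub_zero]
    linarith

lemma kneser_antitone (hm : 2 ≤ m) (hw : IsKneser m a q b h w) {r0 r2 : ℝ} (h0 : a ≤ r0)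
    (h2 : r0 ≤ r2) : w r2 ≤ w r0 := by
  have e := kneser_parts hw h0 h2 0 (by omega)
  have : 0 ≤ ∫ ξ in r0..r2, (ξ - r0) ^ 0 * ((-1 : ℝ) ^ (0 + 1) * iteratedDeriv (0 + 1) w ξ) := by
    apply intervalIntegral.integral_nonneg h2
    intro u hu
    rw [pow_zero, one_mul]
    exact hw.2.2.2.1 (0 + 1) (by omega) u (h0.trans hu.1)
  simp only [Nat.factorial_zero, Nat.cast_one, one_mul] at e
  linarith

lemma kneser_bound (hm : 2 ≤ m) (ha : 0 < a) (hw : IsKneser m a q b h w)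
    (hq_meas : Measurable q) (hq_nonneg : ∀ r, a ≤ r → 0 ≤ q r)
    (hq_loc : ∀ r, ∃ M, ∀ᵐ x ∂(volume.restrict (Icc a r)), q x ≤ M)
    (hb_nonneg : ∀ i r, a ≤ r → 0 ≤ b i r)
    (hb_loc : ∀ i r, ∃ M, ∀ᵐ x ∂(volume.restrict (Icc a r)), b i x ≤ M)
    {r0 r2 G : ℝ} (h0 : a ≤ r0) (h2 : r0 ≤ r2) (hwpos : ∀ r, a ≤ r → 0 < w r)
    (hG : ∀ ξ ∈ Ioo r0 r2, G ≤ h (w ξ)) :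
    G * ∫ ξ in r0..r2, (ξ - r0) ^ (m - 1) * (q ξ /
      (1 + ∑ i ∈ Finset.Ico 1 m, essSupOn (b i) (Ioo r0 r2) * r2 ^ (m - i))) ≤
    ((m - 1).factorial : ℝ) * (w r0 - w r2) := by
  have hB0 : ∀ i, 0 ≤ essSupOn (b i) (Ioo r0 r2) := by
    intro i
    apply essSupOn_nonneg
    filter_upwards [ae_restrict_mem measurableSet_Ioo] with x hx
    exact hb_nonneg i x (h0.trans hx.1.le)
  have hBle : ∀ i, ∀ᵐ x ∂(volume.restrict (Ioo r0 r2)), b i x ≤ essSupOn (b i) (Ioo r0 r2) := by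
    intro i
    obtain ⟨M, hM⟩ := hb_loc i r2
    apply ae_le_essSupOn (M := M)
    have hsub2 : Ioo r0 r2 ⊆ Icc a r2 := fun x hx => ⟨h0.trans hx.1.le, hx.2.le⟩
    exact ae_restrict_of_ae_restrict_of_subset hsub2 hM
  set B : ℕ → ℝ := fun i => essSupOn (b i) (Ioo r0 r2) with hB
  have hr20 : 0 ≤ r2 := by linarith
  set D : ℝ := 1 + ∑ i ∈ Finset.Ico 1 m, B i * r2 ^ (m - i) with hD
  have hDpos : 0 < D := by
    have : 0 ≤ ∑ i ∈ Finset.Ico 1 m, B i * r2 ^ (m - i) :=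
      Finset.sum_nonneg (fun i _ => mul_nonneg (hB0 i) (pow_nonneg hr20 _))
    linarith
  obtain ⟨Mq, hMq⟩ := hq_loc r2
  have hqi : IntervalIntegrable q volume r0 r2 :=
    intervalIntegrable_of_bdd hq_meas hq_nonneg hMq h0 h2
  have hcont : ∀ k : ℕ, ContinuousOn (fun ξ : ℝ => (ξ - r0) ^ k) (uIcc r0 r2) :=
    fun k => by fun_prop
  have hWi : ∀ i, i ≤ m → ∀ k : ℕ, IntervalIntegrable
      (fun ξ => (ξ - r0) ^ k * ((-1 : ℝ) ^ i * iteratedDeriv i w ξ)) volume r0 r2 :=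
    fun i hi k => (kneser_intble hw hi h0 h2).continuousOn_mul (hcont k)
  have hR1 := hWi m le_rfl (m - 1)
  have hR2 : ∀ i ∈ Finset.Ico 1 m, IntervalIntegrable
      (fun ξ => B i * r2 ^ (m - i) * ((ξ - r0) ^ (i - 1) * ((-1 : ℝ) ^ i * iteratedDeriv i w ξ)))
      volume r0 r2 := fun i hi => (hWi i (Finset.mem_Ico.1 hi).2.le (i - 1)).const_mul _
  have hR3 : IntervalIntegrable (fun ξ => ∑ i ∈ Finset.Ico 1 m,
      B i * r2 ^ (m - i) * ((ξ - r0) ^ (i - 1) * ((-1 : ℝ) ^ i * iteratedDeriv i w ξ)))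
      volume r0 r2 := by
    have := IntervalIntegrable.sum (Finset.Ico 1 m) hR2
    convert! this using 1
    ext x
    simp
  have hL : IntervalIntegrable (fun ξ => G * ((ξ - r0) ^ (m - 1) * q ξ)) volume r0 r2 :=
    (hqi.continuousOn_mul (hcont (m - 1))).const_mul G
  have hmono : ∫ ξ in r0..r2, G * ((ξ - r0) ^ (m - 1) * q ξ) ≤
      ∫ ξ in r0..r2, ((ξ - r0) ^ (m - 1) * ((-1 : ℝ) ^ m * iteratedDeriv m w ξ) +
        ∑ i ∈ Finset.Ico 1 m, B i * r2 ^ (m - i) *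
          ((ξ - r0) ^ (i - 1) * ((-1 : ℝ) ^ i * iteratedDeriv i w ξ))) := by
    apply intervalIntegral.integral_mono_ae_restrict h2 hL (hR1.add hR3)
    have hae : ∀ᵐ x ∂(volume.restrict (Ioo r0 r2)), ∀ i, b i x ≤ B i := ae_all_iff.2 hBle
    have hsub3 : Ioo r0 r2 ⊆ Ici a := fun x hx => h0.trans hx.1.le
    have hkn := ae_restrict_of_ae_restrict_of_subset hsub3 hw.2.2.2.2
    rw [← Measure.restrict_congr_set (Ioo_ae_eq_Icc (μ := volume) (a := r0) (b := r2))]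
    filter_upwards [hae, hkn, ae_restrict_mem measurableSet_Ioo] with ξ h1 h3 h4
    have hξa : a ≤ ξ := h0.trans h4.1.le
    have h5 := h3 (hwpos ξ hξa)
    have hp : ∀ k : ℕ, 0 ≤ (ξ - r0) ^ k := fun k => pow_nonneg (by linarith [h4.1]) k
    have h6 : G * q ξ ≤ q ξ * h (w ξ) := by
      rw [mul_comm]; exact mul_le_mul_of_nonneg_left (hG ξ h4) (hq_nonneg ξ hξa)
    have h7 : (ξ - r0) ^ (m - 1) * (∑ i ∈ Finset.Ico 1 m, b i ξ * |iteratedDeriv i w ξ|) ≤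
        ∑ i ∈ Finset.Ico 1 m, B i * r2 ^ (m - i) *
          ((ξ - r0) ^ (i - 1) * ((-1 : ℝ) ^ i * iteratedDeriv i w ξ)) := by
      rw [Finset.mul_sum]
      apply Finset.sum_le_sum
      intro i hi
      rw [Finset.mem_Ico] at hi
      have hWn := hw.2.2.2.1 i hi.2 ξ hξa
      have habs : |iteratedDeriv i w ξ| = (-1 : ℝ) ^ i * iteratedDeriv i w ξ := by
        rw [← abs_of_nonneg hWn, abs_mul, abs_pow, abs_neg, abs_one, one_pow, one_mul]
      rw [habs]
      have e1 : (ξ - r0) ^ (m - 1) = (ξ - r0) ^ (m - i) * (ξ - r0) ^ (i - 1) := by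
        rw [← pow_add]; congr 1; omega
      have e2 : (ξ - r0) ^ (m - i) ≤ r2 ^ (m - i) :=
        pow_le_pow_left₀ (by linarith [h4.1]) (by linarith [h4.2]) _
      rw [e1]
      calc (ξ - r0) ^ (m - i) * (ξ - r0) ^ (i - 1) *
            (b i ξ * ((-1 : ℝ) ^ i * iteratedDeriv i w ξ))
          = (b i ξ * (ξ - r0) ^ (m - i)) *
            ((ξ - r0) ^ (i - 1) * ((-1 : ℝ) ^ i * iteratedDeriv i w ξ)) := by ring
        _ ≤ _ := by
          apply mul_le_mul_of_nonneg_right _ (mul_nonneg (hp _) hWn)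
          exact mul_le_mul (h1 i) e2 (hp _) (hB0 i)
    have h8 := mul_le_mul_of_nonneg_left h5 (hp (m - 1))
    have h9 := mul_le_mul_of_nonneg_left h6 (hp (m - 1))
    nlinarith [h7, h8, h9]
  rw [intervalIntegral.integral_add hR1 hR3, intervalIntegral.integral_finsetSum hR2] at hmono
  have hk1 : ∫ ξ in r0..r2, (ξ - r0) ^ (m - 1) * ((-1 : ℝ) ^ m * iteratedDeriv m w ξ) ≤
      ((m - 1).factorial : ℝ) * (w r0 - w r2) := by
    have := kneser_parts hw h0 h2 (m - 1) (by omega)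
    rwa [Nat.sub_add_cancel (by omega)] at this
  have hw02 : 0 ≤ w r0 - w r2 := sub_nonneg.2 (kneser_antitone hm hw h0 h2)
  have hk2 : ∑ i ∈ Finset.Ico 1 m, ∫ ξ in r0..r2, B i * r2 ^ (m - i) *
          ((ξ - r0) ^ (i - 1) * ((-1 : ℝ) ^ i * iteratedDeriv i w ξ)) ≤
      ∑ i ∈ Finset.Ico 1 m, B i * r2 ^ (m - i) * (((m - 1).factorial : ℝ) * (w r0 - w r2)) := by
    apply Finset.sum_le_sum
    intro i hi
    rw [Finset.mem_Ico] at hi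
    rw [intervalIntegral.integral_const_mul]
    apply mul_le_mul_of_nonneg_left _ (mul_nonneg (hB0 i) (pow_nonneg hr20 _))
    have := kneser_parts hw h0 h2 (i - 1) (by omega)
    rw [Nat.sub_add_cancel hi.1] at this
    refine this.trans (mul_le_mul_of_nonneg_right ?_ hw02)
    exact_mod_cast Nat.factorial_le (by omega)
  rw [← Finset.sum_mul] at hk2
  have hfin : ∫ ξ in r0..r2, G * ((ξ - r0) ^ (m - 1) * q ξ) ≤
      D * (((m - 1).factorial : ℝ) * (w r0 - w r2)) := by
    rw [hD, add_mul]
    linarith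
  rw [intervalIntegral.integral_const_mul] at hfin
  have e : ∫ ξ in r0..r2, (ξ - r0) ^ (m - 1) * (q ξ / D) =
      (∫ ξ in r0..r2, (ξ - r0) ^ (m - 1) * q ξ) / D := by
    rw [← intervalIntegral.integral_div]
    congr 1
    ext x
    ring
  rw [e, ← mul_div_assoc, div_le_iff₀ hDpos]
  linarith

end kneser

lemma rpow_helper {m : ℕ} (hm : 2 ≤ m) {z : ℝ} (hz : 0 < z) :
    (z ^ m) ^ ((1 : ℝ) / m - 1) = (z ^ (m - 1))⁻¹ := by
  have hm0 : (m : ℝ) ≠ 0 := by positivity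
  rw [← Real.rpow_natCast z m, ← Real.rpow_mul hz.le, ← Real.rpow_natCast z (m - 1),
    ← Real.rpow_neg hz.le, Nat.cast_sub (by omega)]
  congr 1
  field_simp
  push_cast
  ring

lemma expo_nonpos {m : ℕ} (hm : 2 ≤ m) : (1 : ℝ) / m - 1 ≤ 0 := by
  have : (1 : ℝ) ≤ m := by exact_mod_cast (by omega : 1 ≤ m)
  have := (div_le_one (by linarith : (0 : ℝ) < m)).2 this
  linarith

lemma root_pow {m : ℕ} (hm : 2 ≤ m) {y : ℝ} (hy : 0 ≤ y) : (y ^ ((1 : ℝ) / m)) ^ m = y := by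
  rw [one_div]
  exact Real.rpow_inv_natCast_pow hy (by omega)

section vlemmas
variable {m : ℕ} {a σ : ℝ} {q : ℝ → ℝ} {b : ℕ → ℝ → ℝ} {v : ℝ → ℝ}

lemma v_le_one (hm : 2 ≤ m) (ha : 0 < a) (hq_nonneg : ∀ r, a ≤ r → 0 ≤ q r)
    (hb_nonneg : ∀ i r, a ≤ r → 0 ≤ b i r)
    (hvu : ∀ r, a ≤ r → v r ≤ r ^ (m - 1) * fFun m a σ q b r *
      (muFun m a σ q b r) ^ ((1 : ℝ) / m - 1)) {r : ℝ} (hr : a ≤ r) :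
    v r ≤ r ^ (m - 1) * fFun m a σ q b r := by
  refine (hvu r hr).trans (mul_le_of_le_one_right ?_ ?_)
  · exact mul_nonneg (pow_nonneg (ha.le.trans hr) _) (fFun_nonneg ha hq_nonneg hb_nonneg hr)
  · exact Real.rpow_le_one_of_one_le_of_nonpos (one_le_mu ha hq_nonneg hb_nonneg hr)
      (expo_nonpos hm)

lemma v_le_mu (hm : 2 ≤ m) (ha : 0 < a) (hq_nonneg : ∀ r, a ≤ r → 0 ≤ q r)
    (hb_nonneg : ∀ i r, a ≤ r → 0 ≤ b i r)
    (hvu : ∀ r, a ≤ r → v r ≤ r ^ (m - 1) * fFun m a σ q b r *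
      (muFun m a σ q b r) ^ ((1 : ℝ) / m - 1)) {r : ℝ} (hr : a ≤ r) {e : ℝ} (he : 0 < e)
    (heE : e ^ m ≤ essSupOn (fFun m a σ q b) (Ioo (r / σ) r ∩ Ici a)) :
    v r * e ^ (m - 1) ≤ fFun m a σ q b r := by
  have hr0 : 0 < r := ha.trans_le hr
  have hre : 0 < r * e := mul_pos hr0 he
  have hmu : (r * e) ^ m ≤ muFun m a σ q b r := by
    unfold muFun
    rw [mul_pow]
    have := mul_le_mul_of_nonneg_left heE (pow_nonneg hr0.le m)
    linarith
  have h1 : (muFun m a σ q b r) ^ ((1 : ℝ) / m - 1) ≤ ((r * e) ^ (m - 1))⁻¹ := by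
    rw [← rpow_helper hm hre]
    exact Real.rpow_le_rpow_of_nonpos (pow_pos hre _) hmu (expo_nonpos hm)
  have hf := fFun_nonneg (m := m) (σ := σ) ha hq_nonneg hb_nonneg hr
  calc v r * e ^ (m - 1) ≤ (r ^ (m - 1) * fFun m a σ q b r * ((r * e) ^ (m - 1))⁻¹) *
        e ^ (m - 1) := by
        apply mul_le_mul_of_nonneg_right _ (pow_nonneg he.le _)
        exact (hvu r hr).trans
          (mul_le_mul_of_nonneg_left h1 (mul_nonneg (pow_nonneg hr0.le _) hf))
    _ = fFun m a σ q b r := by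
        rw [mul_pow]
        field_simp

lemma v_le_root (hm : 2 ≤ m) (ha : 0 < a) (hσ : 1 < σ) (hq_nonneg : ∀ r, a ≤ r → 0 ≤ q r)
    (hq_loc : ∀ r, ∃ M, ∀ᵐ x ∂(volume.restrict (Icc a r)), q x ≤ M)
    (hb_nonneg : ∀ i r, a ≤ r → 0 ≤ b i r)
    (hvu : ∀ r, a ≤ r → v r ≤ r ^ (m - 1) * fFun m a σ q b r *
      (muFun m a σ q b r) ^ ((1 : ℝ) / m - 1)) :
    ∀ᵐ s, a < s → v s ≤ (fFun m a σ q b s) ^ ((1 : ℝ) / m) := by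
  filter_upwards [ae_le_left_essSup ha hσ
    (fFun_loc (m := m) (σ := σ) ha hq_nonneg hb_nonneg hq_loc)] with s hs has
  have hs := hs has
  have hf := fFun_nonneg (m := m) (σ := σ) ha hq_nonneg hb_nonneg has.le
  rcases hf.eq_or_lt with h0 | h0
  · have := v_le_one hm ha hq_nonneg hb_nonneg hvu has.le
    rw [← h0, mul_zero] at this
    exact this.trans (Real.rpow_nonneg hf _)
  · have hy : 0 < (fFun m a σ q b s) ^ ((1 : ℝ) / m) := Real.rpow_pos_of_pos h0 _
    have h1 := v_le_mu hm ha hq_nonneg hb_nonneg hvu has.le hy (by rw [root_pow hm hf]; exact hs)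
    rw [← le_div_iff₀ (pow_pos hy _)] at h1
    refine h1.trans (le_of_eq ?_)
    rw [div_eq_iff (pow_pos hy _).ne', ← pow_succ', Nat.sub_add_cancel (by omega), root_pow hm hf]

lemma v_loc (hm : 2 ≤ m) (ha : 0 < a) (hq_nonneg : ∀ r, a ≤ r → 0 ≤ q r)
    (hq_loc : ∀ r, ∃ M, ∀ᵐ x ∂(volume.restrict (Icc a r)), q x ≤ M)
    (hb_nonneg : ∀ i r, a ≤ r → 0 ≤ b i r)
    (hvu : ∀ r, a ≤ r → v r ≤ r ^ (m - 1) * fFun m a σ q b r *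
      (muFun m a σ q b r) ^ ((1 : ℝ) / m - 1)) :
    ∀ r, ∃ M, ∀ᵐ x ∂(volume.restrict (Icc a r)), v x ≤ M := by
  intro r
  obtain ⟨M, hM⟩ := hq_loc r
  refine ⟨r ^ (m - 1) * M, ?_⟩
  filter_upwards [hM, ae_restrict_mem measurableSet_Icc] with x hx hx2
  have hx0 : 0 ≤ x := ha.le.trans hx2.1
  have hf := fFun_nonneg (m := m) (σ := σ) ha hq_nonneg hb_nonneg hx2.1
  refine (v_le_one hm ha hq_nonneg hb_nonneg hvu hx2.1).trans ?_
  exact mul_le_mul (pow_le_pow_left₀ hx0 hx2.2 _)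
    ((fFun_le_q ha hq_nonneg hb_nonneg hx2.1).trans hx) hf (pow_nonneg (hx0.trans hx2.2) _)

lemma den_const_pos (ha : 0 < a) (hb_nonneg : ∀ i r, a ≤ r → 0 ≤ b i r)
    {r0 r2 : ℝ} (h0 : a ≤ r0) (h02 : r0 ≤ r2) :
    0 < 1 + ∑ i ∈ Finset.Ico 1 m, essSupOn (b i) (Ioo r0 r2) * r2 ^ (m - i) := by
  have hr20 : 0 ≤ r2 := by linarith
  have : 0 ≤ ∑ i ∈ Finset.Ico 1 m, essSupOn (b i) (Ioo r0 r2) * r2 ^ (m - i) := by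
    refine Finset.sum_nonneg (fun i _ => mul_nonneg ?_ (pow_nonneg hr20 _))
    apply essSupOn_nonneg
    filter_upwards [ae_restrict_mem measurableSet_Ioo] with x hx
    exact hb_nonneg i x (h0.trans hx.1.le)
  linarith

/-- Common comparison step: a pointwise bound on a right part of the interval integrates. -/
lemma int_compare
    (hq_meas : Measurable q) (hq_nonneg : ∀ r, a ≤ r → 0 ≤ q r)
    (hq_loc : ∀ r, ∃ M, ∀ᵐ x ∂(volume.restrict (Icc a r)), q x ≤ M)
    {r0 r1 r2 D c : ℝ} (h0 : a ≤ r0) (h01 : r0 ≤ r1) (h12 : r1 ≤ r2) (hD : 0 < D) (hc : 0 ≤ c)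
    {F : ℝ → ℝ} (hF : IntervalIntegrable F volume r1 r2)
    (hle : ∀ ξ ∈ Ioo r1 r2, F ξ ≤ c * ((ξ - r0) ^ (m - 1) * (q ξ / D))) :
    ∫ ξ in r1..r2, F ξ ≤ c * ∫ ξ in r0..r2, (ξ - r0) ^ (m - 1) * (q ξ / D) := by
  have h02 := h01.trans h12
  obtain ⟨Mq, hMq⟩ := hq_loc r2
  have hqi : IntervalIntegrable q volume r0 r2 :=
    intervalIntegrable_of_bdd hq_meas hq_nonneg hMq h0 h02
  have hI : IntervalIntegrable (fun ξ => (ξ - r0) ^ (m - 1) * (q ξ / D)) volume r0 r2 :=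
    (hqi.div_const D).continuousOn_mul (by fun_prop)
  have hI1 : IntervalIntegrable (fun ξ => (ξ - r0) ^ (m - 1) * (q ξ / D)) volume r1 r2 := by
    apply hI.mono_set
    rw [uIcc_of_le h12, uIcc_of_le h02]
    exact Icc_subset_Icc_left h01
  calc ∫ ξ in r1..r2, F ξ ≤ ∫ ξ in r1..r2, c * ((ξ - r0) ^ (m - 1) * (q ξ / D)) :=
        intervalIntegral.integral_mono_on_of_le_Ioo h12 hF (hI1.const_mul c) hle
    _ = c * ∫ ξ in r1..r2, (ξ - r0) ^ (m - 1) * (q ξ / D) :=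
        intervalIntegral.integral_const_mul _ _
    _ ≤ _ := by
        apply mul_le_mul_of_nonneg_left _ hc
        apply intervalIntegral.integral_mono_interval h01 h12 le_rfl _ hI
        filter_upwards [ae_restrict_mem measurableSet_Ioc] with ξ hξ
        have := hq_nonneg ξ (h0.trans hξ.1.le)
        have h3 : 0 ≤ ξ - r0 := by linarith [hξ.1]
        change (0 : ℝ) ≤ _
        positivity

lemma type_one (hm : 2 ≤ m) (ha : 0 < a) (hσ : 1 < σ)
    (hq_meas : Measurable q) (hq_nonneg : ∀ r, a ≤ r → 0 ≤ q r)
    (hq_loc : ∀ r, ∃ M, ∀ᵐ x ∂(volume.restrict (Icc a r)), q x ≤ M)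
    (hb_nonneg : ∀ i r, a ≤ r → 0 ≤ b i r)
    (hb_loc : ∀ i r, ∃ M, ∀ᵐ x ∂(volume.restrict (Icc a r)), b i x ≤ M)
    (hv : Measurable v) (hv0 : ∀ r, a ≤ r → 0 ≤ v r)
    (hvu : ∀ r, a ≤ r → v r ≤ r ^ (m - 1) * fFun m a σ q b r *
      (muFun m a σ q b r) ^ ((1 : ℝ) / m - 1))
    {r0 r1 r2 κ : ℝ} (hκ : 1 < κ) (h0 : a ≤ r0) (h01 : κ * r0 ≤ r1) (h12 : r1 ≤ r2)
    (h2 : r2 ≤ σ * r0) :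
    ∫ ξ in r1..r2, v ξ ≤ ((κ / (κ - 1)) ^ (m - 1) * σ ^ m) *
      ∫ ξ in r0..r2, (ξ - r0) ^ (m - 1) * (q ξ /
        (1 + ∑ i ∈ Finset.Ico 1 m, essSupOn (b i) (Ioo r0 r2) * r2 ^ (m - i))) := by
  have hr00 : 0 < r0 := ha.trans_le h0
  have h01' : r0 ≤ r1 := by nlinarith
  have hk : 0 < κ - 1 := by linarith
  have hκ' : 0 ≤ κ / (κ - 1) := div_nonneg (by linarith) hk.le
  have hσ0 : 0 < σ := by linarith
  have hD := den_const_pos (m := m) ha hb_nonneg h0 (h01'.trans h12)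
  obtain ⟨Mv, hMv⟩ := v_loc hm ha hq_nonneg hq_loc hb_nonneg hvu r2
  apply int_compare hq_meas hq_nonneg hq_loc h0 h01' h12 hD (by positivity)
    (intervalIntegrable_of_bdd hv hv0 hMv (h0.trans h01') h12)
  intro ξ hξ
  have hξa : a ≤ ξ := h0.trans (h01'.trans hξ.1.le)
  have hξ0 : 0 ≤ ξ := ha.le.trans hξa
  have e1 := v_le_one hm ha hq_nonneg hb_nonneg hvu hξa
  have e2 := fFun_le_const (m := m) ha hσ hq_nonneg hb_nonneg hb_loc h0 h2
    (ξ := ξ) ⟨h01'.trans_lt hξ.1, hξ.2⟩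
  have e3 : ξ ≤ κ / (κ - 1) * (ξ - r0) := by
    rw [div_mul_eq_mul_div, le_div_iff₀ hk]
    nlinarith [hξ.1]
  have e4 : ξ ^ (m - 1) ≤ (κ / (κ - 1)) ^ (m - 1) * (ξ - r0) ^ (m - 1) := by
    rw [← mul_pow]; exact pow_le_pow_left₀ hξ0 e3 _
  refine e1.trans ((mul_le_mul e4 e2 (fFun_nonneg ha hq_nonneg hb_nonneg hξa) ?_).trans
    (le_of_eq (by ring)))
  have h3 : 0 ≤ ξ - r0 := by linarith [hξ.1]
  positivity

lemma type_two (hm : 2 ≤ m) (ha : 0 < a) (hσ : 1 < σ)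
    (hq_meas : Measurable q) (hq_nonneg : ∀ r, a ≤ r → 0 ≤ q r)
    (hq_loc : ∀ r, ∃ M, ∀ᵐ x ∂(volume.restrict (Icc a r)), q x ≤ M)
    (hb_nonneg : ∀ i r, a ≤ r → 0 ≤ b i r)
    (hb_loc : ∀ i r, ∃ M, ∀ᵐ x ∂(volume.restrict (Icc a r)), b i x ≤ M)
    (hv : Measurable v) (hv0 : ∀ r, a ≤ r → 0 ≤ v r)
    (hvu : ∀ r, a ≤ r → v r ≤ r ^ (m - 1) * fFun m a σ q b r *
      (muFun m a σ q b r) ^ ((1 : ℝ) / m - 1))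
    {r0 r2 : ℝ} (h0 : a ≤ r0) (h02 : r0 ≤ r2) (h2 : r2 ≤ σ * r0) :
    (∫ ξ in r0..r2, v ξ) ^ m ≤ (2 ^ m * σ ^ m) *
      ∫ ξ in r0..r2, (ξ - r0) ^ (m - 1) * (q ξ /
        (1 + ∑ i ∈ Finset.Ico 1 m, essSupOn (b i) (Ioo r0 r2) * r2 ^ (m - i))) := by
  have hr00 : 0 < r0 := ha.trans_le h0
  have hσ0 : 0 < σ := by linarith
  have hD := den_const_pos (m := m) ha hb_nonneg h0 h02
  have hii : ∀ x y, a ≤ x → x ≤ y → IntervalIntegrable v volume x y := by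
    intro x y hx hxy
    obtain ⟨Mv, hMv⟩ := v_loc hm ha hq_nonneg hq_loc hb_nonneg hvu y
    exact intervalIntegrable_of_bdd hv hv0 hMv hx hxy
  set V := ∫ ξ in r0..r2, v ξ with hV
  have hV0 : 0 ≤ V := intervalIntegral.integral_nonneg h02 (fun u hu => hv0 u (h0.trans hu.1))
  have hcont : ContinuousOn (fun x => ∫ ξ in r0..x, v ξ) (Icc r0 r2) := by
    have := intervalIntegral.continuousOn_primitive_interval' (hii r0 r2 h0 h02) left_mem_uIcc
    rwa [uIcc_of_le h02] at this
  obtain ⟨x, hx, hxV⟩ : V / 2 ∈ (fun x => ∫ ξ in r0..x, v ξ) '' Icc r0 r2 := by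
    apply intermediate_value_Icc h02 hcont
    simp only [intervalIntegral.integral_same]
    exact ⟨by linarith, by linarith⟩
  simp only at hxV
  have hxa : a ≤ x := h0.trans hx.1
  have hxV2 : ∫ ξ in x..r2, v ξ = V / 2 := by
    have := intervalIntegral.integral_add_adjacent_intervals (hii r0 x h0 hx.1) (hii x r2 hxa hx.2)
    rw [hxV, ← hV] at this
    linarith
  have hroot := v_le_root hm ha hσ hq_nonneg hq_loc hb_nonneg hvu
  have hmain : ∫ ξ in x..r2, v ξ * (V / 2) ^ (m - 1) ≤ σ ^ m *
      ∫ ξ in r0..r2, (ξ - r0) ^ (m - 1) * (q ξ /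
        (1 + ∑ i ∈ Finset.Ico 1 m, essSupOn (b i) (Ioo r0 r2) * r2 ^ (m - i))) := by
    apply int_compare hq_meas hq_nonneg hq_loc h0 hx.1 hx.2 hD (by positivity)
      ((hii x r2 hxa hx.2).mul_const _)
    intro ξ hξ
    have hξr : r0 < ξ := hx.1.trans_lt hξ.1
    have hξa : a ≤ ξ := h0.trans hξr.le
    have e2 := fFun_le_const (m := m) ha hσ hq_nonneg hb_nonneg hb_loc h0 h2
      (ξ := ξ) ⟨hξr, hξ.2⟩
    set E := essSupOn (fFun m a σ q b) (Ioo (ξ / σ) ξ ∩ Ici a) with hE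
    have hE0 : 0 ≤ E := E_nonneg ha hq_nonneg hb_nonneg ξ
    set e := E ^ ((1 : ℝ) / m) with he
    have he0 : 0 ≤ e := Real.rpow_nonneg hE0 _
    have hem : e ^ m = E := root_pow hm hE0
    have hve : v ξ * e ^ (m - 1) ≤ fFun m a σ q b ξ := by
      rcases he0.eq_or_lt with h | h
      · rw [← h, zero_pow (by omega), mul_zero]
        exact fFun_nonneg ha hq_nonneg hb_nonneg hξa
      · exact v_le_mu hm ha hq_nonneg hb_nonneg hvu hξa h hem.le
    have hVle : V / 2 ≤ (ξ - r0) * e := by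
      have s1 : V / 2 ≤ ∫ s in r0..ξ, v s := by
        rw [← hxV]
        apply intervalIntegral.integral_mono_interval le_rfl hx.1 hξ.1.le _ (hii r0 ξ h0 hξr.le)
        filter_upwards [ae_restrict_mem measurableSet_Ioc] with s hs
        exact hv0 s (h0.trans hs.1.le)
      have s2 : ∫ s in r0..ξ, v s ≤ ∫ s in r0..ξ, e := by
        apply intervalIntegral.integral_mono_ae_restrict hξr.le (hii r0 ξ h0 hξr.le) (by simp)
        rw [← Measure.restrict_congr_set (Ioo_ae_eq_Icc (μ := volume) (a := r0) (b := ξ))]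
        have hsub : Ioo r0 ξ ⊆ Ioo (ξ / σ) ξ ∩ Ici a := by
          rintro y ⟨hy1, hy2⟩
          refine ⟨⟨?_, hy2⟩, h0.trans hy1.le⟩
          rw [div_lt_iff₀ hσ0]
          nlinarith [hξ.2]
        have hsub2 : Ioo (ξ / σ) ξ ∩ Ici a ⊆ Icc a ξ := fun y hy => ⟨hy.2, hy.1.2.le⟩
        obtain ⟨M, hM⟩ := fFun_loc (m := m) (σ := σ) ha hq_nonneg hb_nonneg hq_loc ξ
        have hfE := ae_restrict_of_ae_restrict_of_subset hsub
          (ae_le_essSupOn (ae_restrict_of_ae_restrict_of_subset hsub2 hM))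
        filter_upwards [hfE, ae_restrict_of_ae hroot, ae_restrict_mem measurableSet_Ioo]
          with s hs1 hs2 hs3
        have has : a < s := h0.trans_lt hs3.1
        exact (hs2 has).trans (Real.rpow_le_rpow (fFun_nonneg ha hq_nonneg hb_nonneg has.le) hs1
          (by positivity))
      rw [intervalIntegral.integral_const, smul_eq_mul] at s2
      exact s1.trans s2
    have hp : 0 ≤ (ξ - r0) ^ (m - 1) := pow_nonneg (by linarith) _
    calc v ξ * (V / 2) ^ (m - 1) ≤ v ξ * ((ξ - r0) * e) ^ (m - 1) :=
          mul_le_mul_of_nonneg_left (pow_le_pow_left₀ (by linarith) hVle _) (hv0 ξ hξa)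
      _ = (ξ - r0) ^ (m - 1) * (v ξ * e ^ (m - 1)) := by rw [mul_pow]; ring
      _ ≤ (ξ - r0) ^ (m - 1) * _ := mul_le_mul_of_nonneg_left (hve.trans e2) hp
      _ = _ := by ring
  rw [intervalIntegral.integral_mul_const, hxV2, ← pow_succ', Nat.sub_add_cancel (by omega),
    div_pow, div_le_iff₀ (by positivity)] at hmain
  linarith

end vlemmas

section glemmas
variable {m : ℕ} {θ : ℝ} {h : ℝ → ℝ}

lemma gFun_le (hθ : 1 < θ) (hh_pos : ∀ t, 0 < t → 0 < h t) {t s : ℝ} (ht : 0 < t)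
    (hs : s ∈ Ioo (t / θ) (θ * t)) : gFun θ h t ≤ h s := by
  unfold gFun
  apply csInf_le _ (mem_image_of_mem _ hs)
  refine ⟨0, ?_⟩
  rintro _ ⟨y, hy, rfl⟩
  have : 0 < t / θ := div_pos ht (by linarith)
  exact (hh_pos y (this.trans hy.1)).le

lemma le_gFun (hθ : 1 < θ) {t c : ℝ} (ht : 0 < t)
    (hc : ∀ s ∈ Ioo (t / θ) (θ * t), c ≤ h s) : c ≤ gFun θ h t := by
  unfold gFun
  apply le_csInf
  · apply Set.Nonempty.image
    refine ⟨t, div_lt_self ht hθ, by nlinarith⟩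
  · rintro _ ⟨y, hy, rfl⟩
    exact hc y hy

lemma exists_lower (hh_cont : ContinuousOn h (Ioi 0)) {α β : ℝ} (hα : 0 < α) (hαβ : α ≤ β) :
    ∃ s ∈ Icc α β, ∀ y ∈ Icc α β, h s ≤ h y := by
  have hsub : Icc α β ⊆ Ioi 0 := fun y hy => hα.trans_le hy.1
  obtain ⟨s, hs, hmin⟩ := isCompact_Icc.exists_isMinOn (nonempty_Icc.2 hαβ) (hh_cont.mono hsub)
  exact ⟨s, hs, fun y hy => hmin hy⟩

lemma gFun_lower (hθ : 1 < θ) (hh_cont : ContinuousOn h (Ioi 0))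
    (hh_pos : ∀ t, 0 < t → 0 < h t) {α β : ℝ} (hα : 0 < α) (hαβ : α ≤ β) :
    ∃ c > 0, ∀ t ∈ Icc α β, c ≤ gFun θ h t := by
  have hθ0 : 0 < θ := by linarith
  have h1 : 0 < α / θ := div_pos hα hθ0
  have h2 : α / θ ≤ θ * β := by
    have := div_lt_self hα hθ
    nlinarith
  obtain ⟨s, hs, hmin⟩ := exists_lower hh_cont h1 h2
  refine ⟨h s, hh_pos s (h1.trans_le hs.1), fun t ht => ?_⟩
  apply le_gFun hθ (hα.trans_le ht.1)
  intro y hy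
  apply hmin
  have e1 : α / θ ≤ t / θ := div_le_div_of_nonneg_right ht.1 hθ0.le
  exact ⟨e1.trans hy.1.le, hy.2.le.trans (mul_le_mul_of_nonneg_left ht.2 hθ0.le)⟩

lemma gFun_pos (hθ : 1 < θ) (hh_cont : ContinuousOn h (Ioi 0))
    (hh_pos : ∀ t, 0 < t → 0 < h t) {t : ℝ} (ht : 0 < t) : 0 < gFun θ h t := by
  obtain ⟨c, hc, hle⟩ := gFun_lower hθ hh_cont hh_pos ht le_rfl
  exact hc.trans_le (hle t ⟨le_rfl, le_rfl⟩)

lemma k_lower (hm : 2 ≤ m) (hθ : 1 < θ) (hh_cont : ContinuousOn h (Ioi 0))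
    (hh_pos : ∀ t, 0 < t → 0 < h t) {α β s : ℝ} (hα : 0 < α) (hαβ : α ≤ β)
    (hs : ∀ t ∈ Ioo α β, s ∈ Ioo (t / θ) (θ * t)) (hs0 : 0 < s) :
    ENNReal.ofReal (h s ^ (-(1 : ℝ) / m) * β ^ ((1 : ℝ) / m - 1) * (β - α)) ≤
    ∫⁻ t in Ioc α β, ENNReal.ofReal ((gFun θ h t) ^ (-(1 : ℝ) / m) * t ^ ((1 : ℝ) / m - 1)) := by
  rcases hαβ.eq_or_lt with hβ | hβ
  · simp [hβ]
  have hβ0 : 0 < β := hα.trans hβ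
  have hc0 : 0 ≤ h s ^ (-(1 : ℝ) / m) * β ^ ((1 : ℝ) / m - 1) :=
    mul_nonneg (Real.rpow_nonneg (hh_pos s hs0).le _) (Real.rpow_nonneg hβ0.le _)
  rw [ENNReal.ofReal_mul hc0, ← Real.volume_Ioo, ← setLIntegral_const]
  rw [← Measure.restrict_congr_set (Ioo_ae_eq_Ioc (μ := volume) (a := α) (b := β))]
  apply setLIntegral_mono' measurableSet_Ioo
  intro t ht
  have ht0 : 0 < t := hα.trans ht.1
  apply ENNReal.ofReal_le_ofReal
  apply mul_le_mul _ _ (Real.rpow_nonneg hβ0.le _)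
    (Real.rpow_nonneg (gFun_pos hθ hh_cont hh_pos ht0).le _)
  · apply Real.rpow_le_rpow_of_nonpos (gFun_pos hθ hh_cont hh_pos ht0)
      (gFun_le hθ hh_pos ht0 (hs t ht))
    exact div_nonpos_of_nonpos_of_nonneg (by norm_num) (by positivity)
  · exact Real.rpow_le_rpow_of_nonpos ht0 ht.2.le (expo_nonpos hm)

lemma k_finite (hm : 2 ≤ m) (hθ : 1 < θ) (hh_cont : ContinuousOn h (Ioi 0))
    (hh_pos : ∀ t, 0 < t → 0 < h t)
    (hg_int : ∫⁻ t in Ioo (0 : ℝ) 1,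
        ENNReal.ofReal ((gFun θ h t) ^ (-(1 : ℝ) / m) * t ^ ((1 : ℝ) / m - 1)) ≠ ⊤) (A : ℝ) :
    ∫⁻ t in Ioc 0 A,
      ENNReal.ofReal ((gFun θ h t) ^ (-(1 : ℝ) / m) * t ^ ((1 : ℝ) / m - 1)) ≠ ⊤ := by
  have hsub : Ioc 0 A ⊆ Ioo 0 1 ∪ Icc 1 (max A 1) := by
    intro t ht
    rcases lt_or_ge t 1 with h1 | h1
    · exact Or.inl ⟨ht.1, h1⟩
    · exact Or.inr ⟨h1, ht.2.trans (le_max_left _ _)⟩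
  obtain ⟨c, hc, hcle⟩ := gFun_lower hθ hh_cont hh_pos one_pos (le_max_right A 1)
  have h2 : ∫⁻ t in Icc 1 (max A 1),
      ENNReal.ofReal ((gFun θ h t) ^ (-(1 : ℝ) / m) * t ^ ((1 : ℝ) / m - 1)) ≠ ⊤ := by
    have hle : ∫⁻ t in Icc 1 (max A 1),
        ENNReal.ofReal ((gFun θ h t) ^ (-(1 : ℝ) / m) * t ^ ((1 : ℝ) / m - 1)) ≤
        ∫⁻ t in Icc 1 (max A 1), ENNReal.ofReal (c ^ (-(1 : ℝ) / m)) := by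
      apply setLIntegral_mono' measurableSet_Icc
      intro t ht
      apply ENNReal.ofReal_le_ofReal
      have e1 : (gFun θ h t) ^ (-(1 : ℝ) / m) ≤ c ^ (-(1 : ℝ) / m) :=
        Real.rpow_le_rpow_of_nonpos hc (hcle t ht)
          (div_nonpos_of_nonpos_of_nonneg (by norm_num) (by positivity))
      have e2 : t ^ ((1 : ℝ) / m - 1) ≤ 1 :=
        Real.rpow_le_one_of_one_le_of_nonpos ht.1 (expo_nonpos hm)
      have ht0 : 0 ≤ t := zero_le_one.trans ht.1
      calc _ ≤ c ^ (-(1 : ℝ) / m) * 1 := mul_le_mul e1 e2 (Real.rpow_nonneg ht0 _)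
            (Real.rpow_nonneg hc.le _)
        _ = _ := mul_one _
    refine ne_top_of_le_ne_top ?_ hle
    rw [setLIntegral_const, Real.volume_Icc]
    exact ENNReal.mul_ne_top ENNReal.ofReal_ne_top ENNReal.ofReal_ne_top
  refine ne_top_of_le_ne_top (ENNReal.add_ne_top.2 ⟨hg_int, h2⟩) ?_
  exact (lintegral_mono_set hsub).trans (lintegral_union_le _ _ _)

lemma ratio_form {β H : ℝ} (hβ : 0 < β) (hH : 0 < H) :
    H ^ (-(1 : ℝ) / m) * β ^ ((1 : ℝ) / m - 1) = (β / H) ^ ((1 : ℝ) / m) / β := by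
  rw [Real.div_rpow hβ.le hH.le, Real.rpow_sub hβ, Real.rpow_one, neg_div, Real.rpow_neg hH.le]
  field_simp

lemma s_bound (hm : 2 ≤ m) (hθ : 1 < θ) (hh_cont : ContinuousOn h (Ioi 0))
    (hh_pos : ∀ t, 0 < t → 0 < h t)
    (hg_int : ∫⁻ t in Ioo (0 : ℝ) 1,
        ENNReal.ofReal ((gFun θ h t) ^ (-(1 : ℝ) / m) * t ^ ((1 : ℝ) / m - 1)) ≠ ⊤) (A : ℝ) :
    ∃ K, 0 ≤ K ∧ ∀ s ∈ Ioc 0 A, (s / h s) ^ ((1 : ℝ) / m) ≤ K := by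
  have hfin := k_finite hm hθ hh_cont hh_pos hg_int A
  have hθ0 : 0 < θ := by linarith
  have h1 : 0 < 1 - 1 / θ := by
    have := (div_lt_one hθ0).2 hθ
    linarith
  refine ⟨(∫⁻ t in Ioc 0 A, ENNReal.ofReal
    ((gFun θ h t) ^ (-(1 : ℝ) / m) * t ^ ((1 : ℝ) / m - 1))).toReal / (1 - 1 / θ),
    div_nonneg ENNReal.toReal_nonneg h1.le, ?_⟩
  intro s hs
  have hs0 := hs.1
  have hsθ : 0 < s / θ := div_pos hs0 hθ0
  have e := k_lower (m := m) hm hθ hh_cont hh_pos (α := s / θ) (β := s) (s := s) hsθ (div_lt_self hs0 hθ).le (by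
    intro t ht
    have ht1 := ht.1
    rw [div_lt_iff₀ hθ0] at ht1
    exact ⟨(div_lt_self (hsθ.trans ht.1) hθ).trans ht.2, by linarith⟩) hs0
  have hsub : Ioc (s / θ) s ⊆ Ioc 0 A := fun t ht => ⟨hsθ.trans ht.1, ht.2.trans hs.2⟩
  have e2 := e.trans (lintegral_mono_set hsub)
  rw [ENNReal.ofReal_le_iff_le_toReal hfin, ratio_form hs0 (hh_pos s hs0)] at e2
  rw [le_div_iff₀ h1]
  refine le_trans (le_of_eq ?_) e2
  field_simp

end glemmas

section step
variable {m : ℕ} {a θ σ : ℝ} {q : ℝ → ℝ} {b : ℕ → ℝ → ℝ} {h w v : ℝ → ℝ}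

set_option maxHeartbeats 1000000 in
lemma two_step (hm : 2 ≤ m) (ha : 0 < a) (hθ : 1 < θ) (hσ : 1 < σ)
    (hq_meas : Measurable q) (hq_nonneg : ∀ r, a ≤ r → 0 ≤ q r)
    (hq_loc : ∀ r, ∃ M, ∀ᵐ x ∂(volume.restrict (Icc a r)), q x ≤ M)
    (hb_nonneg : ∀ i r, a ≤ r → 0 ≤ b i r)
    (hb_loc : ∀ i r, ∃ M, ∀ᵐ x ∂(volume.restrict (Icc a r)), b i x ≤ M)
    (hh_cont : ContinuousOn h (Ioi 0)) (hh_pos : ∀ t, 0 < t → 0 < h t)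
    (hg_int : ∫⁻ t in Ioo (0 : ℝ) 1,
        ENNReal.ofReal ((gFun θ h t) ^ (-(1 : ℝ) / m) * t ^ ((1 : ℝ) / m - 1)) ≠ ⊤)
    (hv : Measurable v) (hv0 : ∀ r, a ≤ r → 0 ≤ v r)
    (hvu : ∀ r, a ≤ r → v r ≤ r ^ (m - 1) * fFun m a σ q b r *
      (muFun m a σ q b r) ^ ((1 : ℝ) / m - 1))
    (hw : IsKneser m a q b h w) (hwpos : ∀ r, a ≤ r → 0 < w r)
    {κ η : ℝ} (hκ : 1 < κ) (hη : 1 < η) :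
    ∃ C : ℝ, 0 ≤ C ∧ ∀ r0 r1 r2, a ≤ r0 → r0 ≤ r1 → r1 ≤ r2 → r2 ≤ σ * r0 → w r0 < θ * w r2 →
      (κ * r0 ≤ r1 ∨ η * w r1 ≤ w r0) →
      ENNReal.ofReal (∫ ξ in r1..r2, v ξ) ≤ ENNReal.ofReal C * ∫⁻ t in Ioc (w r2) (w r0),
        ENNReal.ofReal ((gFun θ h t) ^ (-(1 : ℝ) / m) * t ^ ((1 : ℝ) / m - 1)) := by
  obtain ⟨K, hK0, hK⟩ := s_bound hm hθ hh_cont hh_pos hg_int (w a)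
  have hσ0 : 0 < σ := by linarith
  have hκ1 : 0 < κ - 1 := by linarith
  have hη1 : 0 < η - 1 := by linarith
  have hη0 : 0 < η := by linarith
  set C1 : ℝ := (κ / (κ - 1)) ^ (m - 1) * σ ^ m with hC1
  have hC10 : 0 ≤ C1 := by positivity
  set fac : ℝ := ((m - 1).factorial : ℝ) with hfac
  have hfac1 : 1 ≤ fac := by
    rw [hfac]; exact_mod_cast Nat.one_le_iff_ne_zero.2 (Nat.factorial_ne_zero _)
  set X : ℝ := θ ^ ((1 : ℝ) / m) * K with hX
  have hX0 : 0 ≤ X := mul_nonneg (Real.rpow_nonneg (by linarith) _) hK0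
  set C3 : ℝ := 2 ^ m * σ ^ m * fac with hC3
  have hC31 : 1 ≤ C3 := by
    have e1 : (1 : ℝ) ≤ 2 ^ m := one_le_pow₀ (by norm_num)
    have e2 : (1 : ℝ) ≤ σ ^ m := one_le_pow₀ hσ.le
    exact one_le_mul_of_one_le_of_one_le (one_le_mul_of_one_le_of_one_le e1 e2) hfac1
  refine ⟨C1 * fac * X ^ (m - 1) + C3 * (η / (η - 1)), by positivity, ?_⟩
  intro r0 r1 r2 h0 h01 h12 h2 hwθ hor
  have h02 := h01.trans h12
  have hw0 := hwpos r0 h0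
  have hw2 := hwpos r2 (h0.trans h02)
  have hw20 := kneser_antitone hm hw h0 h02
  obtain ⟨s, hs, hmin⟩ := exists_lower hh_cont hw2 hw20
  have hs0 : 0 < s := hw2.trans_le hs.1
  have hG := hh_pos s hs0
  have hkb := kneser_bound hm ha hw hq_meas hq_nonneg hq_loc hb_nonneg hb_loc h0 h02 hwpos
    (G := h s) (fun ξ hξ => hmin _ ⟨kneser_antitone hm hw (h0.trans hξ.1.le) hξ.2.le,
      kneser_antitone hm hw h0 hξ.1.le⟩)
  have ht1 := fun (hk : κ * r0 ≤ r1) => type_one hm ha hσ hq_meas hq_nonneg hq_loc hb_nonneg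
    hb_loc hv hv0 hvu hκ h0 hk h12 h2
  have ht2 := type_two hm ha hσ hq_meas hq_nonneg hq_loc hb_nonneg hb_loc hv hv0 hvu h0 h02 h2
  set Q := ∫ ξ in r0..r2, (ξ - r0) ^ (m - 1) * (q ξ /
        (1 + ∑ i ∈ Finset.Ico 1 m, essSupOn (b i) (Ioo r0 r2) * r2 ^ (m - i))) with hQ
  have hkl := k_lower (m := m) hm hθ hh_cont hh_pos (α := w r2) (β := w r0) (s := s) hw2 hw20 (by
    intro t ht
    constructor
    · rw [div_lt_iff₀ (by linarith)]
      nlinarith [ht.2, hs.1]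
    · nlinarith [ht.1, hs.2]) hs0
  rw [ratio_form hw0 hG] at hkl
  set x : ℝ := (w r0 / h s) ^ ((1 : ℝ) / m) with hx
  have hx0 : 0 < x := Real.rpow_pos_of_pos (div_pos hw0 hG) _
  have hxm : x ^ m = w r0 / h s := root_pow hm (div_pos hw0 hG).le
  have hxX : x ≤ X := by
    have hsa : s ∈ Ioc 0 (w a) := ⟨hs0, hs.2.trans (kneser_antitone hm hw le_rfl h0)⟩
    calc x ≤ (θ * (s / h s)) ^ ((1 : ℝ) / m) := by
          apply Real.rpow_le_rpow (div_pos hw0 hG).le _ (by positivity)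
          rw [← mul_div_assoc]
          apply div_le_div_of_nonneg_right _ hG.le
          nlinarith [hs.1]
      _ = θ ^ ((1 : ℝ) / m) * (s / h s) ^ ((1 : ℝ) / m) :=
          Real.mul_rpow (by linarith) (div_pos hs0 hG).le
      _ ≤ X := mul_le_mul_of_nonneg_left (hK s hsa) (Real.rpow_nonneg (by linarith) _)
  set P : ℝ := x / w r0 * (w r0 - w r2) with hP
  have hP0 : 0 ≤ P := mul_nonneg (div_pos hx0 hw0).le (by linarith)
  have hQle : Q ≤ fac * ((w r0 - w r2) / h s) := by
    rw [← mul_div_assoc, le_div_iff₀ hG]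
    linarith
  have hxP : (w r0 - w r2) / h s = x ^ (m - 1) * P := by
    have : x ^ (m - 1) * x = w r0 / h s := by
      rw [← pow_succ, Nat.sub_add_cancel (by omega), hxm]
    rw [hP]
    calc (w r0 - w r2) / h s = (w r0 / h s) / w r0 * (w r0 - w r2) := by field_simp
      _ = _ := by rw [← this]; ring
  have hVP : ∫ ξ in r1..r2, v ξ ≤ (C1 * fac * X ^ (m - 1) + C3 * (η / (η - 1))) * P := by
    have hfac0 : 0 ≤ fac := by linarith
    have hC30 : 0 ≤ C3 := by linarith
    rcases hor with hk | hk
    · have t1 : ∫ ξ in r1..r2, v ξ ≤ C1 * fac * X ^ (m - 1) * P := by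
        calc ∫ ξ in r1..r2, v ξ ≤ C1 * Q := ht1 hk
          _ ≤ C1 * (fac * (x ^ (m - 1) * P)) := by
              rw [← hxP]; exact mul_le_mul_of_nonneg_left hQle hC10
          _ ≤ C1 * (fac * (X ^ (m - 1) * P)) := by
              gcongr
          _ = _ := by ring
      have : 0 ≤ C3 * (η / (η - 1)) * P := by positivity
      linarith
    · have t1 : ∫ ξ in r1..r2, v ξ ≤ ∫ ξ in r0..r2, v ξ := by
        obtain ⟨Mv, hMv⟩ := v_loc hm ha hq_nonneg hq_loc hb_nonneg hvu r2
        apply intervalIntegral.integral_mono_interval h01 h12 le_rfl _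
          (intervalIntegrable_of_bdd hv hv0 hMv h0 h02)
        filter_upwards [ae_restrict_mem measurableSet_Ioc] with ξ hξ
        exact hv0 ξ (h0.trans hξ.1.le)
      have t2 : (∫ ξ in r0..r2, v ξ) ^ m ≤ (C3 * x) ^ m := by
        calc (∫ ξ in r0..r2, v ξ) ^ m ≤ 2 ^ m * σ ^ m * Q := ht2
          _ ≤ 2 ^ m * σ ^ m * (fac * (w r0 / h s)) := by
              apply mul_le_mul_of_nonneg_left _ (by positivity)
              refine hQle.trans (mul_le_mul_of_nonneg_left ?_ hfac0)
              exact div_le_div_of_nonneg_right (by linarith) hG.le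
          _ = C3 * x ^ m := by rw [hxm, hC3]; ring
          _ ≤ C3 ^ m * x ^ m := by
              apply mul_le_mul_of_nonneg_right _ (pow_nonneg hx0.le _)
              exact le_self_pow₀ hC31 (by omega)
          _ = _ := (mul_pow _ _ _).symm
      have t3 : ∫ ξ in r0..r2, v ξ ≤ C3 * x :=
        le_of_pow_le_pow_left₀ (by omega) (by positivity) t2
      have t4 : x ≤ η / (η - 1) * P := by
        have hw12 := kneser_antitone hm hw (h0.trans h01) h12
        have : w r0 ≤ η / (η - 1) * (w r0 - w r2) := by
          rw [div_mul_eq_mul_div, le_div_iff₀ hη1]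
          nlinarith
        calc x = x / w r0 * w r0 := by field_simp
          _ ≤ x / w r0 * (η / (η - 1) * (w r0 - w r2)) :=
              mul_le_mul_of_nonneg_left this (div_pos hx0 hw0).le
          _ = _ := by rw [hP]; ring
      have t5 : 0 ≤ C1 * fac * X ^ (m - 1) * P := by positivity
      have t6 := mul_le_mul_of_nonneg_left t4 hC30
      linarith
  calc ENNReal.ofReal (∫ ξ in r1..r2, v ξ)
      ≤ ENNReal.ofReal ((C1 * fac * X ^ (m - 1) + C3 * (η / (η - 1))) * P) :=
        ENNReal.ofReal_le_ofReal hVP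
    _ = _ := ENNReal.ofReal_mul (by positivity)
    _ ≤ _ := by gcongr

end step

/-- Theorem 2.1: if `∫_0^1 g^{-1/m}(t) t^{1/m-1} dt < ∞` and
`∫_a^∞ ξ^{m-1} f(ξ) μ^{1/m-1}(ξ) dξ = ∞`, then every non-trivial Kneser solution is singular
of the first kind. -/
theorem singular_of_first_kind_of_mu_integral_infinite
    (m : ℕ) (hm : 2 ≤ m) (a : ℝ) (ha : 0 < a) (θ σ : ℝ) (hθ : 1 < θ) (hσ : 1 < σ)
    (q : ℝ → ℝ) (b : ℕ → ℝ → ℝ) (h : ℝ → ℝ)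
    (hq_meas : Measurable q) (hq_nonneg : ∀ r, a ≤ r → 0 ≤ q r)
    (hq_loc : ∀ r, ∃ M, ∀ᵐ x ∂(volume.restrict (Icc a r)), q x ≤ M)
    (hb_meas : ∀ i, Measurable (b i)) (hb_nonneg : ∀ i r, a ≤ r → 0 ≤ b i r)
    (hb_loc : ∀ i r, ∃ M, ∀ᵐ x ∂(volume.restrict (Icc a r)), b i x ≤ M)
    (hh_cont : ContinuousOn h (Ioi 0)) (hh_pos : ∀ t, 0 < t → 0 < h t)
    (hg_int : ∫⁻ t in Ioo (0 : ℝ) 1,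
        ENNReal.ofReal ((gFun θ h t) ^ (-(1 : ℝ) / m) * t ^ ((1 : ℝ) / m - 1)) ≠ ⊤)
    (hf_div : ∫⁻ ξ in Ici a,
        ENNReal.ofReal (ξ ^ (m - 1) * fFun m a σ q b ξ *
          (muFun m a σ q b ξ) ^ ((1 : ℝ) / m - 1)) = ⊤)
    (w : ℝ → ℝ) (hw : IsKneser m a q b h w) (hnt : ∃ r, a ≤ r ∧ w r ≠ 0) :
    ∃ R, a ≤ R ∧ ∀ r, R ≤ r → w r = 0 := by
  by_contra hcon
  push Not at hcon
  -- positivity of the solution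
  have hwpos : ∀ r, a ≤ r → 0 < w r := by
    intro r hr
    obtain ⟨y, hy, hwy⟩ := hcon r hr
    have h1 := hw.2.2.2.1 0 (by omega) y (hr.trans hy)
    simp only [pow_zero, iteratedDeriv_zero, one_mul] at h1
    exact (lt_of_le_of_ne h1 (Ne.symm hwy)).trans_le (kneser_antitone hm hw hr hy)
  have hwcont : Continuous w := by
    have := (hw.1 0 (by omega)).continuous
    rwa [iteratedDeriv_zero] at this
  -- a measurable minorant of the weight
  obtain ⟨u, hu_meas, hu_le, hu_eq⟩ := exists_measurable_le_lintegral_eq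
    (μ := volume.restrict (Ici a)) (fun ξ => ENNReal.ofReal (ξ ^ (m - 1) * fFun m a σ q b ξ *
          (muFun m a σ q b ξ) ^ ((1 : ℝ) / m - 1)))
  have hu_top : ∀ r, u r ≠ ⊤ := fun r => ne_top_of_le_ne_top ENNReal.ofReal_ne_top (hu_le r)
  obtain ⟨v, hvdef⟩ : ∃ v : ℝ → ℝ, v = fun r => (u r).toReal := ⟨_, rfl⟩
  have hv : Measurable v := by rw [hvdef]; exact hu_meas.ennreal_toReal
  have hv0 : ∀ r, a ≤ r → 0 ≤ v r := fun r _ => by rw [hvdef]; exact ENNReal.toReal_nonneg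
  have hvu : ∀ r, a ≤ r → v r ≤ r ^ (m - 1) * fFun m a σ q b r *
      (muFun m a σ q b r) ^ ((1 : ℝ) / m - 1) := by
    intro r hr
    rw [hvdef]
    apply ENNReal.toReal_le_of_le_ofReal _ (hu_le r)
    have h1 := one_le_mu (m := m) (σ := σ) ha hq_nonneg hb_nonneg hr
    have h2 := fFun_nonneg (m := m) (σ := σ) ha hq_nonneg hb_nonneg hr
    exact mul_nonneg (mul_nonneg (pow_nonneg (ha.le.trans hr) _) h2)
      (Real.rpow_nonneg (by linarith) _)
  have hv_inf : ∫⁻ ξ in Ioi a, ENNReal.ofReal (v ξ) = ⊤ := by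
    rw [Measure.restrict_congr_set (Ioi_ae_eq_Ici (μ := volume) (a := a))]
    rw [← hf_div, hu_eq]
    apply lintegral_congr
    intro r
    rw [hvdef]
    exact ENNReal.ofReal_toReal (hu_top r)
  have hvint : ∀ x y, a ≤ x → x ≤ y →
      ∫⁻ ξ in Ioc x y, ENNReal.ofReal (v ξ) = ENNReal.ofReal (∫ ξ in x..y, v ξ) := by
    intro x y hx hxy
    obtain ⟨Mv, hMv⟩ := v_loc hm ha hq_nonneg hq_loc hb_nonneg hvu y
    have hi := intervalIntegrable_of_bdd hv hv0 hMv hx hxy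
    rw [intervalIntegrable_iff_integrableOn_Ioc_of_le hxy] at hi
    rw [intervalIntegral.integral_of_le hxy, ofReal_integral_eq_lintegral_ofReal hi]
    filter_upwards [ae_restrict_mem measurableSet_Ioc] with ξ hξ
    exact hv0 ξ (hx.trans hξ.1.le)
  -- step sizes
  obtain ⟨κ, hκ, hκσ⟩ : ∃ κ : ℝ, 1 < κ ∧ κ * κ ≤ σ :=
    ⟨√σ, by rw [Real.lt_sqrt (by norm_num)]; linarith, (Real.mul_self_sqrt (by linarith)).le⟩
  obtain ⟨η, hη, hηθ⟩ : ∃ η : ℝ, 1 < η ∧ η * η < θ := by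
    have h1 : 1 < √θ := by rw [Real.lt_sqrt (by norm_num)]; linarith
    obtain ⟨η, e1, e2⟩ := exists_between h1
    have h3 := Real.mul_self_sqrt (show 0 ≤ θ by linarith)
    exact ⟨η, e1, by nlinarith⟩
  have hκ0 : 0 < κ := by linarith
  have hη0 : 0 < η := by linarith
  obtain ⟨C, hC0, hC⟩ := two_step hm ha hθ hσ hq_meas hq_nonneg hq_loc hb_nonneg hb_loc hh_cont
    hh_pos hg_int hv hv0 hvu hw hwpos hκ hη
  have hnext : ∀ r, ∃ r', a ≤ r → r ≤ r' ∧ r' ≤ κ * r ∧ w r ≤ η * w r' ∧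
      (κ * r ≤ r' ∨ η * w r' ≤ w r) := by
    intro r
    by_cases hr : a ≤ r
    swap
    · exact ⟨r, fun h => absurd h hr⟩
    have hr0 : 0 < r := ha.trans_le hr
    have hrk : r ≤ κ * r := by nlinarith
    by_cases hcase : w r ≤ η * w (κ * r)
    · exact ⟨κ * r, fun _ => ⟨hrk, le_rfl, hcase, Or.inl le_rfl⟩⟩
    · push Not at hcase
      have hwr := hwpos r hr
      obtain ⟨y, hy, hwy⟩ : w r / η ∈ w '' Icc r (κ * r) := by
        apply intermediate_value_Icc' hrk hwcont.continuousOn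
        refine ⟨?_, (div_lt_self hwr hη).le⟩
        rw [le_div_iff₀ hη0]
        linarith
      have hwy2 : η * w y = w r := by rw [hwy]; field_simp
      exact ⟨y, fun _ => ⟨hy.1, hy.2, hwy2.ge, Or.inr hwy2.le⟩⟩
  choose nx hnx using hnext
  obtain ⟨R, hR0, hRs⟩ : ∃ R : ℕ → ℝ, R 0 = a ∧ ∀ n, R (n + 1) = nx (R n) :=
    ⟨fun n => Nat.rec a (fun _ x => nx x) n, rfl, fun _ => rfl⟩
  have hRa : ∀ n, a ≤ R n := by
    intro n
    induction n with
    | zero => exact hR0.ge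
    | succ n ih => rw [hRs]; exact ih.trans (hnx _ ih).1
  have hstep : ∀ n, R n ≤ R (n + 1) ∧ R (n + 1) ≤ κ * R n ∧ w (R n) ≤ η * w (R (n + 1)) ∧
      (κ * R n ≤ R (n + 1) ∨ η * w (R (n + 1)) ≤ w (R n)) := by
    intro n
    rw [hRs]
    exact hnx _ (hRa n)
  have hRmono : Monotone R := monotone_nat_of_le_succ (fun n => (hstep n).1)
  have hWanti : Antitone (fun n => w (R n)) :=
    fun i j hij => kneser_antitone hm hw (hRa i) (hRmono hij)
  have hRunb : ¬ BddAbove (range R) := by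
    rintro ⟨x, hx⟩
    have hxn : ∀ n, R n ≤ x := fun n => hx ⟨n, rfl⟩
    have hxa : a ≤ x := (hRa 0).trans (hxn 0)
    obtain ⟨ρ, hρ, hρκ, hρη⟩ : ∃ ρ : ℝ, 1 < ρ ∧ ρ ≤ κ ∧ ρ ≤ η :=
      ⟨min κ η, lt_min hκ hη, min_le_left _ _, min_le_right _ _⟩
    have hgrow : ∀ n, ρ ^ n * (R 0 / w (R 0)) ≤ R n / w (R n) := by
      intro n
      induction n with
      | zero => simp
      | succ n ih =>
        have p1 := hwpos _ (hRa n)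
        have p2 := hwpos _ (hRa (n + 1))
        have p3 : 0 < R n := ha.trans_le (hRa n)
        have p4 : 0 < R (n + 1) := ha.trans_le (hRa (n + 1))
        have hmono2 : w (R (n + 1)) ≤ w (R n) := hWanti (Nat.le_succ n)
        have h1 : ρ * (R n / w (R n)) ≤ R (n + 1) / w (R (n + 1)) := by
          rw [← mul_div_assoc]
          rw [div_le_div_iff₀ p1 p2]
          rcases (hstep n).2.2.2 with hk | hk
          · have : ρ * R n ≤ R (n + 1) := by nlinarith
            exact mul_le_mul this hmono2 p2.le p4.le
          · have : ρ * w (R (n + 1)) ≤ w (R n) := by nlinarith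
            calc ρ * R n * w (R (n + 1)) = R n * (ρ * w (R (n + 1))) := by ring
              _ ≤ R (n + 1) * w (R n) :=
                mul_le_mul (hstep n).1 this (by nlinarith) p4.le
        calc ρ ^ (n + 1) * (R 0 / w (R 0)) = ρ * (ρ ^ n * (R 0 / w (R 0))) := by ring
          _ ≤ ρ * (R n / w (R n)) := mul_le_mul_of_nonneg_left ih (by linarith)
          _ ≤ _ := h1
    have hS0 : 0 < R 0 / w (R 0) := div_pos (ha.trans_le (hRa 0)) (hwpos _ (hRa 0))
    obtain ⟨n, hn⟩ := pow_unbounded_of_one_lt ((x / w x) / (R 0 / w (R 0))) hρ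
    rw [div_lt_iff₀ hS0] at hn
    have h2 : R n / w (R n) ≤ x / w x :=
      div_le_div₀ (ha.le.trans hxa) (hxn n) (hwpos x hxa) (kneser_antitone hm hw (hRa n) (hxn n))
    linarith [hgrow n]
  -- cover and sum
  have hcover : Ioi a ⊆ Ioc a (R 1) ∪ ⋃ k : ℕ, Ioc (R (k + 1)) (R (k + 2)) := by
    have e := iUnion_Ioc_map_succ_eq_Ioi (f := R) (fun n => hRmono bot_le) hRunb
    intro y hy
    have hy2 : y ∈ ⋃ n : ℕ, Ioc (R n) (R (Order.succ n)) := by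
      rw [e]
      change R 0 < y
      rw [hR0]; exact hy
    simp only [mem_iUnion, Nat.succ_eq_succ, Nat.succ_eq_add_one] at hy2
    obtain ⟨n, hn⟩ := hy2
    cases n with
    | zero => left; exact ⟨hy, hn.2⟩
    | succ n => right; exact mem_iUnion.2 ⟨n, hn⟩
  obtain ⟨k, hk⟩ : ∃ k : ℝ → ENNReal, k = fun t =>
    ENNReal.ofReal ((gFun θ h t) ^ (-(1 : ℝ) / m) * t ^ ((1 : ℝ) / m - 1)) := ⟨_, rfl⟩
  have hKfin : ∫⁻ t in Ioc 0 (w a), k t ≠ ⊤ := by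
    rw [hk]; exact k_finite hm hθ hh_cont hh_pos hg_int (w a)
  have hsumA : ∑' n : ℕ, ∫⁻ t in Ioc (w (R (n + 1))) (w (R n)), k t ≤
      ∫⁻ t in Ioc 0 (w a), k t := by
    have hd : Pairwise (Function.onFun Disjoint
        (fun n : ℕ => Ioc (w (R (n + 1))) (w (R n)))) := hWanti.pairwise_disjoint_on_Ioc_succ
    rw [← lintegral_iUnion (fun n => measurableSet_Ioc) hd]
    apply lintegral_mono_set
    apply iUnion_subset
    intro n
    apply Ioc_subset_Ioc
    · exact (hwpos _ (hRa (n + 1))).le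
    · exact kneser_antitone hm hw le_rfl (hRa n)
  have hterm : ∀ n : ℕ, ∫⁻ ξ in Ioc (R (n + 1)) (R (n + 2)), ENNReal.ofReal (v ξ) ≤
      ENNReal.ofReal C * ((∫⁻ t in Ioc (w (R (n + 1 + 1))) (w (R (n + 1))), k t) +
        (∫⁻ t in Ioc (w (R (n + 1))) (w (R n)), k t)) := by
    intro n
    obtain ⟨s1, s2, s3, s4⟩ := hstep n
    obtain ⟨t1, t2, t3, t4⟩ := hstep (n + 1)
    rw [hvint _ _ (hRa (n + 1)) t1]
    have hp := hwpos _ (hRa (n + 2))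
    have hp0 : 0 < R n := ha.trans_le (hRa n)
    have hbase := hC (R n) (R (n + 1)) (R (n + 2)) (hRa n) s1 t1 (by
      calc R (n + 2) ≤ κ * (κ * R n) := t2.trans (mul_le_mul_of_nonneg_left s2 hκ0.le)
        _ = (κ * κ) * R n := by ring
        _ ≤ σ * R n := mul_le_mul_of_nonneg_right hκσ hp0.le) (by
      calc w (R n) ≤ η * (η * w (R (n + 2))) := s3.trans (mul_le_mul_of_nonneg_left t3 hη0.le)
        _ = (η * η) * w (R (n + 2)) := by ring
        _ < θ * w (R (n + 2)) := mul_lt_mul_of_pos_right hηθ hp) s4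
    have e1 : w (R (n + 2)) ≤ w (R (n + 1)) := hWanti (Nat.le_succ (n + 1))
    have e2 : w (R (n + 1)) ≤ w (R n) := hWanti (Nat.le_succ n)
    have hun : (∫⁻ t in Ioc (w (R (n + 2))) (w (R n)), k t) ≤
        (∫⁻ t in Ioc (w (R (n + 2))) (w (R (n + 1))), k t) +
        (∫⁻ t in Ioc (w (R (n + 1))) (w (R n)), k t) := by
      rw [← Ioc_union_Ioc_eq_Ioc e1 e2]
      exact lintegral_union_le _ _ _
    rw [hk] at hun ⊢
    exact hbase.trans (mul_le_mul' le_rfl hun)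
  have hsum : ∑' n : ℕ, ∫⁻ ξ in Ioc (R (n + 1)) (R (n + 2)), ENNReal.ofReal (v ξ) ≤
      ENNReal.ofReal C * ((∫⁻ t in Ioc 0 (w a), k t) + (∫⁻ t in Ioc 0 (w a), k t)) := by
    refine (ENNReal.tsum_le_tsum hterm).trans ?_
    rw [ENNReal.tsum_mul_left, ENNReal.tsum_add]
    refine mul_le_mul' le_rfl (add_le_add (le_trans ?_ hsumA) hsumA)
    exact ENNReal.tsum_comp_le_tsum_of_injective (add_left_injective 1)
      (fun n : ℕ => ∫⁻ t in Ioc (w (R (n + 1))) (w (R n)), k t)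
  have hfinal : ∫⁻ ξ in Ioi a, ENNReal.ofReal (v ξ) ≤
      ENNReal.ofReal (∫ ξ in a..(R 1), v ξ) +
      ENNReal.ofReal C * ((∫⁻ t in Ioc 0 (w a), k t) + (∫⁻ t in Ioc 0 (w a), k t)) := by
    refine (lintegral_mono_set hcover).trans ((lintegral_union_le _ _ _).trans ?_)
    rw [hvint a (R 1) le_rfl (hRa 1)]
    gcongr
    exact (lintegral_iUnion_le _ _).trans hsum
  rw [hv_inf, top_le_iff] at hfinal
  exact ENNReal.add_ne_top.2 ⟨ENNReal.ofReal_ne_top, ENNReal.mul_ne_top ENNReal.ofReal_ne_top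
    (ENNReal.add_ne_top.2 ⟨hKfin, hKfin⟩)⟩ hfinal
end

section
/- Assume that ∫_0^1 g(t)^{−1/m} t^{1/m−1} dt < ∞, that ∫_a^∞ ξ^{m−1} f(ξ) dξ = ∞, and that limsup_{r→∞} r^m f(r) / ∫_a^r ξ^{m−1} f(ξ) dξ < ∞. Then every nontrivial Kneser solution w is singular of the first kind, i.e. there exists R ≥ a such that w(r) = 0 for all r ≥ R. -/
open MeasureTheory Filter Set

lemma ii_sub {f : ℝ → ℝ} {a s r : ℝ} (hf : ∀ r, a ≤ r → IntervalIntegrable f volume a r)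
    (hs : a ≤ s) (hr : a ≤ r) : IntervalIntegrable f volume s r :=
  (hf s hs).symm.trans (hf r hr)

lemma ii_mul {f p : ℝ → ℝ} {a s r : ℝ} (hf : ∀ r, a ≤ r → IntervalIntegrable f volume a r)
    (hp : Continuous p)
    (hs : a ≤ s) (hr : a ≤ r) : IntervalIntegrable (fun x => p x * f x) volume s r :=
  (ii_sub hf hs hr).continuousOn_mul hp.continuousOn

lemma gstep (n : ℕ) (a R0 C : ℝ) (ha : 0 < a) (hR0 : a ≤ R0) (hC : 0 ≤ C) (f F : ℝ → ℝ)
    (hF : ∀ r, F r = ∫ ξ in a..r, ξ ^ n * f ξ)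
    (hfi : ∀ r, a ≤ r → IntervalIntegrable f volume a r)
    (hf0 : ∀ r, a ≤ r → 0 ≤ f r)
    (hFpos : ∀ r, R0 ≤ r → 0 < F r)
    (hfF : ∀ r, R0 ≤ r → r ^ (n+1) * f r ≤ C * F r) :
    ∃ K, 0 < K ∧ ∀ s r, R0 ≤ s → s ≤ r →
      (F r ^ ((1:ℝ)/(n+1:ℕ)) - F s ^ ((1:ℝ)/(n+1:ℕ))) ^ (n+1) ≤ K * ∫ ξ in s..r, (ξ - s)^n * f ξ := by
  set G : ℝ → ℝ := fun r => F r ^ ((1:ℝ)/(n+1:ℕ)) with hG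
  have hdiff : ∀ s r, a ≤ s → a ≤ r → F r - F s = ∫ ξ in s..r, ξ ^ n * f ξ := by
    intro s r hs hr
    rw [hF, hF, intervalIntegral.integral_interval_sub_left]
    · exact ii_mul hfi (by fun_prop) le_rfl hr
    · exact ii_mul hfi (by fun_prop) le_rfl hs
  have hFmono : ∀ s r, a ≤ s → s ≤ r → F s ≤ F r := by
    intro s r hs hr
    have := hdiff s r hs (hs.trans hr)
    have h2 : 0 ≤ ∫ ξ in s..r, ξ ^ n * f ξ := by
      apply intervalIntegral.integral_nonneg hr
      intro u hu
      have : a ≤ u := hs.trans hu.1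
      exact mul_nonneg (pow_nonneg (ha.le.trans this) _) (hf0 u this)
    linarith
  have hGpow : ∀ r, R0 ≤ r → G r ^ (n+1) = F r := by
    intro r hr
    have := Real.rpow_inv_natCast_pow (hFpos r hr).le (Nat.succ_ne_zero n)
    simpa [hG, one_div] using this
  have hGpos : ∀ r, R0 ≤ r → 0 < G r := fun r hr => Real.rpow_pos_of_pos (hFpos r hr) _
  have hGmono : ∀ s r, R0 ≤ s → s ≤ r → G s ≤ G r := fun s r hs hr =>
    Real.rpow_le_rpow (hFpos s hs).le (hFmono s r (hR0.trans hs) hr) (by positivity)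
  set C' := max (2*C) 2 with hC'
  have hC'2 : 2 ≤ C' := le_max_right _ _
  have key : ∀ s r, R0 ≤ s → s ≤ r → r * (1 - G s / G r) ≤ C' * (r - s) := by
    intro s r hs hr
    have hs0 : 0 < s := ha.trans_le (hR0.trans hs)
    have hr0 : 0 < r := hs0.trans_le hr
    have hGr := hGpos r (hs.trans hr)
    have hGs := hGpos s hs
    rcases le_total r (2*s) with h2 | h2
    · have e1 : F s / F r ≤ G s / G r := by
        rw [← hGpow s hs, ← hGpow r (hs.trans hr), ← div_pow]
        apply pow_le_of_le_one (by positivity) _ (Nat.succ_ne_zero n)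
        rw [div_le_one hGr]; exact hGmono s r hs hr
      have hFr := hFpos r (hs.trans hr)
      have e2 : F r - F s ≤ C * F r / s * (r - s) := by
        rw [hdiff s r (hR0.trans hs) (hR0.trans (hs.trans hr))]
        have : ∫ ξ in s..r, ξ ^ n * f ξ ≤ ∫ ξ in s..r, C * F r / s := by
          apply intervalIntegral.integral_mono_on hr
            (ii_mul hfi (by fun_prop) (hR0.trans hs) (hR0.trans (hs.trans hr))) (by simp)
          intro x hx
          have hx0 : 0 < x := hs0.trans_le hx.1
          have h3 := hfF x (hs.trans hx.1)
          have h4 := hFmono x r (hR0.trans (hs.trans hx.1)) hx.2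
          have h5 : C * F x ≤ C * F r := by gcongr
          rw [le_div_iff₀ hs0]
          have h6 : 0 ≤ x ^ n * f x :=
            mul_nonneg (by positivity) (hf0 x (hR0.trans (hs.trans hx.1)))
          have h7 : x^n * f x * s ≤ x^n * f x * x := by
            apply mul_le_mul_of_nonneg_left hx.1 h6
          have h8 : x^n * f x * x = x^(n+1) * f x := by ring
          linarith
        apply this.trans
        rw [intervalIntegral.integral_const, smul_eq_mul, mul_comm]
      have e3 : 1 - F s / F r ≤ C / s * (r-s) := by
        rw [one_sub_div hFr.ne', div_le_iff₀ hFr]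
        calc _ ≤ _ := e2
          _ = _ := by ring
      have e4 : r * (1 - G s / G r) ≤ r * (C / s * (r-s)) := by
        gcongr; linarith
      have e5 : r * (C / s * (r-s)) ≤ 2 * C * (r - s) := by
        have : r * (C / s * (r-s)) = (r / s) * (C * (r - s)) := by ring
        rw [this, mul_assoc]
        apply mul_le_mul_of_nonneg_right
        · rw [div_le_iff₀ hs0]; exact h2
        · exact mul_nonneg hC (by linarith)
      have e6 : 2 * C * (r - s) ≤ C' * (r-s) := by
        apply mul_le_mul_of_nonneg_right (le_max_left _ _); linarith
      linarith
    · have e1 : 0 ≤ G s / G r := by positivity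
      have : r * (1 - G s / G r) ≤ r * 1 := by gcongr; linarith
      nlinarith
  refine ⟨2^(n+1) * C'^n, by positivity, ?_⟩
  intro s r hs hr
  change (G r - G s)^(n+1) ≤ _
  have hcont : ContinuousOn G (Icc s r) := by
    apply ContinuousOn.rpow_const
    · have : F = fun r => ∫ ξ in a..r, ξ ^ n * f ξ := funext hF
      rw [this]
      have := intervalIntegral.continuousOn_primitive_interval' (μ := volume)
        (f := fun ξ => ξ ^ n * f ξ) (a := a) (b₁ := a) (b₂ := r)
        (ii_mul hfi (by fun_prop) le_rfl (hR0.trans (hs.trans hr))) (by simp)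
      apply this.mono
      rw [uIcc_of_le (hR0.trans (hs.trans hr))]
      exact Icc_subset_Icc_left (hR0.trans hs)
    · intro x hx; left; exact (hFpos x (hs.trans hx.1)).ne'
  have hGsr := hGmono s r hs hr
  obtain ⟨ρ, hρ, hρG⟩ := intermediate_value_Icc hr hcont
    (show (G s + G r)/2 ∈ Icc (G s) (G r) from ⟨by linarith, by linarith⟩)
  have hρR : R0 ≤ ρ := hs.trans hρ.1
  have hGρ := hGpos ρ hρR
  set d := 1 - G s / G ρ with hd
  have hd0 : 0 ≤ d := by
    have : G s / G ρ ≤ 1 := by rw [div_le_one hGρ]; linarith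
    linarith
  have hdG : G ρ * d = (G r - G s)/2 := by
    rw [hd]; field_simp; linarith
  have hint : d^n * (F r - F ρ) ≤ C'^n * ∫ ξ in ρ..r, (ξ - s)^n * f ξ := by
    rw [hdiff ρ r (hR0.trans hρR) (hR0.trans (hρR.trans hρ.2)),
      ← intervalIntegral.integral_const_mul, ← intervalIntegral.integral_const_mul]
    apply intervalIntegral.integral_mono_on hρ.2
    · exact (ii_mul hfi (by fun_prop) (hR0.trans hρR) (hR0.trans (hρR.trans hρ.2))).const_mul _
    · exact (ii_mul hfi (by fun_prop) (hR0.trans hρR) (hR0.trans (hρR.trans hρ.2))).const_mul _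
    intro x hx
    have hxa : a ≤ x := hR0.trans (hρR.trans hx.1)
    have hk := key s x hs (hρ.1.trans hx.1)
    have hGx := hGmono ρ x hρR hx.1
    have h1 : G s / G x ≤ G s / G ρ := by
      have := hGpos s hs
      gcongr
    have h2 : x * d ≤ C' * (x - s) := by
      refine le_trans ?_ hk
      apply mul_le_mul_of_nonneg_left _ (ha.le.trans hxa)
      linarith
    calc d^n * (x^n * f x) = (x*d)^n * f x := by ring
      _ ≤ (C' * (x-s))^n * f x := by
        have := hf0 x hxa
        have : 0 ≤ x * d := mul_nonneg (ha.le.trans hxa) hd0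
        gcongr
      _ = _ := by rw [mul_pow]; ring
  have hint2 : ∫ ξ in ρ..r, (ξ - s)^n * f ξ ≤ ∫ ξ in s..r, (ξ - s)^n * f ξ := by
    rw [← intervalIntegral.integral_add_adjacent_intervals (b := ρ) (a := s)
      (ii_mul hfi (by fun_prop) (hR0.trans hs) (hR0.trans hρR))
      (ii_mul hfi (by fun_prop) (hR0.trans hρR) (hR0.trans (hρR.trans hρ.2)))]
    have : 0 ≤ ∫ ξ in s..ρ, (ξ - s)^n * f ξ := by
      apply intervalIntegral.integral_nonneg hρ.1
      intro u hu
      exact mul_nonneg (pow_nonneg (by linarith [hu.1]) _) (hf0 u (hR0.trans (hs.trans hu.1)))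
    linarith
  have hFG : G ρ ^ n * (G r - G ρ) ≤ F r - F ρ := by
    rw [← hGpow r (hs.trans hr), ← hGpow ρ hρR, pow_succ, pow_succ]
    have h1 : G ρ ^ n ≤ G r ^ n := by gcongr; linarith
    have h2 := hGpos r (hs.trans hr)
    nlinarith
  have hfin : ((G r - G s)/2)^(n+1) ≤ C'^n * ∫ ξ in s..r, (ξ - s)^n * f ξ := by
    calc ((G r - G s)/2)^(n+1) = (G ρ * d)^n * (G r - G ρ) := by
          rw [hdG, pow_succ, hρG]; ring
      _ = d^n * (G ρ ^ n * (G r - G ρ)) := by ring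
      _ ≤ d^n * (F r - F ρ) := by gcongr
      _ ≤ _ := hint
      _ ≤ _ := by gcongr
  rw [div_pow, div_le_iff₀ (by positivity)] at hfin
  linarith

lemma long_est (n : ℕ) (σ K : ℝ) (hσ : 1 < σ) (hK : 0 < K) :
    ∃ K2, 0 < K2 ∧ ∀ (a s0 R c : ℝ) (f W : ℝ → ℝ), 0 < a → a ≤ s0 → 0 ≤ c →
      (∀ r, a ≤ r → IntervalIntegrable f volume a r) →
      (∀ r, a ≤ r → 0 ≤ f r) →
      (∀ s r, a ≤ s → s ≤ r → W r ≤ W s) →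
      (∀ s r, s0 ≤ s → s ≤ r → r ≤ R → r ≤ σ * s →
        c * ∫ ξ in s..r, (ξ - s)^n * f ξ ≤ K * (W s - W r)) →
      ∀ s r, s0 ≤ s → s ≤ r → r ≤ R →
        c * ∫ ξ in s..r, (ξ - s)^n * f ξ ≤ K2 * (W s - W r) := by
  set τ := Real.sqrt σ with hτ
  have hττ : τ * τ = σ := Real.mul_self_sqrt (by linarith)
  have hτ1 : 1 < τ := by
    rw [hτ]; exact Real.lt_sqrt_of_sq_lt (by linarith)
  set A := (τ/(τ-1))^n with hA
  have hτ2 : 0 < τ - 1 := by linarith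
  have hA0 : 0 < A := by positivity
  refine ⟨K + 2*(A*K), by positivity, ?_⟩
  intro a s0 R c f W ha hs0 hc hfi hf0 hW hshort
  -- claim
  have base : ∀ s r, s0 ≤ s → τ * s ≤ r → r ≤ R → r ≤ σ * s →
      c * ∫ ξ in (τ*s)..r, ξ^n * f ξ ≤ A*K * (W s - W r) := by
    intro s r hs hsr hrR hrσ
    have hsa : a ≤ s := hs0.trans hs
    have hspos : 0 < s := ha.trans_le hsa
    have hsτ : s ≤ τ * s := by nlinarith
    have h1 := hshort s r hs (hsτ.trans hsr) hrR hrσ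
    have h2 : ∫ ξ in (τ*s)..r, (ξ-s)^n * f ξ ≤ ∫ ξ in s..r, (ξ - s)^n * f ξ := by
      rw [← intervalIntegral.integral_add_adjacent_intervals (b := τ*s) (a := s)
        (ii_mul hfi (by fun_prop) hsa (hsa.trans hsτ))
        (ii_mul hfi (by fun_prop) (hsa.trans hsτ) (hsa.trans (hsτ.trans hsr)))]
      have : 0 ≤ ∫ ξ in s..(τ*s), (ξ - s)^n * f ξ := by
        apply intervalIntegral.integral_nonneg hsτ
        intro u hu
        exact mul_nonneg (pow_nonneg (by linarith [hu.1]) _) (hf0 u (hsa.trans hu.1))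
      linarith
    have h3 : ∫ ξ in (τ*s)..r, ξ^n * f ξ ≤ ∫ ξ in (τ*s)..r, A * ((ξ - s)^n * f ξ) := by
      apply intervalIntegral.integral_mono_on hsr
      · exact ii_mul hfi (by fun_prop) (hsa.trans hsτ) (hsa.trans (hsτ.trans hsr))
      · exact (ii_mul hfi (by fun_prop) (hsa.trans hsτ) (hsa.trans (hsτ.trans hsr))).const_mul _
      intro x hx
      have hx1 := hx.1
      have : x ≤ τ/(τ-1) * (x - s) := by
        rw [div_mul_eq_mul_div, le_div_iff₀ hτ2]; nlinarith
      rw [hA, ← mul_assoc, ← mul_pow]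
      apply mul_le_mul_of_nonneg_right _ (hf0 x (hsa.trans (hsτ.trans hx1)))
      apply pow_le_pow_left₀ _ this
      linarith
    rw [intervalIntegral.integral_const_mul] at h3
    calc c * ∫ ξ in (τ*s)..r, ξ^n * f ξ ≤ c * (A * ∫ ξ in s..r, (ξ - s)^n * f ξ) := by
          gcongr; exact h3.trans (by gcongr)
      _ = A * (c * ∫ ξ in s..r, (ξ - s)^n * f ξ) := by ring
      _ ≤ A * (K * (W s - W r)) := by gcongr
      _ = _ := by ring
  have claim : ∀ k : ℕ, ∀ s r, s0 ≤ s → τ * s ≤ r → r ≤ R → r ≤ τ^k * (σ * s) →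
      c * ∫ ξ in (τ*s)..r, ξ^n * f ξ ≤ A*K * ((W s - W r) + (W (τ * s) - W r)) := by
    intro k
    induction k with
    | zero =>
      intro s r hs hsr hrR hrσ
      have hsa : a ≤ s := hs0.trans hs
      have hspos : 0 < s := ha.trans_le hsa
      have hsτ : s ≤ τ * s := by nlinarith
      have h1 := base s r hs hsr hrR (by simpa using hrσ)
      have h2 := hW (τ*s) r (hsa.trans hsτ) hsr
      have h3 : 0 ≤ A * K * (W (τ*s) - W r) := mul_nonneg (by positivity) (by linarith)
      linarith
    | succ k ih =>
      intro s r hs hsr hrR hrσ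
      have hsa : a ≤ s := hs0.trans hs
      have hspos : 0 < s := ha.trans_le hsa
      have hsτ : s ≤ τ * s := by nlinarith
      have hsτ2 : τ * s ≤ τ * (τ * s) := by nlinarith
      rcases le_total r (σ * s) with hc1 | hc1
      · have h1 := base s r hs hsr hrR hc1
        have h2 := hW (τ*s) r (hsa.trans hsτ) hsr
        have h3 : 0 ≤ A * K * (W (τ*s) - W r) := mul_nonneg (by positivity) (by linarith)
        linarith
      · have e : τ * (τ * s) = σ * s := by rw [← hττ]; ring
        have h1 := base s (τ * (τ * s)) hs hsτ2 (by rw [e]; exact hc1.trans hrR) e.le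
        have h2 := ih (τ*s) r (hs.trans hsτ) (by rw [e]; exact hc1) hrR
          (hrσ.trans_eq (by rw [pow_succ]; ring))
        rw [← intervalIntegral.integral_add_adjacent_intervals (b := τ*(τ*s)) (a := τ*s) (c := r)
          (ii_mul hfi (by fun_prop) (hsa.trans hsτ) (hsa.trans (hsτ.trans hsτ2)))
          (ii_mul hfi (by fun_prop) (hsa.trans (hsτ.trans hsτ2)) (hsa.trans (hsτ.trans hsr)))]
        linarith
  intro s r hs hsr hrR
  have hsa : a ≤ s := hs0.trans hs
  have hspos : 0 < s := ha.trans_le hsa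
  have hsτ : s ≤ τ * s := by nlinarith
  have hWsr := hW s r hsa hsr
  rcases le_total r (σ * s) with hc1 | hc1
  · have := hshort s r hs hsr hrR hc1
    have : 0 ≤ 2*(A*K) * (W s - W r) := mul_nonneg (by positivity) (by linarith)
    linarith
  · have hτσ : τ * s ≤ σ * s := by rw [← hττ]; nlinarith
    have hτr : τ * s ≤ r := hτσ.trans hc1
    obtain ⟨k, hk⟩ := pow_unbounded_of_one_lt (r/(σ*s)) hτ1
    have hk' : r ≤ τ^k * (σ * s) := by
      rw [div_lt_iff₀ (by positivity)] at hk; exact hk.le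
    have h1 := claim k s r hs hτr hrR hk'
    have h2 := hshort s (τ*s) hs hsτ (hτr.trans hrR) hτσ
    have h3 := hW s (τ*s) hsa hsτ
    have h3' := hW (τ*s) r (hsa.trans hsτ) hτr
    have h4 : ∫ ξ in (τ*s)..r, (ξ-s)^n * f ξ ≤ ∫ ξ in (τ*s)..r, ξ^n * f ξ := by
      apply intervalIntegral.integral_mono_on hτr
      · exact ii_mul hfi (by fun_prop) (hsa.trans hsτ) (hsa.trans hsr)
      · exact ii_mul hfi (by fun_prop) (hsa.trans hsτ) (hsa.trans hsr)
      intro x hx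
      apply mul_le_mul_of_nonneg_right _ (hf0 x (hsa.trans (hsτ.trans hx.1)))
      apply pow_le_pow_left₀
      · linarith [hx.1]
      · linarith
    rw [← intervalIntegral.integral_add_adjacent_intervals (b := τ*s) (a := s)
        (ii_mul hfi (by fun_prop) hsa (hsa.trans hsτ))
        (ii_mul hfi (by fun_prop) (hsa.trans hsτ) (hsa.trans hsr))]
    have h5 := mul_le_mul_of_nonneg_left h4 hc
    have h6 : K * (W s - W (τ*s)) ≤ K * (W s - W r) := by gcongr
    have h7 : A*K * ((W s - W r) + (W (τ * s) - W r)) ≤ A * K * ((W s - W r) + (W s - W r)) := by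
      gcongr
    linarith

lemma taylor_est (m : ℕ) (a : ℝ) (v : ℕ → ℝ → ℝ)
    (hder : ∀ i < m, ∀ r, HasDerivAt (v i) (- v (i+1) r) r)
    (hint : ∀ r, a ≤ r → IntervalIntegrable (v m) volume a r)
    (hpos : ∀ i < m, ∀ r, a ≤ r → 0 ≤ v i r) :
    ∀ i < m, ∀ s r, a ≤ s → s ≤ r →
      ∫ ξ in s..r, (ξ - s)^i * v (i+1) ξ ≤ (i.factorial : ℝ) * (v 0 s - v 0 r) := by
  have hii : ∀ i ≤ m, ∀ s r, a ≤ s → a ≤ r → IntervalIntegrable (v i) volume s r := by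
    intro i hi s r hs hr
    rcases hi.lt_or_eq with h | h
    · have : Continuous (v i) :=
        continuous_iff_continuousAt.2 fun x => (hder i h x).continuousAt
      exact this.intervalIntegrable _ _
    · subst h; exact ii_sub hint hs hr
  intro i
  induction i with
  | zero =>
    intro hi s r hs hr
    have := intervalIntegral.integral_eq_sub_of_hasDerivAt (f := v 0) (f' := fun x => - v 1 x)
      (a := s) (b := r) (fun x _ => hder 0 hi x) (hii 1 hi s r hs (hs.trans hr)).neg
    rw [intervalIntegral.integral_neg] at this
    simp
    linarith
  | succ i ih =>
    intro hi s r hs hr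
    have ih := ih (by omega) s r hs hr
    have hra := hs.trans hr
    have := intervalIntegral.integral_mul_deriv_eq_deriv_mul (a := s) (b := r)
      (u := fun x => (x - s)^(i+1)) (u' := fun x => (i+1) * (x-s)^i)
      (v := v (i+1)) (v' := fun x => - v (i+2) x)
      (fun x _ => by
        simpa using ((hasDerivAt_id x).sub_const s).fun_pow (i+1))
      (fun x _ => hder (i+1) hi x)
      ((by fun_prop : Continuous fun x : ℝ => ((i:ℝ)+1) * (x-s)^i).intervalIntegrable _ _)
      (hii (i+2) hi s r hs hra).neg
    simp only [mul_neg, intervalIntegral.integral_neg, sub_self, mul_assoc,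
      intervalIntegral.integral_const_mul] at this
    have hp : 0 ≤ (r - s)^(i+1) * v (i+1) r :=
      mul_nonneg (pow_nonneg (by linarith) _) (hpos _ hi r hra)
    rw [Nat.factorial_succ]
    push_cast
    have h2 : ((i:ℝ)+1) * ∫ ξ in s..r, (ξ - s)^i * v (i+1) ξ ≤ ((i:ℝ)+1) * ((i.factorial : ℝ) * (v 0 s - v 0 r)) := by
      gcongr
    have hz : (0:ℝ)^(i+1) * v (i+1) s = 0 := by simp
    rw [hz] at this
    linarith

lemma essSup_facts (ν : Measure ℝ) (b : ℝ → ℝ) (hν : ν ≠ 0) (h0 : ∀ᵐ x ∂ν, 0 ≤ b x)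
    (hM : ∃ M, ∀ᵐ x ∂ν, b x ≤ M) :
    0 ≤ essSup b ν ∧ (∀ᵐ x ∂ν, b x ≤ essSup b ν) ∧
      ∀ c, essSup b ν ≤ c ↔ ∀ᵐ x ∂ν, b x ≤ c := by
  have hdef : essSup b ν = sInf {c | ∀ᵐ x ∂ν, b x ≤ c} := rfl
  have hne : (ae ν).NeBot := ae_neBot.2 hν
  have hlb : ∀ c ∈ {c | ∀ᵐ x ∂ν, b x ≤ c}, 0 ≤ c := by
    intro c hc
    obtain ⟨x, hx1, hx2⟩ := (h0.and hc).exists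
    exact hx1.trans hx2
  have hae : ∀ᵐ x ∂ν, b x ≤ essSup b ν := by
    obtain ⟨M, hM⟩ := hM
    exact ae_le_essSup ⟨M, by simpa using hM⟩
  refine ⟨by rw [hdef]; exact Real.sInf_nonneg hlb, hae, fun c => ⟨fun h => ?_, fun h => ?_⟩⟩
  · filter_upwards [hae] with x hx using hx.trans h
  · rw [hdef]; exact csInf_le ⟨0, hlb⟩ h

lemma window_facts {a σ : ℝ} (ha : 0 < a) (hσ : 1 < σ) {b : ℝ → ℝ}
    (hb0 : ∀ r, a ≤ r → 0 ≤ b r)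
    (hbl : ∀ r, ∃ M, ∀ᵐ x ∂(volume.restrict (Icc a r)), b x ≤ M) {S : Set ℝ} {s r R : ℝ}
    (hSm : MeasurableSet S) (hsr : s < r) (hS : Ioo s r ⊆ S) (hS' : S ⊆ Icc a R) :
    0 ≤ essSupOn b S ∧ (∀ᵐ x ∂(volume.restrict S), b x ≤ essSupOn b S) ∧
      ∀ c, essSupOn b S ≤ c ↔ ∀ᵐ x ∂(volume.restrict S), b x ≤ c := by
  apply essSup_facts
  · intro h0
    rw [Measure.restrict_eq_zero] at h0
    have : volume (Ioo s r) = 0 := measure_mono_null hS h0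
    rw [Real.volume_Ioo, ENNReal.ofReal_eq_zero] at this
    linarith
  · filter_upwards [ae_restrict_mem hSm] with x hx using hb0 x (hS' hx).1
  · obtain ⟨M, hM⟩ := hbl R
    exact ⟨M, ae_restrict_of_ae_restrict_of_subset hS' hM⟩

lemma win_sub {a σ r : ℝ} (ha : 0 < a) (hσ : 1 < σ) (hr : a ≤ r) :
    r < r * σ ∧ Ioo r (r * σ) ⊆ Ioo (r / σ) (r * σ) ∩ Ici a ∧
    Ioo (r / σ) (r * σ) ∩ Ici a ⊆ Icc a (r * σ) := by
  have hr0 : 0 < r := ha.trans_le hr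
  refine ⟨by nlinarith, fun x hx => ⟨⟨(div_le_self hr0.le hσ.le).trans_lt hx.1, hx.2⟩,
    hr.trans hx.1.le⟩, fun x hx => ⟨hx.2, hx.1.2.le⟩⟩

lemma window_meas {a σ : ℝ} (ha : 0 < a) (hσ : 1 < σ) {b : ℝ → ℝ} (hbm : Measurable b)
    (hb0 : ∀ r, a ≤ r → 0 ≤ b r)
    (hbl : ∀ r, ∃ M, ∀ᵐ x ∂(volume.restrict (Icc a r)), b x ≤ M) :
    Measurable ((Ici a).indicator fun r => essSupOn b (Ioo (r / σ) (r * σ) ∩ Ici a)) := by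
  have hfacts : ∀ r, a ≤ r → _ := fun r hr =>
    window_facts ha hσ hb0 hbl (S := Ioo (r / σ) (r * σ) ∩ Ici a) (s := r) (r := r * σ)
      (R := r * σ) (measurableSet_Ioo.inter measurableSet_Ici)
      (win_sub ha hσ hr).1 (win_sub ha hσ hr).2.1 (win_sub ha hσ hr).2.2
  apply measurable_of_Ioi
  intro c
  rcases lt_or_ge c 0 with hc | hc
  · convert MeasurableSet.univ
    ext r
    simp only [mem_preimage, mem_Ioi, mem_univ, iff_true]
    by_cases hr : r ∈ Ici a
    · rw [indicator_of_mem hr]; exact hc.trans_le (hfacts r hr).1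
    · rw [indicator_of_notMem hr]; exact hc
  · let T : Set (ℝ × ℝ) := {p | p.1 / σ < p.2 ∧ p.2 < p.1 * σ ∧ a ≤ p.2 ∧ c < b p.2}
    have hT : MeasurableSet T := by
      have h1 : MeasurableSet {p : ℝ × ℝ | p.1 / σ < p.2} :=
        measurableSet_lt (by fun_prop) (by fun_prop)
      have h2 : MeasurableSet {p : ℝ × ℝ | p.2 < p.1 * σ} :=
        measurableSet_lt (by fun_prop) (by fun_prop)
      have h3 : MeasurableSet {p : ℝ × ℝ | a ≤ p.2} :=
        measurableSet_le (by fun_prop) (by fun_prop)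
      have h4 : MeasurableSet {p : ℝ × ℝ | c < b p.2} :=
        measurableSet_lt (by fun_prop) (by fun_prop)
      exact h1.inter (h2.inter (h3.inter h4))
    have hmeas := measurable_measure_prodMk_left (ν := (volume : Measure ℝ)) hT
    have : ((Ici a).indicator fun r => essSupOn b (Ioo (r / σ) (r * σ) ∩ Ici a)) ⁻¹' Ioi c
        = Ici a ∩ (fun r => volume (Prod.mk r ⁻¹' T)) ⁻¹' {0}ᶜ := by
      ext r
      simp only [mem_preimage, mem_Ioi, mem_inter_iff, mem_compl_iff, mem_singleton_iff]
      by_cases hr : r ∈ Ici a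
      · rw [indicator_of_mem hr]
        have h1 := (hfacts r hr).2.2 c
        rw [← not_le, h1]
        simp only [hr, true_and]
        rw [ae_iff, Measure.restrict_apply]
        · have : {x | ¬ b x ≤ c} ∩ (Ioo (r / σ) (r * σ) ∩ Ici a) = Prod.mk r ⁻¹' T := by
            ext x
            simp [T]; tauto
          rw [this]
        · simp only [not_le]
          exact measurableSet_lt measurable_const hbm
      · rw [indicator_of_notMem hr]
        simp [hr, hc]
    rw [this]
    exact measurableSet_Ici.inter (hmeas (measurableSet_singleton 0).compl)

section
variable {m : ℕ} {a σ : ℝ} {q : ℝ → ℝ} {b : ℕ → ℝ → ℝ}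

lemma f_facts (ha : 0 < a) (hσ : 1 < σ)
    (hq_meas : Measurable q) (hq_nonneg : ∀ r, a ≤ r → 0 ≤ q r)
    (hq_loc : ∀ r, ∃ M, ∀ᵐ x ∂(volume.restrict (Icc a r)), q x ≤ M)
    (hb_meas : ∀ i, Measurable (b i)) (hb_nonneg : ∀ i r, a ≤ r → 0 ≤ b i r)
    (hb_loc : ∀ i r, ∃ M, ∀ᵐ x ∂(volume.restrict (Icc a r)), b i x ≤ M) :
    (∀ r, a ≤ r → 0 ≤ fFun m a σ q b r) ∧
    (∀ r, a ≤ r → IntervalIntegrable (fFun m a σ q b) volume a r) := by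
  have hden : ∀ r, a ≤ r → 1 ≤ 1 + ∑ i ∈ Finset.Ico 1 m, r ^ (m - i) *
      essSupOn (b i) (Ioo (r / σ) (r * σ) ∩ Ici a) := by
    intro r hr
    have : 0 ≤ ∑ i ∈ Finset.Ico 1 m, r ^ (m - i) *
      essSupOn (b i) (Ioo (r / σ) (r * σ) ∩ Ici a) := by
      apply Finset.sum_nonneg
      intro i _
      apply mul_nonneg (pow_nonneg (ha.le.trans hr) _)
      exact (window_facts ha hσ (hb_nonneg i) (hb_loc i)
        (measurableSet_Ioo.inter measurableSet_Ici)
        (win_sub ha hσ hr).1 (win_sub ha hσ hr).2.1 (win_sub ha hσ hr).2.2).1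
    linarith
  have h0 : ∀ r, a ≤ r → 0 ≤ fFun m a σ q b r := fun r hr =>
    div_nonneg (hq_nonneg r hr) (zero_le_one.trans (hden r hr))
  refine ⟨h0, fun r hr => ?_⟩
  rw [intervalIntegrable_iff_integrableOn_Icc_of_le hr]
  obtain ⟨M, hM⟩ := hq_loc r
  let f' : ℝ → ℝ := fun r => q r / (1 + ∑ i ∈ Finset.Ico 1 m, r ^ (m - i) *
    (Ici a).indicator (fun r => essSupOn (b i) (Ioo (r / σ) (r * σ) ∩ Ici a)) r)
  have hf' : Measurable f' := by
    apply hq_meas.div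
    apply Measurable.add measurable_const
    apply Finset.measurable_fun_sum
    intro i _
    exact (measurable_id.pow_const _).mul
      (window_meas ha hσ (hb_meas i) (hb_nonneg i) (hb_loc i))
  have heq : ∀ x ∈ Icc a r, fFun m a σ q b x = f' x := by
    intro x hx
    simp only [fFun, f']
    congr 2
    apply Finset.sum_congr rfl
    intro i _
    rw [indicator_of_mem (show x ∈ Ici a from hx.1)]
  have : IntegrableOn f' (Icc a r) := by
    apply Measure.integrableOn_of_bounded (M := M) (by simp) hf'.aestronglyMeasurable
    filter_upwards [hM, ae_restrict_mem measurableSet_Icc] with x hx hxm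
    rw [← heq x hxm, Real.norm_of_nonneg (h0 x hxm.1)]
    exact (div_le_self (hq_nonneg x hxm.1) (hden x hxm.1)).trans hx
  exact this.congr_fun (fun x hx => (heq x hx).symm) measurableSet_Icc

end

lemma short_est (n : ℕ) (σ : ℝ) (hσ : 1 < σ) : ∃ K, 0 < K ∧ ∀ (a s r c : ℝ) (q : ℝ → ℝ)
    (b : ℕ → ℝ → ℝ) (v : ℕ → ℝ → ℝ), 0 < a →
    (∀ r, a ≤ r → 0 ≤ q r) →
    (∀ i r, a ≤ r → 0 ≤ b i r) →
    (∀ i r, ∃ M, ∀ᵐ x ∂(volume.restrict (Icc a r)), b i x ≤ M) →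
    (∀ r, a ≤ r → IntervalIntegrable (fFun (n+1) a σ q b) volume a r) →
    (∀ i < n+1, ∀ r, HasDerivAt (v i) (- v (i+1) r) r) →
    (∀ r, a ≤ r → IntervalIntegrable (v (n+1)) volume a r) →
    (∀ i < n+1, ∀ r, a ≤ r → 0 ≤ v i r) →
    a ≤ s → s ≤ r → r ≤ σ * s → 0 ≤ c →
    (∀ᵐ ξ ∂(volume.restrict (Icc s r)),
      q ξ * c - ∑ i ∈ Finset.Ico 1 (n+1), b i ξ * v i ξ ≤ v (n+1) ξ) →
    c * ∫ ξ in s..r, (ξ - s)^n * fFun (n+1) a σ q b ξ ≤ K * (v 0 s - v 0 r) := by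
  refine ⟨(n.factorial : ℝ) + ∑ i ∈ Finset.Ico 1 (n+1), (σ-1)^(n+1-i) * ((i-1).factorial : ℝ),
    ?_, ?_⟩
  · have : 0 ≤ ∑ i ∈ Finset.Ico 1 (n+1), (σ-1)^(n+1-i) * ((i-1).factorial : ℝ) := by
      apply Finset.sum_nonneg; intro i _
      exact mul_nonneg (pow_nonneg (by linarith) _) (by positivity)
    have : (0:ℝ) < n.factorial := by positivity
    linarith
  intro a s r c q b v ha hq0 hb0 hbl hfi hder hvi hv0 hs hsr hrσ hc hineq
  have hra : a ≤ r := hs.trans hsr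
  have hs0 : 0 < s := ha.trans_le hs
  have htay := taylor_est (n+1) a v hder hvi hv0
  set D : ℕ → ℝ := fun i => essSupOn (b i) (Ioo s (σ * s)) with hD
  have hsσ : s < σ * s := by nlinarith
  have hDf : ∀ i, _ := fun i => window_facts ha hσ (hb0 i) (hbl i) (S := Ioo s (σ * s))
    measurableSet_Ioo hsσ (le_refl _)
    (R := σ * s) (fun x hx => ⟨hs.trans hx.1.le, hx.2.le⟩)
  set den : ℝ := 1 + ∑ i ∈ Finset.Ico 1 (n+1), s^(n+1-i) * D i with hden
  have hterm : ∀ i, 0 ≤ s^(n+1-i) * D i := fun i =>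
    mul_nonneg (by positivity) (hDf i).1
  have hden1 : 1 ≤ den := by
    have : 0 ≤ ∑ i ∈ Finset.Ico 1 (n+1), s^(n+1-i) * D i := Finset.sum_nonneg fun i _ => hterm i
    linarith
  have hden0 : 0 < den := by linarith
  -- integrability
  have hii : ∀ i ≤ n+1, ∀ p : ℝ → ℝ, Continuous p →
      IntervalIntegrable (fun x => p x * v i x) volume s r := by
    intro i hi p hp
    rcases hi.lt_or_eq with h | h
    · have : Continuous (v i) :=
        continuous_iff_continuousAt.2 fun x => (hder i h x).continuousAt
      exact (hp.mul this).intervalIntegrable _ _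
    · rw [h]; exact ii_mul hvi hp hs hra
  have hsumi : IntervalIntegrable (fun ξ => ∑ i ∈ Finset.Ico 1 (n+1),
      (σ-1)^(n+1-i) * ((ξ-s)^(i-1) * v i ξ)) volume s r := by
    have := IntervalIntegrable.sum (μ := volume) (a := s) (b := r) (Finset.Ico 1 (n+1))
      (f := fun i ξ => (σ-1)^(n+1-i) * ((ξ-s)^(i-1) * v i ξ)) (fun i hi => by
        rw [Finset.mem_Ico] at hi
        exact (hii i hi.2.le (fun ξ => (ξ-s)^(i-1)) (by fun_prop)).const_mul _)
    have e : (fun ξ => ∑ i ∈ Finset.Ico 1 (n+1), (σ-1)^(n+1-i) * ((ξ-s)^(i-1) * v i ξ)) =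
        ∑ i ∈ Finset.Ico 1 (n+1), fun ξ => (σ-1)^(n+1-i) * ((ξ-s)^(i-1) * v i ξ) := by
      funext x
      rw [Finset.sum_apply]
    rw [e]
    exact this
  have hmono : ∫ ξ in s..r, c * ((ξ - s)^n * fFun (n+1) a σ q b ξ) ≤
      ∫ ξ in s..r, (den⁻¹ * ((ξ - s)^n * v (n+1) ξ) +
        ∑ i ∈ Finset.Ico 1 (n+1), (σ-1)^(n+1-i) * ((ξ-s)^(i-1) * v i ξ)) := by
    apply intervalIntegral.integral_mono_ae_restrict hsr
    · exact (ii_mul hfi (by fun_prop) hs hra).const_mul _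
    · apply IntervalIntegrable.add
      · exact (hii (n+1) le_rfl _ (by fun_prop)).const_mul _
      · exact hsumi
    have hb_ae : ∀ᵐ x ∂(volume.restrict (Icc s r)), ∀ i ∈ Finset.Ico 1 (n+1), b i x ≤ D i := by
      rw [Measure.restrict_congr_set Ioo_ae_eq_Icc.symm]
      rw [Finset.eventually_all]
      intro i _
      exact ae_restrict_of_ae_restrict_of_subset (Ioo_subset_Ioo_right hrσ) (hDf i).2.1
    have hmem : ∀ᵐ x ∂(volume.restrict (Icc s r)), x ∈ Ioo s r := by
      rw [Measure.restrict_congr_set Ioo_ae_eq_Icc.symm]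
      exact ae_restrict_mem measurableSet_Ioo
    filter_upwards [hineq, hb_ae, hmem] with x h1 h2 h3
    have hxa : a ≤ x := hs.trans h3.1.le
    have hx0 : 0 < x := ha.trans_le hxa
    have hxs : 0 ≤ x - s := by linarith [h3.1]
    have hf_le : fFun (n+1) a σ q b x ≤ q x / den := by
      unfold fFun
      apply div_le_div_of_nonneg_left (hq0 x hxa) hden0
      rw [hden]
      gcongr with i hi
      · exact (hDf i).1
      · exact h3.1.le
      · rw [hD]
        rw [(hDf i).2.2]
        have hw := (window_facts ha hσ (hb0 i) (hbl i)
          (measurableSet_Ioo.inter measurableSet_Ici)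
          (win_sub ha hσ hxa).1 (win_sub ha hσ hxa).2.1 (win_sub ha hσ hxa).2.2).2.1
        apply ae_restrict_of_ae_restrict_of_subset _ hw
        intro y hy
        refine ⟨⟨?_, ?_⟩, hs.trans hy.1.le⟩
        · rw [div_lt_iff₀ (by linarith)]
          nlinarith [hy.1, h3.2]
        · nlinarith [hy.2, h3.1]
    have hbv : ∀ i ∈ Finset.Ico 1 (n+1), den⁻¹ * ((x-s)^n * (b i x * v i x)) ≤
        (σ-1)^(n+1-i) * ((x-s)^(i-1) * v i x) := by
      intro i hi
      have hi' := Finset.mem_Ico.1 hi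
      have hv := hv0 i hi'.2 x hxa
      have hle : s^(n+1-i) * D i ≤ den := by
        have := Finset.single_le_sum (f := fun i => s^(n+1-i) * D i) (fun j _ => hterm j) hi
        linarith
      have e1 : (x-s)^n = (x-s)^(n+1-i) * (x-s)^(i-1) := by
        rw [← pow_add]; congr 1; omega
      have e2 : (x-s)^(n+1-i) ≤ (σ-1)^(n+1-i) * s^(n+1-i) := by
        rw [← mul_pow]
        apply pow_le_pow_left₀ hxs
        linarith [h3.2]
      have e3 : (x-s)^(n+1-i) * b i x ≤ (σ-1)^(n+1-i) * den := by
        calc (x-s)^(n+1-i) * b i x ≤ ((σ-1)^(n+1-i) * s^(n+1-i)) * D i := by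
              apply mul_le_mul e2 (h2 i hi) (hb0 i x hxa)
              exact mul_nonneg (pow_nonneg (by linarith) _) (by positivity)
          _ = (σ-1)^(n+1-i) * (s^(n+1-i) * D i) := by ring
          _ ≤ _ := by
              apply mul_le_mul_of_nonneg_left hle (pow_nonneg (by linarith) _)
      have e4 : den⁻¹ * ((x-s)^(n+1-i) * b i x) ≤ (σ-1)^(n+1-i) := by
        rw [inv_mul_le_iff₀ hden0]; linarith
      calc den⁻¹ * ((x-s)^n * (b i x * v i x))
          = (den⁻¹ * ((x-s)^(n+1-i) * b i x)) * ((x-s)^(i-1) * v i x) := by rw [e1]; ring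
        _ ≤ _ := by
          apply mul_le_mul_of_nonneg_right e4
          positivity
    have hsum := Finset.sum_le_sum hbv
    rw [← Finset.mul_sum, ← Finset.mul_sum] at hsum
    have hx1 : (x-s)^n * (q x * c) ≤ (x-s)^n * (v (n+1) x +
        ∑ i ∈ Finset.Ico 1 (n+1), b i x * v i x) := by
      gcongr; linarith
    calc c * ((x - s)^n * fFun (n+1) a σ q b x) ≤ c * ((x-s)^n * (q x / den)) := by gcongr
      _ = den⁻¹ * ((x-s)^n * (q x * c)) := by rw [div_eq_mul_inv]; ring
      _ ≤ den⁻¹ * ((x-s)^n * (v (n+1) x + ∑ i ∈ Finset.Ico 1 (n+1), b i x * v i x)) := by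
        gcongr
      _ = den⁻¹ * ((x-s)^n * v (n+1) x) +
          den⁻¹ * ((x-s)^n * ∑ i ∈ Finset.Ico 1 (n+1), b i x * v i x) := by ring
      _ ≤ _ := by linarith
  rw [intervalIntegral.integral_const_mul, intervalIntegral.integral_add,
    intervalIntegral.integral_finsetSum, intervalIntegral.integral_const_mul] at hmono
  rotate_left
  · intro i hi
    rw [Finset.mem_Ico] at hi
    exact (hii i hi.2.le (fun ξ => (ξ-s)^(i-1)) (by fun_prop)).const_mul _
  · exact (hii (n+1) le_rfl _ (by fun_prop)).const_mul _
  · exact hsumi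
  refine hmono.trans ?_
  have hΔ : 0 ≤ v 0 s - v 0 r := by
    have h0 := htay 0 (by omega) s r hs hsr
    simp only [pow_zero, one_mul, Nat.factorial_zero, Nat.cast_one, zero_add] at h0
    refine le_trans ?_ h0
    by_cases hn : 1 < n + 1
    · exact intervalIntegral.integral_nonneg hsr fun u hu => hv0 1 hn u (hs.trans hu.1)
    · have : n = 0 := by omega
      subst this
      apply intervalIntegral.integral_nonneg_of_ae_restrict hsr
      filter_upwards [hineq, ae_restrict_mem measurableSet_Icc] with x hx hxm
      simp at hx
      have := mul_nonneg (hq0 x (hs.trans hxm.1)) hc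
      exact this.trans hx
  rw [add_mul, Finset.sum_mul]
  apply add_le_add
  · calc den⁻¹ * ∫ ξ in s..r, (ξ - s)^n * v (n+1) ξ ≤ den⁻¹ * (n.factorial * (v 0 s - v 0 r)) := by
          gcongr; exact htay n (by omega) s r hs hsr
      _ ≤ _ := by
        apply mul_le_of_le_one_left (by positivity)
        exact inv_le_one_of_one_le₀ hden1
  · apply Finset.sum_le_sum
    intro i hi
    have hi' := Finset.mem_Ico.1 hi
    rw [intervalIntegral.integral_const_mul, mul_assoc]
    have := htay (i-1) (by omega) s r hs hsr
    rw [Nat.sub_add_cancel hi'.1] at this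
    exact mul_le_mul_of_nonneg_left this (pow_nonneg (by linarith) _)

lemma lint_step (m : ℕ) (hm : 0 < m) (θ : ℝ) (hθ : 1 < θ) (h : ℝ → ℝ)
    (hh_cont : ContinuousOn h (Ioi 0)) (hh_pos : ∀ t, 0 < t → 0 < h t) (y : ℝ) (hy : 0 < y) :
    ∃ c, 0 < c ∧ (∀ t ∈ Icc (y / Real.sqrt θ) y, c ≤ h t) ∧
      ENNReal.ofReal ((1 - 1 / Real.sqrt θ) * (y / c) ^ ((1:ℝ)/m)) ≤
      ∫⁻ t in Ioo (y / Real.sqrt θ) y,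
        ENNReal.ofReal ((gFun θ h t) ^ (-(1 : ℝ) / m) * t ^ ((1 : ℝ) / m - 1)) := by
  set lam := Real.sqrt θ with hlam
  have hlam1 : 1 < lam := Real.lt_sqrt_of_sq_lt (by linarith)
  have hll : lam * lam = θ := Real.mul_self_sqrt (by linarith)
  have hlamθ : lam < θ := by nlinarith
  have hx : 0 < y / lam := by positivity
  have hxy : y / lam < y := div_lt_self hy hlam1
  have hm1 : (1:ℝ) ≤ m := by exact_mod_cast hm
  have hsub : Icc (y / lam) y ⊆ Ioi 0 := fun x hx' => hx.trans_le hx'.1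
  obtain ⟨t0, ht0, hmin⟩ := isCompact_Icc.exists_isMinOn (nonempty_Icc.2 hxy.le)
    (hh_cont.mono hsub)
  have hc : 0 < h t0 := hh_pos _ (hsub ht0)
  refine ⟨h t0, hc, fun t ht => hmin ht, ?_⟩
  have hpt : ∀ t ∈ Ioo (y / lam) y,
      ENNReal.ofReal ((h t0) ^ (-(1 : ℝ) / m) * y ^ ((1 : ℝ) / m - 1)) ≤
      ENNReal.ofReal ((gFun θ h t) ^ (-(1 : ℝ) / m) * t ^ ((1 : ℝ) / m - 1)) := by
    intro t ht
    have ht' : 0 < t := hx.trans ht.1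
    have hyt : y < lam * t := by
      have := ht.1
      rw [div_lt_iff₀ (by linarith)] at this
      linarith
    have htθ : t / θ < θ * t := (div_lt_self ht' hθ).trans (by nlinarith)
    have hgle : gFun θ h t ≤ h t0 := by
      apply csInf_le
      · refine ⟨0, ?_⟩
        rintro _ ⟨x, hx', rfl⟩
        exact (hh_pos x ((by positivity : 0 < t / θ).trans hx'.1)).le
      · refine ⟨t0, ⟨?_, ?_⟩, rfl⟩
        · refine lt_of_lt_of_le ?_ ht0.1
          rw [div_lt_div_iff₀ (by linarith) (by linarith)]
          nlinarith [ht.2]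
        · refine lt_of_le_of_lt ht0.2 (hyt.trans ?_)
          nlinarith
    have hgpos : 0 < gFun θ h t := by
      have hsub2 : Icc (t/θ) (θ * t) ⊆ Ioi 0 := fun x hx' =>
        (by positivity : 0 < t / θ).trans_le hx'.1
      obtain ⟨t1, ht1, hmin1⟩ := isCompact_Icc.exists_isMinOn (nonempty_Icc.2 htθ.le)
        (hh_cont.mono hsub2)
      refine (hh_pos _ (hsub2 ht1)).trans_le ?_
      apply le_csInf
      · exact (nonempty_Ioo.2 htθ).image _
      · rintro _ ⟨x, hx', rfl⟩
        exact hmin1 (Ioo_subset_Icc_self hx')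
    apply ENNReal.ofReal_le_ofReal
    apply mul_le_mul
    · apply Real.rpow_le_rpow_of_nonpos hgpos hgle
      rw [neg_div]; simp
    · apply Real.rpow_le_rpow_of_nonpos ht' ht.2.le
      have : (1:ℝ)/m ≤ 1 := by rw [div_le_one (by linarith)]; exact hm1
      linarith
    · positivity
    · positivity
  have h1 := setLIntegral_mono' (μ := volume) measurableSet_Ioo hpt
  refine le_trans (le_of_eq ?_) h1
  rw [setLIntegral_const, Real.volume_Ioo, ← ENNReal.ofReal_mul (by positivity)]
  congr 1
  rw [Real.div_rpow hy.le hc.le, neg_div, Real.rpow_neg hc.le, Real.rpow_sub hy, Real.rpow_one]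
  field_simp

/-- Theorem 2.2: if `∫_0^1 g^{-1/m}(t) t^{1/m-1} dt < ∞`, `∫_a^∞ ξ^{m-1} f(ξ) dξ = ∞`, and
`limsup_{r→∞} r^m f(r) / ∫_a^r ξ^{m-1} f(ξ) dξ < ∞`, then every non-trivial Kneser solution
is singular of the first kind. -/
theorem singular_of_first_kind_of_f_integral_infinite
    (m : ℕ) (hm : 2 ≤ m) (a : ℝ) (ha : 0 < a) (θ σ : ℝ) (hθ : 1 < θ) (hσ : 1 < σ)
    (q : ℝ → ℝ) (b : ℕ → ℝ → ℝ) (h : ℝ → ℝ)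
    (hq_meas : Measurable q) (hq_nonneg : ∀ r, a ≤ r → 0 ≤ q r)
    (hq_loc : ∀ r, ∃ M, ∀ᵐ x ∂(volume.restrict (Icc a r)), q x ≤ M)
    (hb_meas : ∀ i, Measurable (b i)) (hb_nonneg : ∀ i r, a ≤ r → 0 ≤ b i r)
    (hb_loc : ∀ i r, ∃ M, ∀ᵐ x ∂(volume.restrict (Icc a r)), b i x ≤ M)
    (hh_cont : ContinuousOn h (Ioi 0)) (hh_pos : ∀ t, 0 < t → 0 < h t)
    (hg_int : ∫⁻ t in Ioo (0 : ℝ) 1,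
        ENNReal.ofReal ((gFun θ h t) ^ (-(1 : ℝ) / m) * t ^ ((1 : ℝ) / m - 1)) ≠ ⊤)
    (hf_div : ∫⁻ ξ in Ici a, ENNReal.ofReal (ξ ^ (m - 1) * fFun m a σ q b ξ) = ⊤)
    (hlimsup : IsBoundedUnder (· ≤ ·) atTop fun r =>
      r ^ m * fFun m a σ q b r / ∫ ξ in a..r, ξ ^ (m - 1) * fFun m a σ q b ξ)
    (w : ℝ → ℝ) (hw : IsKneser m a q b h w) (hnt : ∃ r, a ≤ r ∧ w r ≠ 0) :
    ∃ R, a ≤ R ∧ ∀ r, R ≤ r → w r = 0 := by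
  obtain ⟨n, rfl⟩ : ∃ n, m = n + 1 := ⟨m - 1, by omega⟩
  obtain ⟨hw1, hw2, -, hw4, hw5⟩ := hw
  set f := fFun (n+1) a σ q b with hf
  obtain ⟨hf0, hfi⟩ := f_facts (m := n+1) ha hσ hq_meas hq_nonneg hq_loc hb_meas hb_nonneg hb_loc
  rw [← hf] at hf0 hfi
  set v : ℕ → ℝ → ℝ := fun i r => (-1 : ℝ)^i * iteratedDeriv i w r with hv
  have hv0w : ∀ r, v 0 r = w r := by intro r; simp [hv]
  have hder : ∀ i < n+1, ∀ r, HasDerivAt (v i) (- v (i+1) r) r := by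
    intro i hi r
    have h1 := ((hw1 i hi) r).hasDerivAt.const_mul ((-1 : ℝ)^i)
    have e : - v (i+1) r = (-1 : ℝ)^i * deriv (iteratedDeriv i w) r := by
      simp only [hv, iteratedDeriv_succ, pow_succ]
      ring
    rw [e]
    exact h1
  have hvi : ∀ r, a ≤ r → IntervalIntegrable (v (n+1)) volume a r := fun r hr =>
    (hw2 r hr).const_mul _
  have hanti : ∀ s r, a ≤ s → s ≤ r → w r ≤ w s := by
    intro s r hs hsr
    have h0 := taylor_est (n+1) a v hder hvi hw4 0 (by omega) s r hs hsr
    simp only [pow_zero, one_mul, Nat.factorial_zero, Nat.cast_one, zero_add, hv0w] at h0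
    have : 0 ≤ ∫ ξ in s..r, v 1 ξ :=
      intervalIntegral.integral_nonneg hsr fun u hu => hw4 1 (by omega) u (hs.trans hu.1)
    linarith
  by_contra hcon
  have hwpos : ∀ r, a ≤ r → 0 < w r := by
    intro r hr
    by_contra hneg
    apply hcon
    refine ⟨r, hr, fun r' hr' => le_antisymm ?_ ?_⟩
    · exact (hanti r r' hr hr').trans (not_lt.1 hneg)
    · have := hw4 0 (by omega) r' (hr.trans hr')
      simpa using this
  have hwcont : Continuous w := by
    have := (hw1 0 (by omega)).continuous
    simpa using this
  -- the main estimate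
  obtain ⟨K1, hK1, hshort⟩ := short_est n σ hσ
  obtain ⟨K2, hK2, hlong⟩ := long_est n σ K1 hσ hK1
  have hest : ∀ s r c, a ≤ s → s ≤ r → 0 ≤ c → (∀ t ∈ Icc (w r) (w s), c ≤ h t) →
      c * ∫ ξ in s..r, (ξ - s)^n * f ξ ≤ K2 * (w s - w r) := by
    intro s r c hs hsr hc hch
    refine hlong a s r c f w ha hs hc hfi hf0 hanti ?_ s r le_rfl hsr le_rfl
    intro s' r' hs' hsr' hr' hrσ
    have := hshort a s' r' c q b v ha hq_nonneg hb_nonneg hb_loc hfi hder hvi hw4 (hs.trans hs')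
      hsr' hrσ hc ?_
    · simpa only [hv0w] using this
    have hsub : Icc s' r' ⊆ Ici a := fun x hx => hs.trans (hs'.trans hx.1)
    filter_upwards [ae_restrict_of_ae_restrict_of_subset hsub hw5,
      ae_restrict_mem measurableSet_Icc] with x hx hxm
    have hxa : a ≤ x := hsub hxm
    refine le_trans ?_ (hx (hwpos x hxa))
    have e : ∑ i ∈ Finset.Ico 1 (n+1), b i x * |iteratedDeriv i w x| =
        ∑ i ∈ Finset.Ico 1 (n+1), b i x * v i x := by
      apply Finset.sum_congr rfl
      intro i hi
      congr 1
      have := hw4 i (Finset.mem_Ico.1 hi).2 x hxa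
      change _ = (-1 : ℝ)^i * iteratedDeriv i w x
      rw [← abs_of_nonneg this, abs_mul, abs_pow, abs_neg, abs_one, one_pow, one_mul]
    rw [e]
    have : q x * c ≤ q x * h (w x) := by
      apply mul_le_mul_of_nonneg_left _ (hq_nonneg x hxa)
      exact hch _ ⟨hanti x r hxa (hxm.2.trans hr'), hanti s x hs (hs'.trans hxm.1)⟩
    linarith
  -- the function F
  simp only [Nat.add_sub_cancel] at hf_div hlimsup
  obtain ⟨F, hF⟩ : ∃ F : ℝ → ℝ, ∀ r, F r = ∫ ξ in a..r, ξ ^ n * f ξ := ⟨_, fun _ => rfl⟩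
  have hxf0 : ∀ r, a ≤ r → 0 ≤ r ^ n * f r := fun r hr =>
    mul_nonneg (pow_nonneg (ha.le.trans hr) _) (hf0 r hr)
  have hxfi : ∀ s r, a ≤ s → a ≤ r → IntervalIntegrable (fun ξ => ξ ^ n * f ξ) volume s r :=
    fun s r hs hr => ii_mul hfi (by fun_prop) hs hr
  have hFmono : ∀ s r, a ≤ s → s ≤ r → F s ≤ F r := by
    intro s r hs hr
    rw [hF, hF, ← intervalIntegral.integral_add_adjacent_intervals (hxfi a s le_rfl hs)
      (hxfi s r hs (hs.trans hr))]
    have : 0 ≤ ∫ ξ in s..r, ξ ^ n * f ξ :=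
      intervalIntegral.integral_nonneg hr fun u hu => hxf0 u (hs.trans hu.1)
    linarith
  have hFunb : ∀ M, ∃ r, a ≤ r ∧ M < F r := by
    intro M
    by_contra hno
    push Not at hno
    have hint : IntegrableOn (fun ξ => ξ ^ n * f ξ) (Ioi a) := by
      apply integrableOn_Ioi_of_intervalIntegral_norm_bounded (l := atTop)
        (b := fun k : ℕ => a + k) M a
      · intro k
        have hk : a ≤ a + k := by simp
        exact (intervalIntegrable_iff_integrableOn_Ioc_of_le hk).1 (hxfi a _ le_rfl hk)
      · exact tendsto_atTop_add_const_left _ _ tendsto_natCast_atTop_atTop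
      · refine Eventually.of_forall fun k => ?_
        have hk : a ≤ a + (k:ℝ) := by simp
        refine le_trans (le_of_eq ?_) (hno (a+k) hk)
        rw [hF]
        apply intervalIntegral.integral_congr
        intro x hx
        rw [uIcc_of_le hk] at hx
        exact Real.norm_of_nonneg (hxf0 x hx.1)
    rw [← integrableOn_Ici_iff_integrableOn_Ioi] at hint
    have := hint.lintegral_lt_top
    rw [hf_div] at this
    exact lt_irrefl _ this
  obtain ⟨C, hC⟩ := hlimsup
  rw [eventually_map, eventually_atTop] at hC
  obtain ⟨R2, hR2⟩ := hC
  obtain ⟨R1, hR1a, hR1⟩ := hFunb 0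
  set R0 := max R1 R2 with hR0
  have haR0 : a ≤ R0 := hR1a.trans (le_max_left _ _)
  have hFpos : ∀ r, R0 ≤ r → 0 < F r := fun r hr =>
    hR1.trans_le (hFmono R1 r hR1a ((le_max_left _ _).trans hr))
  have hfF : ∀ r, R0 ≤ r → r ^ (n+1) * f r ≤ max C 0 * F r := by
    intro r hr
    have h1 := hR2 r ((le_max_right _ _).trans hr)
    rw [← hF, div_le_iff₀ (hFpos r hr)] at h1
    refine h1.trans ?_
    apply mul_le_mul_of_nonneg_right (le_max_left _ _) (hFpos r hr).le
  obtain ⟨K3, hK3, hg⟩ := gstep n a R0 (max C 0) ha haR0 (le_max_right _ _) f F hF hfi hf0 hFpos hfF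
  set G : ℝ → ℝ := fun r => F r ^ ((1:ℝ)/(n+1:ℕ)) with hG
  have hGmono : ∀ s r, R0 ≤ s → s ≤ r → G s ≤ G r := fun s r hs hr =>
    Real.rpow_le_rpow (hFpos s hs).le (hFmono s r (haR0.trans hs) hr) (by positivity)
  have hGpow : ∀ r, R0 ≤ r → G r ^ (n+1) = F r := by
    intro r hr
    have := Real.rpow_inv_natCast_pow (hFpos r hr).le (Nat.succ_ne_zero n)
    simpa [hG, one_div] using this
  have hGpos : ∀ r, R0 ≤ r → 0 < G r := fun r hr => Real.rpow_pos_of_pos (hFpos r hr) _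
  have hGunb : ∀ B, ∃ r, R0 ≤ r ∧ B < G r := by
    intro B
    obtain ⟨r, hra, hr⟩ := hFunb ((max B 0) ^ (n+1))
    refine ⟨max r R0, le_max_right _ _, ?_⟩
    have h1 : (max B 0)^(n+1) < G (max r R0) ^ (n+1) := by
      rw [hGpow _ (le_max_right _ _)]
      exact hr.trans_le (hFmono _ _ hra (le_max_left _ _))
    exact (le_max_left _ _).trans_lt
      (lt_of_pow_lt_pow_left₀ _ (hGpos _ (le_max_right _ _)).le h1)
  have hp0 : (0:ℝ) < (1:ℝ)/(n+1:ℕ) := by positivity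
  -- combined increment estimate
  have hinc : ∀ s r c, R0 ≤ s → s ≤ r → 0 < c → (∀ t ∈ Icc (w r) (w s), c ≤ h t) →
      G r - G s ≤ (K3 * K2) ^ ((1:ℝ)/(n+1:ℕ)) * (w s / c) ^ ((1:ℝ)/(n+1:ℕ)) := by
    intro s r c hs hsr hc hch
    have hsa := haR0.trans hs
    have h1 := hest s r c hsa hsr hc.le hch
    have h2 : (G r - G s) ^ (n+1) ≤ K3 * ∫ ξ in s..r, (ξ - s)^n * f ξ := hg s r hs hsr
    have h3 := hwpos r (hsa.trans hsr)
    have h3' := hwpos s hsa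
    have h4 : ∫ ξ in s..r, (ξ - s)^n * f ξ ≤ K2 * (w s / c) := by
      rw [← mul_div_assoc, le_div_iff₀ hc]
      nlinarith
    have h5 : (G r - G s) ^ (n+1) ≤ K3 * K2 * (w s / c) := by
      refine h2.trans ?_
      rw [mul_assoc]; gcongr
    have h6 : 0 ≤ G r - G s := by linarith [hGmono s r hs hsr]
    rw [← Real.mul_rpow (by positivity) (by positivity)]
    have h7 := Real.rpow_le_rpow (by positivity) h5 hp0.le
    rw [one_div, Real.pow_rpow_inv_natCast h6 (Nat.succ_ne_zero n)] at h7
    rw [one_div]; exact h7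
  by_cases hlim : ∃ ε, 0 < ε ∧ ∀ r, R0 ≤ r → ε ≤ w r
  · obtain ⟨ε, hε, hεw⟩ := hlim
    have hsub : Icc ε (w R0) ⊆ Ioi 0 := fun x hx => hε.trans_le hx.1
    obtain ⟨t0, ht0, hmin⟩ := isCompact_Icc.exists_isMinOn (nonempty_Icc.2 (hεw R0 le_rfl))
      (hh_cont.mono hsub)
    obtain ⟨r, hr, hGr⟩ := hGunb
      (G R0 + (K3 * K2) ^ ((1:ℝ)/(n+1:ℕ)) * (w R0 / h t0) ^ ((1:ℝ)/(n+1:ℕ)))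
    have := hinc R0 r (h t0) le_rfl hr (hh_pos _ (hsub ht0)) (fun t ht =>
      hmin ⟨(hεw r hr).trans ht.1, ht.2⟩)
    linarith
  push Not at hlim
  set lam := Real.sqrt θ with hlam
  have hlam1 : 1 < lam := Real.lt_sqrt_of_sq_lt (by linarith)
  set ε0 := min 1 (w R0) with hε0
  have hε0pos : 0 < ε0 := lt_min one_pos (hwpos R0 haR0)
  have hex : ∀ k : ℕ, ∃ s, R0 ≤ s ∧ w s = ε0 / lam^k := by
    intro k
    have hk : 0 < ε0 / lam ^ k := by positivity
    obtain ⟨r, hr, hwr⟩ := hlim _ hk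
    have hk1 : ε0 / lam^k ≤ w R0 :=
      (div_le_self hε0pos.le (one_le_pow₀ hlam1.le)).trans (min_le_right _ _)
    obtain ⟨s, hs, hws⟩ := intermediate_value_Icc' hr hwcont.continuousOn ⟨hwr.le, hk1⟩
    exact ⟨s, hs.1, hws⟩
  choose s hsR hsw using hex
  set κ := (1 - 1/lam) / (K3 * K2) ^ ((1:ℝ)/(n+1:ℕ)) with hκ
  have hlam2 : 0 < 1 - 1/lam := by
    have : 1/lam < 1 := by rw [div_lt_one (by linarith)]; exact hlam1
    linarith
  have hKpos : 0 < (K3 * K2) ^ ((1:ℝ)/(n+1:ℕ)) := by positivity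
  have hκ0 : 0 < κ := by positivity
  set u : ℝ → ENNReal := fun t =>
    ENNReal.ofReal ((gFun θ h t) ^ (-(1 : ℝ) / (n+1:ℕ)) * t ^ ((1 : ℝ) / (n+1:ℕ) - 1)) with hu
  have hsum : ∀ k : ℕ, ENNReal.ofReal (κ * (G (s k) - G (s 0))) ≤
      ∫⁻ t in Ioo (ε0 / lam^k) ε0, u t := by
    intro k
    induction k with
    | zero => simp
    | succ k ih =>
      have hk : 0 < ε0 / lam ^ k := by positivity
      obtain ⟨c, hc, hch, hlint⟩ := lint_step (n+1) (by omega) θ hθ h hh_cont hh_pos _ hk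
      have e : ε0 / lam^k / Real.sqrt θ = ε0 / lam^(k+1) := by
        rw [← hlam, pow_succ, div_div]
      rw [e] at hch hlint
      have hlt : ε0 / lam^(k+1) < ε0 / lam^k := by
        rw [← e, ← hlam]; exact div_lt_self hk hlam1
      have hss : s k ≤ s (k+1) := by
        by_contra hlt'
        push Not at hlt'
        have := hanti (s (k+1)) (s k) (haR0.trans (hsR _)) hlt'.le
        rw [hsw, hsw] at this
        linarith
      have h1 := hinc (s k) (s (k+1)) c (hsR k) hss hc (by rw [hsw, hsw]; exact hch)
      rw [hsw] at h1
      have h2 : κ * (G (s (k+1)) - G (s k)) ≤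
          (1 - 1/lam) * (ε0 / lam^k / c) ^ ((1:ℝ)/(n+1:ℕ)) := by
        rw [hκ, div_mul_eq_mul_div, div_le_iff₀ hKpos]
        calc _ ≤ (1 - 1/lam) * ((K3 * K2) ^ ((1:ℝ)/(n+1:ℕ)) *
              (ε0 / lam^k / c) ^ ((1:ℝ)/(n+1:ℕ))) := by gcongr
          _ = _ := by ring
      have h3 : ENNReal.ofReal (κ * (G (s (k+1)) - G (s k))) ≤
          ∫⁻ t in Ioo (ε0 / lam^(k+1)) (ε0 / lam^k), u t :=
        (ENNReal.ofReal_le_ofReal h2).trans hlint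
      have e2 : κ * (G (s (k+1)) - G (s 0)) =
          κ * (G (s (k+1)) - G (s k)) + κ * (G (s k) - G (s 0)) := by ring
      rw [e2]
      refine ENNReal.ofReal_add_le.trans ((add_le_add h3 ih).trans ?_)
      rw [← lintegral_union measurableSet_Ioo]
      · apply lintegral_mono_set
        apply union_subset
        · exact Ioo_subset_Ioo_right (div_le_self hε0pos.le (one_le_pow₀ hlam1.le))
        · exact Ioo_subset_Ioo_left hlt.le
      · rw [Set.disjoint_left]
        intro x hx hx'
        exact absurd hx.2 (not_lt.2 hx'.1.le)
  have hbound : ∀ k : ℕ, κ * (G (s k) - G (s 0)) ≤ (∫⁻ t in Ioo (0:ℝ) 1, u t).toReal := by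
    intro k
    rw [← ENNReal.ofReal_le_iff_le_toReal hg_int]
    refine (hsum k).trans (lintegral_mono_set ?_)
    exact Ioo_subset_Ioo (by positivity) (min_le_left _ _)
  obtain ⟨r, hr, hGr⟩ := hGunb (G (s 0) + (∫⁻ t in Ioo (0:ℝ) 1, u t).toReal / κ)
  have hwr := hwpos r (haR0.trans hr)
  obtain ⟨k, hk⟩ := pow_unbounded_of_one_lt (ε0 / w r) hlam1
  have hk2 : w (s k) < w r := by
    rw [hsw, div_lt_iff₀ (by positivity)]
    rw [div_lt_iff₀ hwr] at hk
    linarith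
  have hrs : r ≤ s k := by
    by_contra hlt
    push Not at hlt
    have := hanti (s k) r (haR0.trans (hsR k)) hlt.le
    linarith
  have h1 := hGmono r (s k) hr hrs
  have h2 := hbound k
  rw [mul_comm, ← le_div_iff₀ hκ0] at h2
  linarith
end

section
/- Suppose λ < 1, s > −1 and l ≥ s − 1. Then every nontrivial Kneser solution of the second-order problem is singular of the first kind, i.e. there exists R ≥ a with w(r) = 0 for all r ≥ R. -/
open MeasureTheory Filter Set

/-- A Kneser solution of the second-order problem `w'' + b(r) w' = p(r) F(w)` on `[a, ∞)`:
`w` is twice differentiable, `w` and `w'` satisfy the fundamental-theorem-of-calculus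
identities on `[a, ∞)` (with `w''` locally integrable), `w ≥ 0` and `w' ≤ 0` on `[a, ∞)`,
and the equation holds for a.e. `r ≥ a` with `w r > 0`. -/
def IsKneser2 (a : ℝ) (b p : ℝ → ℝ) (F : ℝ → ℝ) (w : ℝ → ℝ) : Prop :=
  Differentiable ℝ w ∧ Differentiable ℝ (deriv w) ∧
  (∀ r, a ≤ r → IntervalIntegrable (deriv (deriv w)) volume a r) ∧
  (∀ r, a ≤ r → w r = w a + ∫ ξ in a..r, deriv w ξ) ∧
  (∀ r, a ≤ r → deriv w r = deriv w a + ∫ ξ in a..r, deriv (deriv w) ξ) ∧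
  (∀ r, a ≤ r → 0 ≤ w r ∧ deriv w r ≤ 0) ∧
  (∀ᵐ r ∂(volume.restrict (Ici a)), 0 < w r →
    deriv (deriv w) r + b r * deriv w r = p r * F (w r))

theorem aux_ae_to_pointwise (g G : ℝ → ℝ) (R : ℝ) (hg : Differentiable ℝ g)
    (hint : ∀ x y, R ≤ x → x ≤ y → IntervalIntegrable (deriv g) volume x y)
    (hftc : ∀ x y, R ≤ x → x ≤ y → g y - g x = ∫ t in x..y, deriv g t)
    (hG : ContinuousOn G (Ici R))
    (hae : ∀ᵐ t ∂(volume.restrict (Ici R)), G t ≤ deriv g t) :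
    ∀ x, R < x → G x ≤ deriv g x := by
  intro x hx
  have hGi : ∀ u v, R ≤ u → u ≤ v → IntervalIntegrable G volume u v := by
    intro u v hu huv
    apply ContinuousOn.intervalIntegrable
    rw [uIcc_of_le huv]
    exact hG.mono (fun t ht => le_trans hu ht.1)
  have hGx : ContinuousAt G x := hG.continuousAt (Ici_mem_nhds hx)
  have hmono : MonotoneOn (fun y => g y - ∫ t in R..y, G t) (Ici R) := by
    intro u hu v hv huv
    have h1 := hftc u v hu huv
    have h2 : ∫ t in u..v, G t ≤ ∫ t in u..v, deriv g t := by
      apply intervalIntegral.integral_mono_ae_restrict huv (hGi u v hu huv) (hint u v hu huv)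
      exact ae_restrict_of_ae_restrict_of_subset (fun t ht => le_trans hu ht.1) hae
    have h3 := intervalIntegral.integral_add_adjacent_intervals
      (hGi R u le_rfl hu) (hGi u v hu huv)
    simp only
    linarith
  have hd : HasDerivAt (fun y => g y - ∫ t in R..y, G t) (deriv g x - G x) x := by
    apply (hg x).hasDerivAt.sub
    apply intervalIntegral.integral_hasDerivAt_right (hGi R x le_rfl hx.le) _ hGx
    exact (hG.mono Ioi_subset_Ici_self).stronglyMeasurableAtFilter isOpen_Ioi x hx
  have h4 := hmono.derivWithin_nonneg (x := x)
  rw [(hd.hasDerivWithinAt).derivWithin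
    ((uniqueDiffOn_Ici R) x hx.le)] at h4
  linarith

/-- A function with `f' ≤ -ε/r` on `[R, ∞)` becomes negative. -/
theorem aux_log_decay (f f' : ℝ → ℝ) (R ε : ℝ) (hR : 0 < R) (hε : 0 < ε)
    (hf : ∀ x, R ≤ x → HasDerivAt f (f' x) x)
    (hf' : ∀ x, R ≤ x → f' x ≤ -(ε / x)) (hpos : ∀ x, R ≤ x → 0 ≤ f x) : False := by
  have hd : ∀ x, R ≤ x → HasDerivAt (fun x => f x + ε * Real.log x) (f' x + ε * x⁻¹) x := by
    intro x hx
    exact (hf x hx).add ((Real.hasDerivAt_log (by linarith)).const_mul ε)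
  have hanti : AntitoneOn (fun x => f x + ε * Real.log x) (Ici R) := by
    apply antitoneOn_of_deriv_nonpos (convex_Ici R)
    · intro x hx
      exact (hd x hx).continuousAt.continuousWithinAt
    · intro x hx
      rw [interior_Ici] at hx
      exact (hd x (le_of_lt hx)).differentiableAt.differentiableWithinAt
    · intro x hx
      rw [interior_Ici] at hx
      rw [(hd x (le_of_lt hx)).deriv]
      have := hf' x (le_of_lt hx)
      rw [div_eq_mul_inv] at this
      linarith
  have ht : Tendsto (fun x => ε * Real.log x) atTop atTop :=
    Real.tendsto_log_atTop.const_mul_atTop hε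
  obtain ⟨x, hx1, hx2⟩ :=
    ((ht.eventually_gt_atTop (f R + ε * Real.log R)).and (eventually_ge_atTop R)).exists
  have h := hanti (self_mem_Ici) hx2 hx2
  simp only at h
  linarith [hpos x hx2]

/-- Algebraic core. -/
theorem aux_core (x q z z0 A c B m ε rs rl : ℝ) (hx : 1 ≤ x) (hq : 0 ≤ q)
    (hB : 0 < B) (hc : 0 < c) (hz0 : 0 < z0) (hz : z0 ≤ z) (hε : 0 < ε)
    (hqε : x * q ≤ ε) (hrs : rs ≤ x * rl) (hrs0 : 0 ≤ rs) (hrl : 1 ≤ x ^ 2 * rl)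
    (e1 : |m| * ε ^ 2 ≤ c / 2) (e2 : B * ε ≤ z0 * c / 4) (e3 : ε ≤ z0 * c / 8)
    (hA : A ≤ B * rs * q - c * rl * z + m * q ^ 2 * z) :
    q + x * A ≤ -(ε / x) := by
  have hx0 : 0 < x := by linarith
  have hrl0 : 0 < rl := by
    by_contra h
    have : x ^ 2 * rl ≤ 0 := mul_nonpos_of_nonneg_of_nonpos (by positivity) (not_lt.mp h)
    linarith
  have a1 : (x * q) ^ 2 ≤ ε ^ 2 := by gcongr
  have a2 : q ^ 2 ≤ ε ^ 2 * rl := by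
    have : x ^ 2 * q ^ 2 ≤ x ^ 2 * (ε ^ 2 * rl) := by nlinarith [sq_nonneg ε]
    exact le_of_mul_le_mul_left this (by positivity)
  have a3 : m * q ^ 2 ≤ c / 2 * rl := by
    calc m * q ^ 2 ≤ |m| * q ^ 2 := by gcongr; exact le_abs_self m
      _ ≤ |m| * (ε ^ 2 * rl) := by gcongr
      _ = (|m| * ε ^ 2) * rl := by ring
      _ ≤ c / 2 * rl := by gcongr
  have a4 : m * q ^ 2 * z - c * rl * z ≤ - (z0 * c / 2 * rl) := by
    have : z0 * (c / 2 * rl) ≤ z * (c * rl - m * q ^ 2) := by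
      apply mul_le_mul hz _ (by positivity) (by linarith)
      linarith
    linarith
  have a5 : B * rs * q ≤ z0 * c / 4 * rl := by
    calc B * rs * q ≤ B * (x * rl) * q := by gcongr
      _ = B * (x * q) * rl := by ring
      _ ≤ B * ε * rl := by gcongr
      _ ≤ _ := by gcongr
  have a6 : A ≤ -(z0 * c / 4 * rl) := by linarith
  have a7 : x * (q + x * A) ≤ -ε := by
    have : x ^ 2 * A ≤ x ^ 2 * (-(z0 * c / 4 * rl)) := by gcongr
    have : z0 * c / 4 * 1 ≤ z0 * c / 4 * (x ^ 2 * rl) := by gcongr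
    nlinarith
  rw [← neg_div, le_div_iff₀ hx0]
  linarith

/-- Example 2.1 (case `s > -1`): if `λ < 1`, `s > -1`, `l ≥ s - 1`, `|b(r)| ≤ B r^s` for
large `r` and `p(r) ∼ r^l` at infinity, then every non-trivial Kneser solution of
`w'' + b(r) w' = p(r) w^λ` is singular of the first kind. -/
theorem second_order_singular_of_l_ge_s_sub_one
    (a lam s l B : ℝ) (ha : 0 < a) (hlam : lam < 1) (hs : -1 < s) (hl : s - 1 ≤ l)
    (hB : 0 < B) (b p : ℝ → ℝ) (hb_meas : Measurable b) (hp_meas : Measurable p)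
    (hb_loc : ∀ r, ∃ M, ∀ x ∈ Icc a r, |b x| ≤ M)
    (hp_loc : ∀ r, ∃ M, ∀ x ∈ Icc a r, |p x| ≤ M)
    (hp_nonneg : ∀ r, a ≤ r → 0 ≤ p r)
    (hb_bound : ∀ᶠ r in atTop, |b r| ≤ B * r ^ s)
    (hp_sim : ∃ c₁ > (0 : ℝ), ∃ c₂ > (0 : ℝ), ∃ R : ℝ,
      ∀ᵐ r ∂(volume.restrict (Ici R)), c₁ * r ^ l ≤ p r ∧ p r ≤ c₂ * r ^ l)
    (w : ℝ → ℝ) (hw : IsKneser2 a b p (fun t => t ^ lam) w)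
    (hnt : ∃ r, a ≤ r ∧ w r ≠ 0) :
    ∃ R, a ≤ R ∧ ∀ r, R ≤ r → w r = 0 := by
  obtain ⟨hd1, hd2, hii, hw1, hw2, hsgn, heq⟩ := hw
  obtain ⟨c, hc, c₂, hc₂, R₂, hp⟩ := hp_sim
  obtain ⟨R₁, hb⟩ := eventually_atTop.mp hb_bound
  have hanti : AntitoneOn w (Ici a) := by
    apply antitoneOn_of_deriv_nonpos (convex_Ici a) hd1.continuous.continuousOn
      hd1.differentiableOn
    intro x hx
    rw [interior_Ici] at hx
    exact (hsgn x (le_of_lt hx)).2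
  by_contra hcon
  have hwpos : ∀ r, a ≤ r → 0 < w r := by
    intro r hr
    rcases (hsgn r hr).1.lt_or_eq with h | h
    · exact h
    · exact absurd ⟨r, hr, fun t ht => le_antisymm
        (by rw [h]; exact hanti hr (le_trans hr ht) ht) (hsgn t (le_trans hr ht)).1⟩ hcon
  clear hcon hnt
  obtain ⟨R, hRa, hR1, hRR1, hRR2⟩ : ∃ R, a ≤ R ∧ 1 ≤ R ∧ R₁ ≤ R ∧ R₂ ≤ R :=
    ⟨max (max a 1) (max R₁ R₂), by simp, by simp, by simp, by simp⟩
  -- pointwise differential inequality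
  have hpt : ∀ x, R < x →
      B * x ^ s * deriv w x + c * x ^ l * (w x) ^ lam ≤ deriv (deriv w) x := by
    apply aux_ae_to_pointwise (deriv w)
      (fun x => B * x ^ s * deriv w x + c * x ^ l * (w x) ^ lam) R hd2
    · intro x y hx hxy
      exact (hii x (hRa.trans hx)).symm.trans (hii y (hRa.trans (hx.trans hxy)))
    · intro x y hx hxy
      have h1 := hw2 x (hRa.trans hx)
      have h2 := hw2 y (hRa.trans (hx.trans hxy))
      have h3 := intervalIntegral.integral_interval_sub_left
        (hii y (hRa.trans (hx.trans hxy))) (hii x (hRa.trans hx))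
      linarith
    · intro x hx
      have hx : R ≤ x := hx
      have hx0 : x ≠ 0 := by linarith
      have hwx : w x ≠ 0 := (hwpos x (hRa.trans hx)).ne'
      apply ContinuousAt.continuousWithinAt
      have k1 : ContinuousAt (fun x : ℝ => x ^ s) x := Real.continuousAt_rpow_const x s (Or.inl hx0)
      have k2 : ContinuousAt (fun x : ℝ => x ^ l) x := Real.continuousAt_rpow_const x l (Or.inl hx0)
      have k3 : ContinuousAt (fun x : ℝ => w x ^ lam) x :=
        (hd1 x).continuousAt.rpow_const (Or.inl hwx)
      have k4 : ContinuousAt (deriv w) x := (hd2 x).continuousAt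
      exact ((continuousAt_const.mul k1).mul k4).add ((continuousAt_const.mul k2).mul k3)
    · have h1 := ae_restrict_of_ae_restrict_of_subset (Ici_subset_Ici.mpr hRa) heq
      have h2 := ae_restrict_of_ae_restrict_of_subset (Ici_subset_Ici.mpr hRR2) hp
      filter_upwards [h1, h2, ae_restrict_mem measurableSet_Ici] with x e1 e2 hx
      have hx : R ≤ x := hx
      have hwx := hwpos x (hRa.trans hx)
      have e1 := e1 hwx
      have hv := (hsgn x (hRa.trans hx)).2
      have hbx := hb x (hRR1.trans hx)
      have e3 : c * x ^ l * w x ^ lam ≤ p x * w x ^ lam := by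
        have := Real.rpow_nonneg hwx.le lam
        gcongr
        exact e2.1
      have e4 : b x * deriv w x ≤ -(B * x ^ s * deriv w x) := by
        have := neg_abs_le (b x)
        nlinarith
      linarith
  -- the exponent
  obtain ⟨m, hm⟩ : ∃ m, m = (1 + lam) / 2 := ⟨_, rfl⟩
  have hm1 : m < 1 := by linarith
  have hwa := hwpos a le_rfl
  obtain ⟨z0, hz0e⟩ : ∃ z0, z0 = w a ^ (m - 1) := ⟨_, rfl⟩
  have hz0 : 0 < z0 := by rw [hz0e]; exact Real.rpow_pos_of_pos hwa _
  obtain ⟨ε, hε, e1, e2, e3⟩ : ∃ ε : ℝ, 0 < ε ∧ |m| * ε ^ 2 ≤ c / 2 ∧ B * ε ≤ z0 * c / 4 ∧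
      ε ≤ z0 * c / 8 := by
    have t1 : Tendsto (fun ε : ℝ => |m| * ε ^ 2) (nhdsWithin 0 (Ioi 0)) (nhds 0) := by
      have : Continuous (fun ε : ℝ => |m| * ε ^ 2) := by fun_prop
      have := (this.tendsto 0).mono_left (nhdsWithin_le_nhds (s := Ioi 0))
      simpa using this
    have t2 : Tendsto (fun ε : ℝ => B * ε) (nhdsWithin 0 (Ioi 0)) (nhds 0) := by
      have : Continuous (fun ε : ℝ => B * ε) := by fun_prop
      have := (this.tendsto 0).mono_left (nhdsWithin_le_nhds (s := Ioi 0))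
      simpa using this
    have t3 : Tendsto (fun ε : ℝ => ε) (nhdsWithin 0 (Ioi 0)) (nhds 0) :=
      tendsto_id.mono_left nhdsWithin_le_nhds
    obtain ⟨ε, h⟩ := (((t1.eventually_le_const (show 0 < c / 2 by positivity)).and
      (t2.eventually_le_const (show 0 < z0 * c / 4 by positivity))).and
      ((t3.eventually_le_const (show 0 < z0 * c / 8 by positivity)).and
      (self_mem_nhdsWithin))).exists
    exact ⟨ε, h.2.2, h.1.1, h.1.2, h.2.1⟩
  -- q and Q
  have hwd : ∀ (k x : ℝ), R < x → HasDerivAt (fun x => w x ^ k)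
      (deriv w x * k * w x ^ (k - 1)) x := by
    intro k x hx
    exact (hd1 x).hasDerivAt.rpow_const (Or.inl (hwpos x (by linarith)).ne')
  have hQd : ∀ x, R < x → HasDerivAt (fun x => x * (w x ^ (-m) * (-deriv w x)))
      (w x ^ (-m) * (-deriv w x) + x * (deriv w x * (-m) * w x ^ (-m - 1) * (-deriv w x) +
        w x ^ (-m) * (-deriv (deriv w) x))) x := by
    intro x hx
    have h := (hasDerivAt_id x).mul ((hwd (-m) x hx).mul (hd2 x).hasDerivAt.neg)
    refine h.congr_deriv ?_
    simp [Pi.mul_apply, Pi.neg_apply]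
  have hQ0 : ∀ x, R < x → 0 ≤ w x ^ (-m) * (-deriv w x) := by
    intro x hx
    exact mul_nonneg (Real.rpow_nonneg (hwpos x (by linarith)).le _)
      (by linarith [(hsgn x (by linarith)).2])
  have hkey : ∀ x, R < x → x * (w x ^ (-m) * (-deriv w x)) ≤ ε →
      (w x ^ (-m) * (-deriv w x) + x * (deriv w x * (-m) * w x ^ (-m - 1) * (-deriv w x) +
        w x ^ (-m) * (-deriv (deriv w) x))) ≤ -(ε / x) := by
    intro x hx hle
    have hwx := hwpos x (by linarith)
    have hx0 : 0 < x := by linarith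
    have hx1 : 1 ≤ x := by linarith
    apply aux_core x _ (w x ^ (m - 1)) z0 _ c B m ε (x ^ s) (x ^ l) hx1 (hQ0 x hx) hB hc hz0 _ hε
      hle _ (Real.rpow_nonneg hx0.le _) _ e1 e2 e3
    · have h1 := mul_le_mul_of_nonneg_left (hpt x hx) (Real.rpow_nonneg hwx.le (-m))
      have h2 : w x ^ (-m) * w x ^ lam = w x ^ (m - 1) := by
        rw [← Real.rpow_add hwx]; congr 1; rw [hm]; ring
      have h3 : w x ^ (-m - 1) = (w x ^ (-m)) ^ 2 * w x ^ (m - 1) := by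
        rw [← Real.rpow_natCast, ← Real.rpow_mul hwx.le, ← Real.rpow_add hwx]
        congr 1; push_cast; ring
      rw [h3, ← h2]
      rw [← h2] at h3
      nlinarith
    · rw [hz0e]
      exact Real.rpow_le_rpow_of_nonpos hwx (hanti self_mem_Ici (mem_Ici.mpr (by linarith))
        (by linarith)) (by linarith)
    · calc x ^ s ≤ x ^ (1 + l) := Real.rpow_le_rpow_of_exponent_le hx1 (by linarith)
        _ = x * x ^ l := by rw [Real.rpow_add hx0, Real.rpow_one]
    · calc (1 : ℝ) ≤ x ^ (2 + l) := Real.one_le_rpow hx1 (by linarith)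
        _ = x ^ 2 * x ^ l := by rw [Real.rpow_add hx0, Real.rpow_two]
  by_cases hcase : ∃ r₁, R < r₁ ∧ r₁ * (w r₁ ^ (-m) * (-deriv w r₁)) ≤ ε
  · obtain ⟨r₁, hr₁, hle⟩ := hcase
    have hstay : ∀ x, r₁ ≤ x → x * (w x ^ (-m) * (-deriv w x)) ≤ ε := by
      intro x hx
      have := image_le_of_deriv_right_lt_deriv_boundary (a := r₁) (b := x)
        (f := fun x => x * (w x ^ (-m) * (-deriv w x)))
        (f' := fun x => (w x ^ (-m) * (-deriv w x) + x * (deriv w x * (-m) * w x ^ (-m - 1) *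
          (-deriv w x) + w x ^ (-m) * (-deriv (deriv w) x))))
        (B := fun _ => ε) (B' := fun _ => 0)
        (fun t ht => (hQd t (by linarith [ht.1])).continuousAt.continuousWithinAt)
        (fun t ht => (hQd t (by linarith [ht.1])).hasDerivWithinAt) hle
        (fun t => hasDerivAt_const t ε)
        (fun t ht he => by
          have h1 := hkey t (by linarith [ht.1]) he.le
          have h2 : 0 < ε / t := div_pos hε (by linarith [ht.1])
          linarith)
      exact this (right_mem_Icc.mpr hx)
    exact aux_log_decay _ _ r₁ ε (by linarith) hε (fun x hx => hQd x (by linarith))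
      (fun x hx => hkey x (by linarith) (hstay x hx))
      (fun x hx => mul_nonneg (by linarith) (hQ0 x (by linarith)))
  · push Not at hcase
    refine aux_log_decay _ _ (R + 1) ((1 - m) * ε) (by linarith) (mul_pos (by linarith) hε)
      (fun x hx => hwd (1 - m) x (by linarith)) ?_
      (fun x hx => Real.rpow_nonneg (hwpos x (by linarith)).le _)
    intro x hx
    have h := hcase x (by linarith)
    have hx0 : 0 < x := by linarith
    have h2 : ε / x ≤ w x ^ (-m) * (-deriv w x) := by
      rw [div_le_iff₀ hx0]; linarith
    have h3 : (1 - m - 1) = -m := by ring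
    rw [h3, mul_div_assoc]
    have h4 := mul_le_mul_of_nonneg_left h2 (show 0 ≤ 1 - m by linarith)
    linarith
end

section
/- Suppose λ < 1, s ≤ −1 and l ≥ −2. Then every nontrivial Kneser solution of the second-order problem is singular of the first kind, i.e. there exists R ≥ a with w(r) = 0 for all r ≥ R. -/
open MeasureTheory Filter Set

theorem helper_lin (f f' : ℝ → ℝ) (T κ : ℝ) (hκ : 0 < κ)
    (hf : ∀ t, T ≤ t → HasDerivAt f (f' t) t) (hf' : ∀ t, T ≤ t → f' t ≤ -κ)
    (L : ℝ) (hL : ∀ t, T ≤ t → L ≤ f t) : False := by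
  have key : ∀ t, T ≤ t → f t ≤ f T + -κ * (t - T) := by
    intro t ht
    have := (convex_Ici T).image_sub_le_mul_sub_of_deriv_le (f := f) (C := -κ)
      (fun x hx => (hf x hx).continuousAt.continuousWithinAt)
      (fun x hx => (hf x (interior_subset hx)).differentiableAt.differentiableWithinAt)
      (fun x hx => by
        rw [(hf x (interior_subset hx)).deriv]; exact hf' x (interior_subset hx))
      T (by simp) t ht ht
    linarith
  have h1 := key (T + ((f T - L) / κ + 1)) (by
    have : 0 ≤ (f T - L) / κ := div_nonneg (by linarith [hL T le_rfl]) hκ.le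
    linarith)
  have h2 := hL (T + ((f T - L) / κ + 1)) (by
    have : 0 ≤ (f T - L) / κ := div_nonneg (by linarith [hL T le_rfl]) hκ.le
    linarith)
  have h3 : κ * ((f T - L) / κ) = f T - L := by field_simp
  nlinarith

theorem helper_core (U V V' : ℝ → ℝ) (T M k c ν : ℝ) (hM : 0 < M) (hk : 0 ≤ k) (hc : 0 < c)
    (hν0 : 0 ≤ ν) (hν1 : ν < 1)
    (hU : ∀ t, T ≤ t → HasDerivAt U (-V t) t) (hV : ∀ t, T ≤ t → HasDerivAt V (V' t) t)
    (hU0 : ∀ t, T ≤ t → 0 < U t) (hUM : ∀ t, T ≤ t → U t ≤ M)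
    (hV0 : ∀ t, T ≤ t → 0 ≤ V t)
    (hV' : ∀ t, T ≤ t → V' t ≤ k * V t - c * U t ^ ν) : False := by
  obtain ⟨μ, hμ⟩ : ∃ μ, μ = (1 + ν) / 2 := ⟨_, rfl⟩
  have hμ0 : 0 < μ := by linarith
  have hμ1 : μ < 1 := by linarith
  obtain ⟨K, hK⟩ : ∃ K, K = k * M ^ (μ - ν) + 1 := ⟨_, rfl⟩
  have hMp : 0 < M ^ (μ - ν) := Real.rpow_pos_of_pos hM _
  have hK0 : 0 < K := by rw [hK]; positivity
  obtain ⟨δ, hδ⟩ : ∃ δ, δ = min 1 (c / 2 / K) := ⟨_, rfl⟩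
  have hδ0 : 0 < δ := by rw [hδ]; exact lt_min one_pos (by positivity)
  have hδ1 : δ ≤ 1 := by rw [hδ]; exact min_le_left _ _
  have hδK : δ * K ≤ c / 2 := by
    rw [← le_div_iff₀ hK0, hδ]; exact min_le_right _ _
  have hφ : ∀ t, T ≤ t → HasDerivAt (fun t => V t - δ * U t ^ μ)
      (V' t + δ * (μ * U t ^ (μ - 1) * V t)) t := by
    intro t ht
    have h1 := (hU t ht).rpow_const (p := μ) (Or.inl (hU0 t ht).ne')
    have := (hV t ht).sub (h1.const_mul δ)
    refine this.congr_deriv ?_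
    ring
  have hneg : ∀ t, T ≤ t → V t - δ * U t ^ μ < 0 →
      V' t + δ * (μ * U t ^ (μ - 1) * V t) ≤ -(c / 2) * U t ^ ν := by
    intro t ht hlt
    have hu := hU0 t ht
    have e1 : U t ^ μ = U t ^ ν * U t ^ (μ - ν) := by
      rw [← Real.rpow_add hu]; ring_nf
    have e2 : U t ^ (μ - 1) * U t ^ μ = U t ^ ν := by
      rw [← Real.rpow_add hu]; congr 1; rw [hμ]; ring
    have hle : U t ^ (μ - ν) ≤ M ^ (μ - ν) :=
      Real.rpow_le_rpow hu.le (hUM t ht) (by linarith)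
    have p1 : 0 < U t ^ ν := Real.rpow_pos_of_pos hu _
    have p2 : 0 < U t ^ (μ - 1) := Real.rpow_pos_of_pos hu _
    have s1 : k * V t ≤ k * (δ * (U t ^ ν * M ^ (μ - ν))) := by
      apply mul_le_mul_of_nonneg_left _ hk
      refine hlt.le |> sub_nonpos.mp |>.trans ?_
      rw [e1]; gcongr
    have s2 : δ * (μ * U t ^ (μ - 1) * V t) ≤ δ * U t ^ ν := by
      apply mul_le_mul_of_nonneg_left _ hδ0.le
      have hV1 : V t ≤ U t ^ μ := by
        have : δ * U t ^ μ ≤ 1 * U t ^ μ := by gcongr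
        linarith
      calc μ * U t ^ (μ - 1) * V t ≤ 1 * U t ^ (μ - 1) * U t ^ μ := by
            have := hV0 t ht
            gcongr
        _ = U t ^ ν := by rw [one_mul, e2]
    have s3 : δ * K * U t ^ ν ≤ c / 2 * U t ^ ν := by gcongr
    have := hV' t ht
    rw [hK] at s3
    nlinarith
  by_cases hex : ∃ t0, T ≤ t0 ∧ V t0 - δ * U t0 ^ μ < 0
  · obtain ⟨t0, ht0, hlt⟩ := hex
    have hstay : ∀ t, t0 ≤ t → V t - δ * U t ^ μ ≤ V t0 - δ * U t0 ^ μ := by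
      intro t ht
      refine image_le_of_deriv_right_lt_deriv_boundary (a := t0) (b := t)
        (f := fun t => V t - δ * U t ^ μ)
        (f' := fun t => V' t + δ * (μ * U t ^ (μ - 1) * V t))
        (B := fun _ => V t0 - δ * U t0 ^ μ) (B' := fun _ => 0) ?_ ?_ le_rfl ?_ ?_ ⟨ht, le_rfl⟩
      · intro x hx
        exact (hφ x (ht0.trans hx.1)).continuousAt.continuousWithinAt
      · intro x hx
        exact (hφ x (ht0.trans hx.1)).hasDerivWithinAt
      · intro x
        exact hasDerivAt_const _ _
      · intro x hx heq
        have hx' := ht0.trans hx.1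
        have := hneg x hx' (heq.trans_lt hlt)
        have p1 : 0 < U x ^ ν := Real.rpow_pos_of_pos (hU0 x hx') _
        nlinarith
    obtain ⟨ε, hε⟩ : ∃ ε, ε = -(V t0 - δ * U t0 ^ μ) := ⟨_, rfl⟩
    have hε0 : 0 < ε := by linarith
    have hm : ∀ t, t0 ≤ t → ((ε / δ) ^ μ⁻¹) ^ ν ≤ U t ^ ν := by
      intro t ht
      have h1 := hstay t ht
      have h2 := hV0 t (ht0.trans ht)
      have h3 : ε / δ ≤ U t ^ μ := by rw [div_le_iff₀ hδ0]; linarith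
      have h4 : (ε / δ) ^ μ⁻¹ ≤ U t := by
        rw [Real.rpow_inv_le_iff_of_pos (by positivity) (hU0 t (ht0.trans ht)).le hμ0]
        exact h3
      exact Real.rpow_le_rpow (by positivity) h4 hν0
    have hmp : 0 < ((ε / δ) ^ μ⁻¹) ^ ν := by positivity
    refine helper_lin _ _ t0 (c / 2 * ((ε / δ) ^ μ⁻¹) ^ ν) (by positivity)
      (fun t ht => hφ t (ht0.trans ht)) ?_ (-(δ * M ^ μ)) ?_
    · intro t ht
      have h1 := hneg t (ht0.trans ht) ((hstay t ht).trans_lt hlt)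
      have h2 := hm t ht
      nlinarith
    · intro t ht
      have h2 := hV0 t (ht0.trans ht)
      have h3 : U t ^ μ ≤ M ^ μ :=
        Real.rpow_le_rpow (hU0 t (ht0.trans ht)).le (hUM t (ht0.trans ht)) hμ0.le
      nlinarith
  · push Not at hex
    refine helper_lin (fun t => U t ^ (1 - μ)) _ T ((1 - μ) * δ)
      (mul_pos (by linarith) hδ0)
      (fun t ht => (hU t ht).rpow_const (p := 1 - μ) (Or.inl (hU0 t ht).ne')) ?_ 0 ?_
    · intro t ht
      have h1 := hex t ht
      have hu := hU0 t ht
      have e : U t ^ (1 - μ - 1) * U t ^ μ = 1 := by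
        rw [← Real.rpow_add hu]; ring_nf; simp
      have p1 : 0 < U t ^ (1 - μ - 1) := Real.rpow_pos_of_pos hu _
      have h5 : δ ≤ U t ^ (1 - μ - 1) * V t := by
        have : U t ^ (1 - μ - 1) * (δ * U t ^ μ) ≤ U t ^ (1 - μ - 1) * V t := by
          apply mul_le_mul_of_nonneg_left _ p1.le
          linarith
        calc δ = U t ^ (1 - μ - 1) * (δ * U t ^ μ) := by rw [mul_left_comm, e, mul_one]
          _ ≤ _ := this
      have : (1 - μ) * δ ≤ (1 - μ) * (U t ^ (1 - μ - 1) * V t) :=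
        mul_le_mul_of_nonneg_left h5 (by linarith)
      linarith
    · intro t ht
      exact (Real.rpow_pos_of_pos (hU0 t ht) _).le

/-- An almost everywhere continuous lower bound for the derivative holds everywhere. -/
theorem helper_ae (g G : ℝ → ℝ) (a R : ℝ) (haR : a ≤ R) (hg : Differentiable ℝ g)
    (hint : ∀ r, a ≤ r → IntervalIntegrable (deriv g) volume a r)
    (hftc : ∀ r, a ≤ r → g r = g a + ∫ ξ in a..r, deriv g ξ)
    (hG : ContinuousOn G (Ici R))
    (hle : ∀ᵐ r ∂(volume.restrict (Ici R)), G r ≤ deriv g r) :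
    ∀ r, R < r → G r ≤ deriv g r := by
  intro r hr
  have hGi : ∀ x y, R ≤ x → x ≤ y → IntervalIntegrable G volume x y := by
    intro x y hx hxy
    apply ContinuousOn.intervalIntegrable
    rw [uIcc_of_le hxy]
    exact hG.mono (fun z hz => hx.trans hz.1)
  have hgi : ∀ x y, R ≤ x → x ≤ y → IntervalIntegrable (deriv g) volume x y := by
    intro x y hx hxy
    exact (hint x (haR.trans hx)).symm.trans (hint y (haR.trans (hx.trans hxy)))
  have hmono : MonotoneOn (fun x => g x - ∫ ξ in R..x, G ξ) (Ici R) := by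
    intro x hx y hy hxy
    have hx' : R ≤ x := hx
    have h1 : g y - g x = ∫ ξ in x..y, deriv g ξ := by
      rw [hftc y (haR.trans hy), hftc x (haR.trans hx),
        ← intervalIntegral.integral_add_adjacent_intervals (hint x (haR.trans hx))
          (hgi x y hx hxy)]
      ring
    have h2 : (∫ ξ in R..y, G ξ) = (∫ ξ in R..x, G ξ) + ∫ ξ in x..y, G ξ :=
      (intervalIntegral.integral_add_adjacent_intervals (hGi R x le_rfl hx)
        (hGi x y hx hxy)).symm
    have h3 : (∫ ξ in x..y, G ξ) ≤ ∫ ξ in x..y, deriv g ξ := by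
      apply intervalIntegral.integral_mono_ae_restrict hxy (hGi x y hx hxy) (hgi x y hx hxy)
      exact ae_restrict_of_ae_restrict_of_subset (fun z hz => hx'.trans hz.1) hle
    simp only
    linarith
  have hnhds : Ici R ∈ nhds r := Ici_mem_nhds hr
  have hd : HasDerivAt (fun x => ∫ ξ in R..x, G ξ) (G r) r := by
    apply intervalIntegral.integral_hasDerivAt_right (hGi R r le_rfl hr.le)
    · exact (hG.mono Ioi_subset_Ici_self).stronglyMeasurableAtFilter isOpen_Ioi r hr
    · exact hG.continuousAt hnhds
  have hd2 := ((hg r).hasDerivAt.sub hd)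
  have hnn : 0 ≤ derivWithin (fun x => g x - ∫ ξ in R..x, G ξ) (Ici R) r := hmono.derivWithin_nonneg
  rw [derivWithin_of_mem_nhds hnhds] at hnn
  have : deriv (fun x => g x - ∫ ξ in R..x, G ξ) r = deriv g r - G r := hd2.deriv
  linarith

theorem second_order_singular_of_l_ge_neg_two
    (a lam s l B : ℝ) (ha : 0 < a) (hlam : lam < 1) (hs : s ≤ -1) (hl : -2 ≤ l)
    (hB : 0 < B) (b p : ℝ → ℝ) (hb_meas : Measurable b) (hp_meas : Measurable p)
    (hb_loc : ∀ r, ∃ M, ∀ x ∈ Icc a r, |b x| ≤ M)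
    (hp_loc : ∀ r, ∃ M, ∀ x ∈ Icc a r, |p x| ≤ M)
    (hp_nonneg : ∀ r, a ≤ r → 0 ≤ p r)
    (hb_bound : ∀ᶠ r in atTop, |b r| ≤ B * r ^ s)
    (hp_sim : ∃ c₁ > (0 : ℝ), ∃ c₂ > (0 : ℝ), ∃ R : ℝ,
      ∀ᵐ r ∂(volume.restrict (Ici R)), c₁ * r ^ l ≤ p r ∧ p r ≤ c₂ * r ^ l)
    (w : ℝ → ℝ) (hw : IsKneser2 a b p (fun t => t ^ lam) w)
    (hnt : ∃ r, a ≤ r ∧ w r ≠ 0) :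
    ∃ R, a ≤ R ∧ ∀ r, R ≤ r → w r = 0 := by
  obtain ⟨hw1, hw2, hint, -, hftc, hsgn, heq⟩ := hw
  have hanti : AntitoneOn w (Ici a) := by
    apply antitoneOn_of_deriv_nonpos (convex_Ici a) hw1.continuous.continuousOn
      hw1.differentiableOn
    intro x hx
    exact (hsgn x (interior_subset hx)).2
  by_contra hcon
  have hpos : ∀ r, a ≤ r → 0 < w r := by
    intro r hr
    by_contra h0
    apply hcon
    refine ⟨r, hr, fun x hx => ?_⟩
    have h1 := hanti hr (hr.trans hx : a ≤ x) hx
    have h2 := (hsgn x (hr.trans hx)).1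
    linarith
  obtain ⟨c₁, hc₁, c₂, -, R₁, hp⟩ := hp_sim
  obtain ⟨R₂, hb⟩ := eventually_atTop.mp hb_bound
  obtain ⟨R, hR⟩ : ∃ R, R = max (max a 1) (max R₁ R₂) := ⟨_, rfl⟩
  have haR : a ≤ R := by rw [hR]; exact (le_max_left _ _).trans (le_max_left _ _)
  have h1R : 1 ≤ R := by rw [hR]; exact (le_max_right _ _).trans (le_max_left _ _)
  have hR1 : R₁ ≤ R := by rw [hR]; exact (le_max_left _ _).trans (le_max_right _ _)
  have hR2 : R₂ ≤ R := by rw [hR]; exact (le_max_right _ _).trans (le_max_right _ _)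
  have hM : 0 < w a := hpos a le_rfl
  obtain ⟨ν, hν⟩ : ∃ ν, ν = max lam 0 := ⟨_, rfl⟩
  have hν0 : 0 ≤ ν := by rw [hν]; exact le_max_right _ _
  have hνl : lam ≤ ν := by rw [hν]; exact le_max_left _ _
  have hν1 : ν < 1 := by rw [hν]; exact max_lt hlam one_pos
  obtain ⟨c, hc⟩ : ∃ c, c = c₁ * w a ^ (lam - ν) := ⟨_, rfl⟩
  have hc0 : 0 < c := by rw [hc]; positivity
  have hwa : ∀ r, a ≤ r → w r ≤ w a := fun r hr => hanti (le_refl a : a ≤ a) hr hr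
  have hlow : ∀ r, a ≤ r → w a ^ (lam - ν) * w r ^ ν ≤ w r ^ lam := by
    intro r hr
    have hu := hpos r hr
    have e : w r ^ lam = w r ^ (lam - ν) * w r ^ ν := by
      rw [← Real.rpow_add hu]; ring_nf
    rw [e]
    apply mul_le_mul_of_nonneg_right _ (Real.rpow_pos_of_pos hu _).le
    exact Real.rpow_le_rpow_of_nonpos hu (hwa r hr) (by linarith)
  have hG := helper_ae (deriv w) (fun r => c * w r ^ ν * (r ^ 2)⁻¹ + B * r⁻¹ * deriv w r) a R haR
    hw2 hint hftc (by
      have hne : ∀ x ∈ Ici R, x ≠ 0 := fun x hx => by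
        have : R ≤ x := hx
        linarith
      refine ContinuousOn.add (ContinuousOn.mul (ContinuousOn.mul continuousOn_const ?_) ?_)
        (ContinuousOn.mul (ContinuousOn.mul continuousOn_const ?_) hw2.continuous.continuousOn)
      · exact hw1.continuous.continuousOn.rpow_const (fun x hx => Or.inr hν0)
      · exact ((continuous_id.pow 2).continuousOn).inv₀ (fun x hx => pow_ne_zero 2 (hne x hx))
      · exact continuousOn_id.inv₀ hne) (by
      have hp' := ae_restrict_of_ae_restrict_of_subset (Ici_subset_Ici.mpr hR1) hp
      have heq' := ae_restrict_of_ae_restrict_of_subset (Ici_subset_Ici.mpr haR) heq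
      filter_upwards [hp', heq', ae_restrict_mem measurableSet_Ici] with r h1 h2 h3
      have hRr : R ≤ r := h3
      have har : a ≤ r := haR.trans hRr
      have hr1 : 1 ≤ r := h1R.trans hRr
      have hr0 : 0 < r := by linarith
      have hE := h2 (hpos r har)
      have hbr := hb r (hR2.trans hRr)
      have hws := (hsgn r har).2
      have hrs : r ^ s ≤ r⁻¹ := by
        rw [← Real.rpow_neg_one]; exact Real.rpow_le_rpow_of_exponent_le hr1 hs
      have hrl : (r ^ 2)⁻¹ ≤ r ^ l := by
        have : (r ^ 2)⁻¹ = r ^ (-2 : ℝ) := by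
          rw [Real.rpow_neg hr0.le]; norm_num
        rw [this]; exact Real.rpow_le_rpow_of_exponent_le hr1 hl
      have hb' : b r ≥ -(B * r⁻¹) := by
        have h5 := neg_abs_le (b r)
        have h6 : B * r ^ s ≤ B * r⁻¹ := by gcongr
        linarith
      have hb'' : b r ≤ B * r⁻¹ := by
        have h5 := le_abs_self (b r)
        have h6 : B * r ^ s ≤ B * r⁻¹ := by gcongr
        linarith
      have hpp : c₁ * (r ^ 2)⁻¹ ≤ p r := le_trans (by gcongr) h1.1
      have hpw : c₁ * (r ^ 2)⁻¹ * (w a ^ (lam - ν) * w r ^ ν) ≤ p r * w r ^ lam := by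
        apply mul_le_mul hpp (hlow r har)
        · have := hpos r har
          positivity
        · exact hp_nonneg r har
      rw [hc]
      nlinarith)
  have hT : ∀ t, Real.log (R + 1) ≤ t → R < Real.exp t := by
    intro t ht
    have := (Real.log_le_iff_le_exp (by linarith : 0 < R + 1)).mp ht
    linarith
  refine helper_core (fun t => w (Real.exp t)) (fun t => -(Real.exp t * deriv w (Real.exp t)))
    (fun t => -(Real.exp t * deriv w (Real.exp t) +
      Real.exp t * (deriv (deriv w) (Real.exp t) * Real.exp t)))
    (Real.log (R + 1)) (w a) (1 + B) c ν hM (by linarith) hc0 hν0 hν1 ?_ ?_ ?_ ?_ ?_ ?_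
  · intro t ht
    have := (hw1 (Real.exp t)).hasDerivAt.comp t (Real.hasDerivAt_exp t)
    refine this.congr_deriv ?_
    ring
  · intro t ht
    have := (hw2 (Real.exp t)).hasDerivAt.comp t (Real.hasDerivAt_exp t)
    exact ((Real.hasDerivAt_exp t).mul this).neg
  · intro t ht
    exact hpos _ (haR.trans (hT t ht).le)
  · intro t ht
    exact hwa _ (haR.trans (hT t ht).le)
  · intro t ht
    have := (hsgn _ (haR.trans (hT t ht).le)).2
    have := Real.exp_pos t
    nlinarith
  · intro t ht
    have h1 := hG _ (hT t ht)
    have hx := Real.exp_pos t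
    generalize Real.exp t = x at *
    have h2 := mul_le_mul_of_nonneg_left h1 (by positivity : 0 ≤ x ^ 2)
    have e : x ^ 2 * (c * w x ^ ν * (x ^ 2)⁻¹ + B * x⁻¹ * deriv w x) =
        c * w x ^ ν + B * (x * deriv w x) := by
      field_simp
    rw [e] at h2
    nlinarith
end

section
/- Suppose λ < 1, s > −1 and l < s − 1, and set β = (l − s + 1)/(1 − λ) (so β < 0). Define w(r) = r^β and b(r) = −r^s. Then there exists a ≥ 1 such that the function p(r) := (w''(r) + b(r) w'(r)) / w(r)^λ = β(β−1) r^{l−s−1} − β r^l is continuous and nonnegative on [a,∞), satisfies c_1 r^l ≤ p(r) ≤ c_2 r^l on [a,∞) for some constants c_1, c_2 > 0, and w is a regular Kneser solution of the second-order problem with these b and p: w is smooth with w > 0 and w' ≤ 0 on [a,∞) and w'' + b w' = p w^λ on [a,∞). In particular, the condition l ≥ s − 1 in the preceding singularity result is sharp. -/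
open Set

/-- Example 2.1, sharpness of `l ≥ s - 1`: if `λ < 1`, `s > -1`, `l < s - 1`, and
`β = (l - s + 1)/(1 - λ)` (so `β < 0`), then for `w(r) = r^β`, `b(r) = -r^s` and
`p(r) = β(β-1) r^{l-s-1} - β r^l` there exists `a ≥ 1` such that `p` is continuous and
nonnegative on `[a, ∞)`, `p(r) ∼ r^l` on `[a, ∞)`, and `w` is a regular (everywhere
positive) smooth Kneser solution of `w'' + b w' = p w^λ` on `[a, ∞)`. -/
theorem second_order_regular_solution_of_l_lt_s_sub_one
    (lam s l β : ℝ) (hlam : lam < 1) (hs : -1 < s) (hl : l < s - 1)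
    (hβ : β = (l - s + 1) / (1 - lam))
    (w b p : ℝ → ℝ)
    (hw : w = fun r : ℝ => r ^ β)
    (hb : b = fun r : ℝ => -(r ^ s))
    (hp : p = fun r : ℝ => β * (β - 1) * r ^ (l - s - 1) - β * r ^ l) :
    β < 0 ∧ ∃ a : ℝ, 1 ≤ a ∧
      ContinuousOn p (Ici a) ∧ (∀ r ∈ Ici a, 0 ≤ p r) ∧
      (∃ c₁ > (0 : ℝ), ∃ c₂ > (0 : ℝ), ∀ r ∈ Ici a, c₁ * r ^ l ≤ p r ∧ p r ≤ c₂ * r ^ l) ∧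
      ContDiffOn ℝ (⊤ : ℕ∞) w (Ici a) ∧
      (∀ r ∈ Ici a, 0 < w r) ∧ (∀ r ∈ Ici a, deriv w r ≤ 0) ∧
      (∀ r ∈ Ici a, deriv (deriv w) r + b r * deriv w r = p r * w r ^ lam) := by
  have h1 : 0 < 1 - lam := by linarith
  have hneg : β < 0 := by
    rw [hβ]
    exact div_neg_of_neg_of_pos (by linarith) h1
  have hrel : β * (1 - lam) = l - s + 1 := by
    rw [hβ]
    field_simp
  have hpos : 0 < β * (β - 1) := mul_pos_of_neg_of_neg hneg (by linarith)
  have hr0 : ∀ r ∈ Ici (1 : ℝ), (0 : ℝ) < r := fun r hr => lt_of_lt_of_le one_pos hr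
  have hd : ∀ r : ℝ, 0 < r → deriv w r = β * r ^ (β - 1) := by
    intro r hr
    rw [hw]
    exact (Real.hasDerivAt_rpow_const (Or.inl hr.ne')).deriv
  have hlow : ∀ r ∈ Ici (1 : ℝ), -β * r ^ l ≤ p r := by
    intro r hr
    have : 0 < r ^ (l - s - 1) := Real.rpow_pos_of_pos (hr0 r hr) _
    have := mul_pos hpos this
    simp only [hp]
    linarith
  refine ⟨hneg, 1, le_refl _, ?_, ?_, ⟨-β, by linarith, β * (β - 1) - β, by linarith, ?_⟩,
    ?_, ?_, ?_, ?_⟩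
  · rw [hp]
    intro r hr
    have h0 := (hr0 r hr).ne'
    apply ContinuousAt.continuousWithinAt
    exact (continuousAt_const.mul (Real.continuousAt_rpow_const r _ (Or.inl h0))).sub
      (continuousAt_const.mul (Real.continuousAt_rpow_const r _ (Or.inl h0)))
  · intro r hr
    have : 0 < r ^ l := Real.rpow_pos_of_pos (hr0 r hr) _
    exact le_trans (mul_nonneg (by linarith) this.le) (hlow r hr)
  · intro r hr
    refine ⟨hlow r hr, ?_⟩
    have : r ^ (l - s - 1) ≤ r ^ l := Real.rpow_le_rpow_of_exponent_le hr (by linarith)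
    have := mul_le_mul_of_nonneg_left this hpos.le
    simp only [hp]
    linarith
  · rw [hw]
    intro r hr
    exact (Real.contDiffAt_rpow_const_of_ne (hr0 r hr).ne').contDiffWithinAt
  · intro r hr
    rw [hw]
    exact Real.rpow_pos_of_pos (hr0 r hr) _
  · intro r hr
    rw [hd r (hr0 r hr)]
    exact mul_nonpos_of_nonpos_of_nonneg hneg.le (Real.rpow_pos_of_pos (hr0 r hr) _).le
  · intro r hr
    have h0 := hr0 r hr
    have hdd : deriv (deriv w) r = β * ((β - 1) * r ^ (β - 1 - 1)) := by
      have he : deriv w =ᶠ[nhds r] fun x => β * x ^ (β - 1) := by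
        filter_upwards [lt_mem_nhds h0] with x hx using hd x hx
      rw [he.deriv_eq]
      exact ((Real.hasDerivAt_rpow_const (Or.inl h0.ne')).const_mul β).deriv
    rw [hdd, hd r h0]
    simp only [hp, hb, hw]
    rw [← Real.rpow_mul h0.le, sub_mul (β * (β - 1) * r ^ (l - s - 1)), mul_assoc _ (r ^ (l - s - 1)), mul_assoc β (r ^ l),
      ← Real.rpow_add h0, ← Real.rpow_add h0]
    have e1 : l - s - 1 + β * lam = β - 1 - 1 := by linarith
    have e2 : l + β * lam = s + (β - 1) := by linarith
    rw [e1, e2, Real.rpow_add h0]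
    ring
end
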